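/- arXiv:1701.05182 — 2 statements merged into one kernel-verified Lean document; each statement's English description precedes it below -/
import Mathlib

section
/- Let n ∈ ℕ and let H be an n-qubit Hamiltonian (a Hermitian 2ⁿ×2ⁿ matrix) of the form H = Σ_{i>j} α_{ij} A_{ij} + Σ_k (β_k X_k + γ_k Z_k), where each A_{ij} is one of X_iX_j, X_iZ_j, Z_iX_j, Z_iZ_j and all α_{ij}, β_k, γ_k ∈ ℝ. Then for all η > 0 and ε > 0 there exists Δ₀ > 0 such that for every Δ ≥ Δ₀ there exist: m ∈ ℕ; a Heisenberg Hamiltonian H' on m qubits, i.e. H' = c·1 + Σ_{i<j} w_{ij}·(X_iX_j + Y_iY_j + Z_iZ_j) with c, w_{ij} ∈ ℝ; a partition of the m qubits into n disjoint blocks S₁, …, S_n; isometries V_i : ℂ² → (ℂ²)^{⊗|S_i|}; and an isometry Ṽ : ℂ^{2ⁿ} → ℂ^{2ᵐ}; such that, with V = V₁ ⊗ ⋯ ⊗ V_n regarded as an isometry ℂ^{2ⁿ} → ℂ^{2ᵐ} (after reordering the m qubits according to the blocks): ‖Ṽ − V‖ ≤ η, Ṽ·Ṽ† = P_{≤Δ(H')},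 and ‖H'·P_{≤Δ(H')} − Ṽ·H·Ṽ†‖ ≤ ε. The same statement holds with the Heisenberg interaction X_iX_j + Y_iY_j + Z_iZ_j replaced throughout by the XY interaction X_iX_j + Y_iY_j. -/
open scoped Matrix Kronecker ComplexOrder Classical

noncomputable def opNorm {m n : Type*} [Fintype m] [Fintype n] [DecidableEq n]
    (A : Matrix m n ℂ) : ℝ :=
  ‖LinearMap.toContinuousLinearMap (Matrix.toEuclideanLin A)‖

noncomputable def lowEnergyProj {k : Type*} [Fintype k] [DecidableEq k]
    (A : Matrix k k ℂ) (Δ : ℝ) : Matrix k k ℂ :=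
  if h : A.IsHermitian then
    (h.eigenvectorUnitary : Matrix k k ℂ) *
      Matrix.diagonal (fun i => if h.eigenvalues i ≤ Δ then (1 : ℂ) else 0) *
      star (h.eigenvectorUnitary : Matrix k k ℂ)
  else 0

/-- The Pauli matrices. -/
noncomputable def PX : Matrix (Fin 2) (Fin 2) ℂ := !![0, 1; 1, 0]
noncomputable def PY : Matrix (Fin 2) (Fin 2) ℂ := !![0, -Complex.I; Complex.I, 0]
noncomputable def PZ : Matrix (Fin 2) (Fin 2) ℂ := !![1, 0; 0, -1]

/-- The single-qubit operator `A` acting on qubit `i` of an `m`-qubit system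
(tensored with the identity on all other qubits). -/
noncomputable def onSite {m : ℕ} (i : Fin m) (A : Matrix (Fin 2) (Fin 2) ℂ) :
    Matrix (Fin m → Fin 2) (Fin m → Fin 2) ℂ :=
  Matrix.of fun f g => A (f i) (g i) * ∏ j ∈ Finset.univ.erase i, if f j = g j then 1 else 0

/-- The two-qubit operator `A ⊗ B` acting on distinct qubits `i` and `j`. -/
noncomputable def twoSite {m : ℕ} (i j : Fin m) (A B : Matrix (Fin 2) (Fin 2) ℂ) :
    Matrix (Fin m → Fin 2) (Fin m → Fin 2) ℂ :=
  onSite i A * onSite j B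

/-- The Heisenberg interaction `XᵢXⱼ + YᵢYⱼ + ZᵢZⱼ`. -/
noncomputable def heis {m : ℕ} (i j : Fin m) : Matrix (Fin m → Fin 2) (Fin m → Fin 2) ℂ :=
  twoSite i j PX PX + twoSite i j PY PY + twoSite i j PZ PZ

/-- The XY interaction `XᵢXⱼ + YᵢYⱼ`. -/
noncomputable def xy {m : ℕ} (i j : Fin m) : Matrix (Fin m → Fin 2) (Fin m → Fin 2) ℂ :=
  twoSite i j PX PX + twoSite i j PY PY

section Perturbation

open scoped Matrix.Norms.L2Operator MatrixOrder

set_option linter.unusedSectionVars false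

variable {k l : Type*} [Fintype k] [DecidableEq k] [Fintype l] [DecidableEq l]

theorem norm_le_one_of_conjTranspose_mul_self_eq_one {V : Matrix k l ℂ} (hV : Vᴴ * V = 1) :
    ‖V‖ ≤ 1 := by
  have h := Matrix.l2_opNorm_conjTranspose_mul_self V
  rw [hV] at h
  have h1 : ‖(1 : Matrix l l ℂ)‖ ≤ 1 := by
    rcases subsingleton_or_nontrivial (Matrix l l ℂ) with hs | hs
    · rw [Subsingleton.elim (1 : Matrix l l ℂ) 0, norm_zero]; exact zero_le_one
    · exact CStarRing.norm_one.le
  nlinarith [norm_nonneg V]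

theorem lowEnergyProj_eq_diagonal {A : Matrix k k ℂ} (hA : A.IsHermitian) (Δ : ℝ) :
    lowEnergyProj A Δ = (hA.eigenvectorUnitary : Matrix k k ℂ) *
      Matrix.diagonal (fun i => if hA.eigenvalues i ≤ Δ then (1 : ℂ) else 0) *
      star (hA.eigenvectorUnitary : Matrix k k ℂ) := by
  rw [lowEnergyProj, dif_pos hA]

theorem eq_eigenvectorUnitary_mul_diagonal {A : Matrix k k ℂ} (hA : A.IsHermitian) :
    A = (hA.eigenvectorUnitary : Matrix k k ℂ) *
      Matrix.diagonal (fun i => (hA.eigenvalues i : ℂ)) *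
      star (hA.eigenvectorUnitary : Matrix k k ℂ) := by
  conv_lhs => rw [hA.spectral_theorem]
  rfl

/-- Conjugated diagonal matrices multiply entrywise. -/
theorem unitary_diagonal_mul (U : Matrix.unitaryGroup k ℂ) (x y : k → ℂ) :
    ((U : Matrix k k ℂ) * Matrix.diagonal x * star (U : Matrix k k ℂ)) *
      ((U : Matrix k k ℂ) * Matrix.diagonal y * star (U : Matrix k k ℂ)) =
    (U : Matrix k k ℂ) * Matrix.diagonal (fun i => x i * y i) * star (U : Matrix k k ℂ) := by
  have h : star (U : Matrix k k ℂ) * (U : Matrix k k ℂ) = 1 := Unitary.coe_star_mul_self U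
  calc _ = (U : Matrix k k ℂ) * Matrix.diagonal x * (star (U : Matrix k k ℂ) * U) *
        Matrix.diagonal y * star (U : Matrix k k ℂ) := by simp only [mul_assoc]
    _ = _ := by rw [h, mul_one, mul_assoc (U : Matrix k k ℂ), Matrix.diagonal_mul_diagonal]

theorem lowEnergyProj_mul_self {A : Matrix k k ℂ} (hA : A.IsHermitian) (Δ : ℝ) :
    lowEnergyProj A Δ * lowEnergyProj A Δ = lowEnergyProj A Δ := by
  rw [lowEnergyProj_eq_diagonal hA, unitary_diagonal_mul]
  congr 3
  ext i
  split_ifs <;> simp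

theorem lowEnergyProj_conjTranspose {A : Matrix k k ℂ} (hA : A.IsHermitian) (Δ : ℝ) :
    (lowEnergyProj A Δ)ᴴ = lowEnergyProj A Δ := by
  rw [lowEnergyProj_eq_diagonal hA, ← Matrix.star_eq_conjTranspose, star_mul, star_mul, star_star,
    Matrix.star_eq_conjTranspose (Matrix.diagonal _), Matrix.diagonal_conjTranspose, mul_assoc]
  congr 3
  ext i
  simp only [Pi.star_apply]
  split_ifs <;> simp

theorem lowEnergyProj_comm {A : Matrix k k ℂ} (hA : A.IsHermitian) (Δ : ℝ) :
    A * lowEnergyProj A Δ = lowEnergyProj A Δ * A := by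
  have h := eq_eigenvectorUnitary_mul_diagonal hA
  rw [lowEnergyProj_eq_diagonal hA]
  generalize hA.eigenvectorUnitary = U at *
  generalize hA.eigenvalues = e at *
  subst h
  rw [unitary_diagonal_mul, unitary_diagonal_mul]
  simp only [mul_comm]

theorem mul_lowEnergyProj_le {A : Matrix k k ℂ} (hA : A.IsHermitian) (Δ : ℝ) :
    A * lowEnergyProj A Δ ≤ (Δ : ℂ) • lowEnergyProj A Δ := by
  have h := eq_eigenvectorUnitary_mul_diagonal hA
  rw [lowEnergyProj_eq_diagonal hA]
  generalize hA.eigenvectorUnitary = U at *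
  generalize hA.eigenvalues = e at *
  subst h
  rw [unitary_diagonal_mul, ← smul_mul_assoc, ← mul_smul_comm, ← Matrix.diagonal_smul,
    ← sub_nonneg, ← sub_mul, ← mul_sub, Matrix.diagonal_sub]
  refine star_right_conjugate_nonneg (Matrix.nonneg_iff_posSemidef.2 ?_) _
  refine Matrix.PosSemidef.diagonal fun i => ?_
  simp only [Pi.smul_apply, smul_eq_mul, Pi.zero_apply]
  split_ifs with hi
  · rw [mul_one, mul_one, sub_nonneg]; exact_mod_cast hi
  · simp

/-- `A` is invertible above the cutoff, with inverse of norm at most `Δ⁻¹`. -/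
theorem exists_norm_le_mul_eq_one_sub_lowEnergyProj {A : Matrix k k ℂ} (hA : A.IsHermitian)
    {Δ : ℝ} (hΔ : 0 < Δ) :
    ∃ M : Matrix k k ℂ, ‖M‖ ≤ Δ⁻¹ ∧ M * A = 1 - lowEnergyProj A Δ ∧
      M * (1 - lowEnergyProj A Δ) = M := by
  have h := eq_eigenvectorUnitary_mul_diagonal hA
  rw [lowEnergyProj_eq_diagonal hA]
  generalize hA.eigenvectorUnitary = U at *
  generalize hA.eigenvalues = e at *
  have h1 : (1 : Matrix k k ℂ) = (U : Matrix k k ℂ) * Matrix.diagonal (fun _ => 1) *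
      star (U : Matrix k k ℂ) := by
    rw [Matrix.diagonal_one, mul_one]; exact (Unitary.coe_mul_star_self U).symm
  refine ⟨(U : Matrix k k ℂ) * Matrix.diagonal (fun i => if e i ≤ Δ then (0 : ℂ) else (e i : ℂ)⁻¹) *
      star (U : Matrix k k ℂ), ?_, ?_, ?_⟩
  · rw [CStarRing.norm_mul_mem_unitary _ (Unitary.star_mem U.2), CStarRing.norm_coe_unitary_mul,
      Matrix.l2_opNorm_diagonal, pi_norm_le_iff_of_nonneg (by positivity)]
    intro i
    split_ifs with hi
    · simpa using hΔ.le
    · push Not at hi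
      rw [norm_inv, Complex.norm_real, Real.norm_of_nonneg (hΔ.trans hi).le]
      gcongr
  · rw [h1, ← sub_mul, ← mul_sub, Matrix.diagonal_sub]
    conv_lhs => rw [h]
    rw [unitary_diagonal_mul]
    congr 3
    ext i
    split_ifs with hi
    · simp
    · push Not at hi
      have : (e i : ℂ) ≠ 0 := by exact_mod_cast (hΔ.trans hi).ne'
      simp [this]
  · rw [h1, ← sub_mul, ← mul_sub, Matrix.diagonal_sub, unitary_diagonal_mul]
    congr 3
    ext i
    split_ifs <;> simp

theorem norm_sub_one_le_norm_mul_self_sub_one {M : Matrix k k ℂ} (hM : 0 ≤ M) :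
    ‖M - 1‖ ≤ ‖M * M - 1‖ := by
  have hA := (Matrix.nonneg_iff_posSemidef.1 hM).isHermitian
  have he := (Matrix.nonneg_iff_posSemidef.1 hM).eigenvalues_nonneg
  have h := eq_eigenvectorUnitary_mul_diagonal hA
  change ∀ i, 0 ≤ hA.eigenvalues i at he
  generalize hA.eigenvectorUnitary = U at *
  generalize hA.eigenvalues = e at *
  have h1 : (1 : Matrix k k ℂ) = (U : Matrix k k ℂ) * Matrix.diagonal (fun _ => 1) *
      star (U : Matrix k k ℂ) := by
    rw [Matrix.diagonal_one, mul_one]; exact (Unitary.coe_mul_star_self U).symm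
  rw [h, unitary_diagonal_mul, h1, ← sub_mul, ← mul_sub, ← sub_mul, ← mul_sub,
    Matrix.diagonal_sub, Matrix.diagonal_sub]
  simp only [CStarRing.norm_mul_mem_unitary _ (Unitary.star_mem U.2),
    CStarRing.norm_coe_unitary_mul, Matrix.l2_opNorm_diagonal]
  refine (pi_norm_le_iff_of_nonneg (norm_nonneg _)).2 fun i => ?_
  refine le_trans ?_ (norm_le_pi_norm _ i)
  have : (e i : ℂ) * e i - 1 = (e i - 1) * ((e i + 1 : ℝ) : ℂ) := by push_cast; ring
  rw [this, norm_mul, Complex.norm_real, Real.norm_of_nonneg (by linarith [he i])]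
  nlinarith [norm_nonneg ((e i : ℂ) - 1), he i]

/-- Polar decomposition of a near-isometry. -/
theorem exists_polar_of_norm_sub_one_le {S : Matrix k l ℂ} {κ : ℝ} (hκ : κ ≤ 1 / 2)
    (hS : ‖Sᴴ * S - 1‖ ≤ κ) :
    ∃ (W : Matrix k l ℂ) (M N : Matrix l l ℂ), Wᴴ * W = 1 ∧ S = W * M ∧ M * N = 1 ∧ N * M = 1 ∧
      ‖M - 1‖ ≤ κ ∧ ‖N‖ ≤ 2 := by
  have hnn : 0 ≤ Sᴴ * S :=
    Matrix.nonneg_iff_posSemidef.2 (Matrix.posSemidef_conjTranspose_mul_self S)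
  set M := CFC.sqrt (Sᴴ * S) with hM
  have hM0 : 0 ≤ M := CFC.sqrt_nonneg _
  have hMM : M * M = Sᴴ * S := CFC.sqrt_mul_sqrt_self _ hnn
  have hMh : Mᴴ = M := (Matrix.nonneg_iff_posSemidef.1 hM0).isHermitian
  have hM1 : ‖M - 1‖ ≤ κ := by
    refine le_trans ?_ hS
    rw [← hMM]
    exact norm_sub_one_le_norm_mul_self_sub_one hM0
  obtain ⟨u, hu⟩ : IsUnit M := by
    have : ‖1 - M‖ < 1 := by rw [norm_sub_rev]; linarith
    simpa using isUnit_one_sub_of_norm_lt_one this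
  refine ⟨S * (↑u⁻¹ : Matrix l l ℂ), M, (↑u⁻¹ : Matrix l l ℂ), ?_, ?_, ?_, ?_, hM1, ?_⟩
  · rw [← hu] at hMM hMh
    rw [Matrix.conjTranspose_mul, Matrix.mul_assoc, ← Matrix.mul_assoc Sᴴ, ← hMM,
      Matrix.mul_assoc, Units.mul_inv, Matrix.mul_one, ← hMh, ← Matrix.conjTranspose_mul, Units.mul_inv, Matrix.conjTranspose_one]
  · rw [Matrix.mul_assoc, ← hu, Units.inv_mul, Matrix.mul_one]
  · rw [← hu]; simp
  · rw [← hu]; simp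
  · have h1 : (↑u⁻¹ : Matrix l l ℂ) = 1 - (↑u⁻¹ : Matrix l l ℂ) * (M - 1) := by
      rw [← hu, Matrix.mul_sub, Units.inv_mul]; simp
    have h2 : ‖(↑u⁻¹ : Matrix l l ℂ)‖ ≤ 1 + ‖(↑u⁻¹ : Matrix l l ℂ)‖ * κ := by
      conv_lhs => rw [h1]
      refine (norm_sub_le _ _).trans (add_le_add ?_ ((norm_mul_le _ _).trans (by gcongr)))
      exact norm_le_one_of_conjTranspose_mul_self_eq_one (by simp)
    nlinarith [norm_nonneg (↑u⁻¹ : Matrix l l ℂ)]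

/-- An approximate intertwiner `T` close to an isometry `V` can be corrected to an exact
isometry into the low-energy space. -/
theorem exists_isometry_of_approx {A : Matrix k k ℂ} (hA : A.IsHermitian) {Δ : ℝ}
    {H : Matrix l l ℂ} (hH : ‖H‖ < Δ) {V T : Matrix k l ℂ} (hV : Vᴴ * V = 1) {σ κ ρ : ℝ}
    (hρ : ‖A * T - T * H‖ ≤ ρ) (hσ : ‖T - V‖ + ρ / (Δ - ‖H‖) ≤ σ) (hκ : 2 * σ + σ ^ 2 ≤ κ)
    (hκ' : κ ≤ 1 / 2) :
    ∃ W : Matrix k l ℂ, Wᴴ * W = 1 ∧ lowEnergyProj A Δ * W = W ∧ ‖W - V‖ ≤ κ + σ ∧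
      ‖A * W - W * H‖ ≤ 2 * (2 * ‖H‖ * κ + ρ) := by
  obtain ⟨M, hM, hMA, hMQ⟩ :=
    exists_norm_le_mul_eq_one_sub_lowEnergyProj hA ((norm_nonneg H).trans_lt hH)
  have hQQ := lowEnergyProj_mul_self hA Δ
  have hQA := lowEnergyProj_comm hA Δ
  have hQh := lowEnergyProj_conjTranspose hA Δ
  set Q := lowEnergyProj A Δ
  have hQ1 : ‖Q‖ ≤ 1 := by
    have h := Matrix.l2_opNorm_conjTranspose_mul_self Q
    rw [hQh, hQQ] at h
    by_contra! hlt
    nlinarith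
  have hΔ : 0 < Δ := (norm_nonneg H).trans_lt hH
  have hgap : 0 < Δ - ‖H‖ := sub_pos.2 hH
  have hρ0 : 0 ≤ ρ := (norm_nonneg _).trans hρ
  set Y := (1 - Q) * T with hY
  have hYeq : Y = M * (Y * H + (A * T - T * H)) := by
    have h1 : Y = M * (A * T) := by rw [hY, ← hMA, Matrix.mul_assoc]
    have h2 : M * (Y * H) = M * (T * H) := by
      rw [hY, ← Matrix.mul_assoc, ← Matrix.mul_assoc, hMQ, Matrix.mul_assoc]
    rw [Matrix.mul_add, Matrix.mul_sub, h2, ← h1]; abel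
  have hYn : ‖Y‖ ≤ ρ / (Δ - ‖H‖) := by
    have h1 : ‖Y‖ ≤ Δ⁻¹ * (‖Y‖ * ‖H‖ + ρ) := by
      conv_lhs => rw [hYeq]
      refine (Matrix.l2_opNorm_mul _ _).trans ?_
      gcongr
      refine (norm_add_le _ _).trans (add_le_add (Matrix.l2_opNorm_mul _ _) hρ)
    rw [le_div_iff₀ hgap]
    rw [inv_mul_eq_div, le_div_iff₀ hΔ] at h1
    linarith
  set S := Q * T with hS
  have hSV : ‖S - V‖ ≤ σ := by
    have : S - V = (T - V) - Y := by rw [hS, hY, Matrix.sub_mul, Matrix.one_mul]; abel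
    rw [this]
    exact (norm_sub_le _ _).trans ((add_le_add le_rfl hYn).trans hσ)
  have hσ0 : 0 ≤ σ := (norm_nonneg _).trans hSV
  have hV1 := norm_le_one_of_conjTranspose_mul_self_eq_one hV
  have hSS : ‖Sᴴ * S - 1‖ ≤ κ := by
    have : Sᴴ * S - 1 = (S - V)ᴴ * (S - V) + ((S - V)ᴴ * V + Vᴴ * (S - V)) := by
      rw [← hV, Matrix.conjTranspose_sub, Matrix.sub_mul, Matrix.mul_sub, Matrix.mul_sub,
        Matrix.sub_mul]
      abel
    rw [this]
    have h1 : ‖(S - V)ᴴ‖ ≤ σ := by rwa [Matrix.l2_opNorm_conjTranspose]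
    have h2 : ‖Vᴴ‖ ≤ 1 := by rwa [Matrix.l2_opNorm_conjTranspose]
    have ha : ‖(S - V)ᴴ * (S - V)‖ ≤ σ * σ := (Matrix.l2_opNorm_mul _ _).trans (by gcongr)
    have hb : ‖(S - V)ᴴ * V‖ ≤ σ * 1 := (Matrix.l2_opNorm_mul _ _).trans (by gcongr)
    have hc : ‖Vᴴ * (S - V)‖ ≤ 1 * σ := (Matrix.l2_opNorm_mul _ _).trans (by gcongr)
    have hd := norm_add_le ((S - V)ᴴ * (S - V)) ((S - V)ᴴ * V + Vᴴ * (S - V))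
    have he := norm_add_le ((S - V)ᴴ * V) (Vᴴ * (S - V))
    nlinarith
  obtain ⟨W, P, N, hW, hSW, hPN, hNP, hP, hN⟩ := exists_polar_of_norm_sub_one_le hκ' hSS
  have hκ0 : 0 ≤ κ := (norm_nonneg _).trans hP
  have hW1 := norm_le_one_of_conjTranspose_mul_self_eq_one hW
  have hWS : W = S * N := by rw [hSW, Matrix.mul_assoc, hPN, Matrix.mul_one]
  refine ⟨W, hW, ?_, ?_, ?_⟩
  · rw [hWS, hS, ← Matrix.mul_assoc, ← Matrix.mul_assoc, hQQ]
  · have : W - V = (S - V) - W * (P - 1) := by rw [Matrix.mul_sub, ← hSW, Matrix.mul_one]; abel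
    rw [this, add_comm κ]
    refine (norm_sub_le _ _).trans (add_le_add hSV ((Matrix.l2_opNorm_mul _ _).trans ?_))
    nlinarith [norm_nonneg W, norm_nonneg (P - 1)]
  · have hAS : A * S = S * H + Q * (A * T - T * H) := by
      rw [hS, Matrix.mul_sub, ← Matrix.mul_assoc A, hQA, Matrix.mul_assoc,
        Matrix.mul_assoc Q T]
      abel
    have : A * W - W * H = (W * ((P - 1) * H - H * (P - 1)) + Q * (A * T - T * H)) * N := by
      have h1 : A * W = A * S * N := by rw [Matrix.mul_assoc, ← hWS]
      have h2 : W * H = W * H * P * N := by rw [Matrix.mul_assoc _ P, hPN, Matrix.mul_one]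
      rw [h1, hAS]
      conv_lhs => rw [h2]
      rw [← Matrix.sub_mul, hSW]
      congr 1
      simp only [Matrix.mul_sub, Matrix.sub_mul, Matrix.mul_one, Matrix.one_mul, Matrix.mul_assoc]
      abel
    rw [this]
    have h1 : ‖(P - 1) * H - H * (P - 1)‖ ≤ 2 * ‖H‖ * κ := by
      refine (norm_sub_le _ _).trans ?_
      have ha := norm_mul_le (P - 1) H
      have hb := norm_mul_le H (P - 1)
      nlinarith [norm_nonneg H]
    have h2 : ‖W * ((P - 1) * H - H * (P - 1))‖ ≤ 1 * (2 * ‖H‖ * κ) :=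
      (Matrix.l2_opNorm_mul _ _).trans (by gcongr)
    have h3 : ‖Q * (A * T - T * H)‖ ≤ 1 * ρ := (Matrix.l2_opNorm_mul _ _).trans (by gcongr)
    calc _ ≤ (1 * (2 * ‖H‖ * κ) + 1 * ρ) * 2 := by
          refine (Matrix.l2_opNorm_mul _ _).trans ?_
          gcongr
          exact (norm_add_le _ _).trans (add_le_add h2 h3)
      _ = _ := by ring

theorem PosDef.exists_smul_one_le {G : Matrix k k ℂ} (hG : G.PosDef) :
    ∃ g : ℝ, 0 < g ∧ (g : ℂ) • (1 : Matrix k k ℂ) ≤ G := by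
  rcases subsingleton_or_nontrivial (Matrix k k ℂ) with hs | hs
  · exact ⟨1, one_pos, (Subsingleton.elim _ _).le⟩
  · have h := Matrix.isStrictlyPositive_iff_posDef.2 hG
    obtain ⟨g, hg, hle⟩ := (CFC.exists_pos_algebraMap_le_iff h.isSelfAdjoint).2
      fun x hx => h.spectrum_pos hx
    refine ⟨g, hg, ?_⟩
    rw [Algebra.algebraMap_eq_smul_one] at hle
    convert hle using 1
    ext i j
    simp

/-- If `A` is a large multiple of `K` up to lower-order terms, an isometry into the low-energy
space of `A` that is close to the kernel of `K` is onto. -/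
theorem mul_conjTranspose_eq_lowEnergyProj {A K B C : Matrix k k ℂ} {V W : Matrix k l ℂ}
    {x g δ Δ : ℝ} (hA : A.IsHermitian) (hAeq : A = ((x ^ 2 : ℝ) : ℂ) • K + (x : ℂ) • B + C)
    (hg : (g : ℂ) • (1 : Matrix k k ℂ) ≤ K + V * Vᴴ) (hW : Wᴴ * W = 1)
    (hQW : lowEnergyProj A Δ * W = W) (hWV : ‖W - V‖ ≤ δ)
    (hx : x ^ 2 * δ ^ 2 + |x| * ‖B‖ + ‖C‖ + Δ < x ^ 2 * g) :
    W * Wᴴ = lowEnergyProj A Δ := by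
  have hQQ := lowEnergyProj_mul_self hA Δ
  have hQh := lowEnergyProj_conjTranspose hA Δ
  have hAQ := mul_lowEnergyProj_le hA Δ
  generalize lowEnergyProj A Δ = Q at *
  have hWQ : Wᴴ * Q = Wᴴ := by
    conv_lhs => rw [← hQh, ← Matrix.conjTranspose_mul, hQW]
  obtain ⟨E, hE⟩ : ∃ E, E = Q - W * Wᴴ := ⟨_, rfl⟩
  have hEh : Eᴴ = E := by
    rw [hE, Matrix.conjTranspose_sub, hQh, Matrix.conjTranspose_mul,
      Matrix.conjTranspose_conjTranspose]
  have hWE : Wᴴ * E = 0 := by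
    rw [hE, Matrix.mul_sub, hWQ, ← Matrix.mul_assoc, hW, Matrix.one_mul, sub_self]
  have hQE : Q * E = E := by
    rw [hE, Matrix.mul_sub, hQQ, ← Matrix.mul_assoc, hQW]
  have hEE : E * E = E := by
    conv_lhs => rw [hE, Matrix.sub_mul, ← hE, hQE, Matrix.mul_assoc, hWE, Matrix.mul_zero, sub_zero]
  have hEn : ‖E‖ = ‖E‖ * ‖E‖ := by
    have := Matrix.l2_opNorm_conjTranspose_mul_self E
    rwa [hEh, hEE] at this
  have h1 : 0 ≤ (Δ : ℂ) • E - E * A * E := by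
    have h := star_left_conjugate_le_conjugate hAQ E
    rw [Matrix.star_eq_conjTranspose, hEh, mul_assoc, mul_assoc, hQE, mul_smul_comm, smul_mul_assoc,
      mul_assoc, hQE, hEE, ← mul_assoc] at h
    exact sub_nonneg.2 h
  have h2 : 0 ≤ E * K * E + E * V * (Vᴴ * E) - (g : ℂ) • E := by
    have h := star_left_conjugate_le_conjugate hg E
    rw [Matrix.star_eq_conjTranspose, hEh, mul_smul_comm, smul_mul_assoc, mul_one, hEE, mul_add,
      add_mul] at h
    rw [sub_nonneg]
    convert h using 2
    simp only [Matrix.mul_assoc]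
  obtain ⟨Z, hZ⟩ : ∃ Z, Z = ((x ^ 2 : ℝ) : ℂ) • (E * V * (Vᴴ * E)) - (x : ℂ) • (E * B * E) -
    E * C * E := ⟨_, rfl⟩
  have h3 : ((x ^ 2 * g - Δ : ℝ) : ℂ) • E ≤ Z := by
    rw [← sub_nonneg]
    have h4 : Z - ((x ^ 2 * g - Δ : ℝ) : ℂ) • E =
        ((x ^ 2 : ℝ) : ℂ) • (E * K * E + E * V * (Vᴴ * E) - (g : ℂ) • E) +
          ((Δ : ℂ) • E - E * A * E) := by
      rw [hZ, hAeq, mul_add, mul_add, add_mul, add_mul, mul_smul_comm, mul_smul_comm,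
        smul_mul_assoc, smul_mul_assoc]
      push_cast
      module
    rw [h4]
    refine add_nonneg ?_ h1
    rw [Matrix.nonneg_iff_posSemidef] at h2 ⊢
    exact h2.smul (by exact_mod_cast sq_nonneg x)
  have hE0 : 0 ≤ E := by
    rw [Matrix.nonneg_iff_posSemidef, ← hEE]
    nth_rw 1 [← hEh]
    exact Matrix.posSemidef_conjTranspose_mul_self E
  have hpos : 0 < x ^ 2 * g - Δ := by
    have : 0 ≤ x ^ 2 * δ ^ 2 + |x| * ‖B‖ + ‖C‖ := by positivity
    linarith
  have hVE : ‖Vᴴ * E‖ ≤ δ * ‖E‖ := by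
    have : Vᴴ * E = -((W - V)ᴴ * E) := by
      rw [Matrix.conjTranspose_sub, Matrix.sub_mul, hWE, zero_sub, neg_neg]
    rw [this, norm_neg]
    refine (Matrix.l2_opNorm_mul _ _).trans ?_
    rw [Matrix.l2_opNorm_conjTranspose]
    gcongr
  have hEV : ‖E * V‖ ≤ δ * ‖E‖ := by
    have : E * V = (Vᴴ * E)ᴴ := by
      rw [Matrix.conjTranspose_mul, hEh, Matrix.conjTranspose_conjTranspose]
    rwa [this, Matrix.l2_opNorm_conjTranspose]
  have hδ : 0 ≤ δ := (norm_nonneg _).trans hWV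
  have h5 : (x ^ 2 * g - Δ) * ‖E‖ ≤ ‖Z‖ := by
    have h0 : 0 ≤ ((x ^ 2 * g - Δ : ℝ) : ℂ) • E := by
      rw [Matrix.nonneg_iff_posSemidef] at hE0 ⊢
      exact hE0.smul (by exact_mod_cast hpos.le)
    have := CStarAlgebra.norm_le_norm_of_nonneg_of_le h0 h3
    rwa [norm_smul, Complex.norm_real, Real.norm_of_nonneg hpos.le] at this
  have h3n : ∀ D : Matrix k k ℂ, ‖E * D * E‖ ≤ ‖E‖ * ‖D‖ * ‖E‖ := fun D =>
    (norm_mul_le _ _).trans (mul_le_mul_of_nonneg_right (norm_mul_le _ _) (norm_nonneg _))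
  have h6 : ‖Z‖ ≤ (x ^ 2 * δ ^ 2 + |x| * ‖B‖ + ‖C‖) * (‖E‖ * ‖E‖) := by
    have ha : ‖((x ^ 2 : ℝ) : ℂ) • (E * V * (Vᴴ * E))‖ ≤ x ^ 2 * ((δ * ‖E‖) * (δ * ‖E‖)) := by
      rw [norm_smul, Complex.norm_real, Real.norm_of_nonneg (sq_nonneg x)]
      exact mul_le_mul_of_nonneg_left ((Matrix.l2_opNorm_mul _ _).trans
        (mul_le_mul hEV hVE (norm_nonneg _) (mul_nonneg hδ (norm_nonneg _)))) (sq_nonneg x)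
    have hb : ‖(x : ℂ) • (E * B * E)‖ ≤ |x| * (‖E‖ * ‖B‖ * ‖E‖) := by
      rw [norm_smul, Complex.norm_real, Real.norm_eq_abs]
      exact mul_le_mul_of_nonneg_left (h3n B) (abs_nonneg x)
    have hc : ‖E * C * E‖ ≤ ‖E‖ * ‖C‖ * ‖E‖ := h3n C
    have hd := norm_sub_le (((x ^ 2 : ℝ) : ℂ) • (E * V * (Vᴴ * E)) - (x : ℂ) • (E * B * E))
      (E * C * E)
    have he := norm_sub_le (((x ^ 2 : ℝ) : ℂ) • (E * V * (Vᴴ * E))) ((x : ℂ) • (E * B * E))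
    rw [← hZ] at hd
    linarith
  rw [← hEn] at h6
  have h7 : ‖E‖ = 0 := by nlinarith [norm_nonneg E]
  exact (sub_eq_zero.1 (hE ▸ norm_eq_zero.1 h7)).symm

theorem posDef_add_mul_conjTranspose {K : Matrix k k ℂ} {V : Matrix k l ℂ} (hK : K.PosSemidef)
    (hV : Vᴴ * V = 1) (hKV : K * V = 0) (hker : ∀ u, K *ᵥ u = 0 → V *ᵥ (Vᴴ *ᵥ u) = u) :
    (K + V * Vᴴ).PosDef := by
  have hVK : Vᴴ * K = 0 := by
    rw [← hK.isHermitian.eq, ← Matrix.conjTranspose_mul, hKV, Matrix.conjTranspose_zero]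
  refine (hK.add (Matrix.posSemidef_self_mul_conjTranspose V)).posDef_iff_isUnit.2 ?_
  rw [← Matrix.mulVec_injective_iff_isUnit]
  refine (injective_iff_map_eq_zero (Matrix.mulVecLin (K + V * Vᴴ))).2 fun u hu => ?_
  rw [Matrix.mulVecLin_apply] at hu
  have h1 : Vᴴ *ᵥ u = 0 := by
    have : Vᴴ * (K + V * Vᴴ) = Vᴴ := by
      rw [Matrix.mul_add, hVK, ← Matrix.mul_assoc, hV, Matrix.one_mul, zero_add]
    rw [← this, ← Matrix.mulVec_mulVec, hu, Matrix.mulVec_zero]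
  have h2 : K *ᵥ u = 0 := by
    rwa [Matrix.add_mulVec, ← Matrix.mulVec_mulVec, h1, Matrix.mulVec_zero, add_zero] at hu
  rw [← hker u h2, h1, Matrix.mulVec_zero]

/-- A Hermitian `K` with kernel `V` is solvable on the complement of `V`. -/
theorem exists_mul_eq_of_conjTranspose_mul_eq_zero {K : Matrix k k ℂ} {V R : Matrix k l ℂ}
    (hK : K.PosSemidef) (hV : Vᴴ * V = 1) (hKV : K * V = 0)
    (hker : ∀ u, K *ᵥ u = 0 → V *ᵥ (Vᴴ *ᵥ u) = u) (hVR : Vᴴ * R = 0) :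
    ∃ T : Matrix k l ℂ, K * T = R := by
  have hVK : Vᴴ * K = 0 := by
    rw [← hK.isHermitian.eq, ← Matrix.conjTranspose_mul, hKV, Matrix.conjTranspose_zero]
  obtain ⟨G, hGu⟩ := (posDef_add_mul_conjTranspose hK hV hKV hker).isUnit
  refine ⟨(↑G⁻¹ : Matrix k k ℂ) * R, ?_⟩
  have h1 : Vᴴ * (↑G⁻¹ : Matrix k k ℂ) = Vᴴ := by
    have : Vᴴ * (G : Matrix k k ℂ) = Vᴴ := by
      rw [hGu, Matrix.mul_add, hVK, ← Matrix.mul_assoc, hV, Matrix.one_mul, zero_add]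
    conv_lhs => rw [← this, Matrix.mul_assoc, Units.mul_inv, Matrix.mul_one]
  have h2 : K = (G : Matrix k k ℂ) - V * Vᴴ := by rw [hGu]; abel
  rw [h2, Matrix.sub_mul, ← Matrix.mul_assoc, Units.mul_inv, Matrix.one_mul, Matrix.mul_assoc V,
    ← Matrix.mul_assoc Vᴴ, h1, hVR, Matrix.mul_zero, sub_zero]

theorem exists_one_le_forall_div_le {q₁ q₂ q₃ q₄ q₅ b₁ b₂ b₃ b₄ b₅ : ℝ} (h₁ : 0 < b₁) (h₂ : 0 < b₂)
    (h₃ : 0 < b₃) (h₄ : 0 < b₄) (h₅ : 0 < b₅) :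
    ∃ x : ℝ, 1 ≤ x ∧ q₁ / x ≤ b₁ ∧ q₂ / x ≤ b₂ ∧ q₃ / x ≤ b₃ ∧ q₄ / x ≤ b₄ ∧ q₅ / x < b₅ := by
  have h : ∀ a b : ℝ, 0 < b → ∀ᶠ x : ℝ in Filter.atTop, a / x < b := fun a b hb =>
    ((tendsto_const_nhds (x := a)).div_atTop Filter.tendsto_id).eventually_lt_const hb
  obtain ⟨x, hx, a₁, a₂, a₃, a₄, a₅⟩ := ((Filter.eventually_ge_atTop (1 : ℝ)).and
    ((h q₁ b₁ h₁).and ((h q₂ b₂ h₂).and ((h q₃ b₃ h₃).and ((h q₄ b₄ h₄).and (h q₅ b₅ h₅)))))).exists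
  exact ⟨x, hx, a₁.le, a₂.le, a₃.le, a₄.le, a₅⟩

set_option maxHeartbeats 800000 in
/-- Second-order perturbation theory: if `K` has kernel `V`, if `B` maps the kernel out of itself,
and if the second-order effective Hamiltonian of `B` plus the first-order one of `C` is `H`, then
`x² K + x B + C` simulates `H` for some large `x`. -/
theorem exists_second_order_simulation {K B C : Matrix k k ℂ} {V T₁ : Matrix k l ℂ}
    {H : Matrix l l ℂ} (hK : K.PosSemidef) (hB : B.IsHermitian) (hC : C.IsHermitian)
    (hV : Vᴴ * V = 1) (hKV : K * V = 0) (hker : ∀ u, K *ᵥ u = 0 → V *ᵥ (Vᴴ *ᵥ u) = u)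
    (hT₁ : K * T₁ = -(B * V)) (hH : Vᴴ * (B * T₁ + C * V) = H) {Δ η ε : ℝ} (hΔ : ‖H‖ < Δ)
    (hη : 0 < η) (hε : 0 < ε) :
    ∃ (x : ℝ) (W : Matrix k l ℂ), Wᴴ * W = 1 ∧ ‖W - V‖ ≤ η ∧
      W * Wᴴ = lowEnergyProj (((x ^ 2 : ℝ) : ℂ) • K + (x : ℂ) • B + C) Δ ∧
      ‖(((x ^ 2 : ℝ) : ℂ) • K + (x : ℂ) • B + C) *
        lowEnergyProj (((x ^ 2 : ℝ) : ℂ) • K + (x : ℂ) • B + C) Δ - W * H * Wᴴ‖ ≤ ε := by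
  obtain ⟨g, hg0, hg⟩ := PosDef.exists_smul_one_le (posDef_add_mul_conjTranspose hK hV hKV hker)
  obtain ⟨T₂, hT₂⟩ : ∃ T₂ : Matrix k l ℂ, K * T₂ = V * H - B * T₁ - C * V := by
    refine exists_mul_eq_of_conjTranspose_mul_eq_zero hK hV hKV hker ?_
    rw [sub_sub, Matrix.mul_sub, hH, ← Matrix.mul_assoc, hV, Matrix.one_mul, sub_self]
  obtain ⟨t, ht⟩ : ∃ t, t = ‖T₁‖ + ‖T₂‖ := ⟨_, rfl⟩
  obtain ⟨r, hr⟩ : ∃ r, r = ‖B * T₂ + C * T₁ - T₁ * H‖ + ‖C * T₂ - T₂ * H‖ := ⟨_, rfl⟩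
  obtain ⟨s, hs⟩ : ∃ s, s = t + r / (Δ - ‖H‖) := ⟨_, rfl⟩
  obtain ⟨q, hq⟩ : ∃ q, q = 2 * s + s ^ 2 := ⟨_, rfl⟩
  have hgap : 0 < Δ - ‖H‖ := sub_pos.2 hΔ
  have ht0 : 0 ≤ t := ht ▸ add_nonneg (norm_nonneg _) (norm_nonneg _)
  have hr0 : 0 ≤ r := hr ▸ add_nonneg (norm_nonneg _) (norm_nonneg _)
  have hs0 : 0 ≤ s := hs ▸ add_nonneg ht0 (div_nonneg hr0 hgap.le)
  have hq0 : 0 ≤ q := hq ▸ by positivity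
  obtain ⟨δ, hδ0, hδ2⟩ : ∃ δ : ℝ, 0 < δ ∧ δ ^ 2 = g / 2 :=
    ⟨Real.sqrt (g / 2), Real.sqrt_pos.2 (half_pos hg0), Real.sq_sqrt (half_pos hg0).le⟩
  obtain ⟨x, hx1, hxq, hxη, hxδ, hxε, hxg⟩ := exists_one_le_forall_div_le (q₁ := q) (q₂ := q + s)
    (q₃ := q + s) (q₄ := 2 * (2 * ‖H‖ * q + r)) (q₅ := ‖B‖ + ‖C‖ + Δ) one_half_pos hη hδ0 hε
    (half_pos hg0)
  have hx0 : 0 < x := one_pos.trans_le hx1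
  have hxi : x⁻¹ ≤ 1 := inv_le_one_of_one_le₀ hx1
  have hxi2 : (x⁻¹) ^ 2 ≤ x⁻¹ := by nlinarith [inv_pos.2 hx0]
  have hxc : (x : ℂ) ≠ 0 := by exact_mod_cast hx0.ne'
  obtain ⟨A, hAdef⟩ : ∃ A, A = ((x ^ 2 : ℝ) : ℂ) • K + (x : ℂ) • B + C := ⟨_, rfl⟩
  have hA : A.IsHermitian := by
    rw [hAdef]
    refine ((Matrix.IsHermitian.add ?_ ?_).add hC)
    · exact hK.isHermitian.smul (by simp [IsSelfAdjoint])
    · exact hB.smul (by simp [IsSelfAdjoint])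
  obtain ⟨T, hT⟩ : ∃ T, T = V + (((x⁻¹ : ℝ) : ℂ) • T₁ + (((x⁻¹) ^ 2 : ℝ) : ℂ) • T₂) := ⟨_, rfl⟩
  have hnorm : ∀ (X Y : Matrix k l ℂ),
      ‖((x⁻¹ : ℝ) : ℂ) • X + (((x⁻¹) ^ 2 : ℝ) : ℂ) • Y‖ ≤ (‖X‖ + ‖Y‖) / x := by
    intro X Y
    refine (norm_add_le _ _).trans ?_
    rw [norm_smul, norm_smul, Complex.norm_real, Complex.norm_real,
      Real.norm_of_nonneg (inv_pos.2 hx0).le, Real.norm_of_nonneg (sq_nonneg _), div_eq_inv_mul]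
    nlinarith [norm_nonneg X, norm_nonneg Y]
  have hTV : ‖T - V‖ ≤ t / x := by
    rw [hT, ht, add_sub_cancel_left]
    exact hnorm _ _
  have hρ : ‖A * T - T * H‖ ≤ r / x := by
    have : A * T - T * H = ((x⁻¹ : ℝ) : ℂ) • (B * T₂ + C * T₁ - T₁ * H) +
        (((x⁻¹) ^ 2 : ℝ) : ℂ) • (C * T₂ - T₂ * H) := by
      rw [hAdef, hT]
      simp only [Matrix.mul_add, Matrix.add_mul, Matrix.smul_mul, Matrix.mul_smul, hKV, hT₁, hT₂]
      push_cast
      match_scalars <;> field_simp <;> ring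
    rw [this, hr]
    exact hnorm _ _
  obtain ⟨W, hW, hQW, hWV, hWH⟩ := exists_isometry_of_approx hA hΔ hV (σ := s / x) (κ := q / x) hρ
    (by rw [hs]; refine (add_le_add hTV le_rfl).trans (le_of_eq ?_); field_simp)
    (by
      rw [hq, div_pow, add_div, mul_div_assoc]
      gcongr
      nlinarith) hxq
  rw [← add_div] at hWV
  have hWQ : W * Wᴴ = lowEnergyProj A Δ := by
    refine mul_conjTranspose_eq_lowEnergyProj hA hAdef hg hW hQW (hWV.trans hxδ) ?_
    rw [hδ2, abs_of_pos hx0]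
    rw [div_lt_iff₀ hx0] at hxg
    have hΔ0 : 0 < Δ := (norm_nonneg H).trans_lt hΔ
    nlinarith [norm_nonneg B, norm_nonneg C]
  refine ⟨x, W, hW, hWV.trans hxη, by rw [← hAdef]; exact hWQ, ?_⟩
  rw [← hAdef, ← hWQ, ← Matrix.mul_assoc, ← Matrix.sub_mul]
  refine (Matrix.l2_opNorm_mul _ _).trans ?_
  rw [Matrix.l2_opNorm_conjTranspose]
  have h1 := norm_le_one_of_conjTranspose_mul_self_eq_one hW
  have h2 : ‖A * W - W * H‖ ≤ ε := by
    refine hWH.trans (le_trans (le_of_eq ?_) hxε)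
    field_simp
  nlinarith [norm_nonneg W, norm_nonneg (A * W - W * H)]

end Perturbation

section TensorProducts

set_option linter.unusedSectionVars false

variable {ι κ κ' κ'' : Type*} [Fintype ι] [DecidableEq ι]

/-- The tensor product of a family of matrices. -/
def tens (A : ι → Matrix κ κ' ℂ) : Matrix (ι → κ) (ι → κ') ℂ :=
  Matrix.of fun f g => ∏ i, A i (f i) (g i)

theorem tens_apply (A : ι → Matrix κ κ' ℂ) (f : ι → κ) (g : ι → κ') :
    tens A f g = ∏ i, A i (f i) (g i) := rfl

theorem tens_mul_tens [Fintype κ'] (A : ι → Matrix κ κ' ℂ) (B : ι → Matrix κ' κ'' ℂ) :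
    tens A * tens B = tens fun i => A i * B i := by
  ext f g
  simp only [Matrix.mul_apply, tens_apply, ← Finset.prod_mul_distrib, Finset.prod_univ_sum,
    Fintype.piFinset_univ]

theorem tens_conjTranspose (A : ι → Matrix κ κ' ℂ) : (tens A)ᴴ = tens fun i => (A i)ᴴ := by
  ext f g
  simp [tens_apply, Matrix.conjTranspose_apply]

theorem tens_eq_zero {A : ι → Matrix κ κ' ℂ} (i : ι) (h : A i = 0) : tens A = 0 := by
  ext f g
  exact Finset.prod_eq_zero (Finset.mem_univ i) (by simp [h])

variable [DecidableEq κ]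

theorem tens_one : tens (fun _ : ι => (1 : Matrix κ κ ℂ)) = 1 := by
  ext f g
  simp only [tens_apply, Matrix.one_apply, Finset.prod_ite_zero, Finset.prod_const_one,
    funext_iff, Finset.mem_univ, true_imp_iff]

/-- The operator acting as `A` on site `i` and as the identity elsewhere. -/
def loc (i : ι) : Matrix κ κ ℂ →ₗ[ℂ] Matrix (ι → κ) (ι → κ) ℂ where
  toFun A := tens (Function.update (fun _ => 1) i A)
  map_add' A B := by
    ext f g
    simp only [tens_apply, Matrix.add_apply, ← Finset.mul_prod_erase _ _ (Finset.mem_univ i),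
      Function.update_self, add_mul]
    congr 2 <;>
    exact Finset.prod_congr rfl fun j hj => by
      simp [Function.update_of_ne (Finset.ne_of_mem_erase hj)]
  map_smul' c A := by
    ext f g
    simp only [tens_apply, Matrix.smul_apply, ← Finset.mul_prod_erase _ _ (Finset.mem_univ i),
      Function.update_self, smul_eq_mul, mul_assoc, RingHom.id_apply]
    congr 2
    exact Finset.prod_congr rfl fun j hj => by
      simp [Function.update_of_ne (Finset.ne_of_mem_erase hj)]

theorem loc_eq (i : ι) (A : Matrix κ κ ℂ) : loc i A = tens (Function.update (fun _ => 1) i A) := rfl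

theorem loc_one (i : ι) : loc i (1 : Matrix κ κ ℂ) = 1 := by
  rw [loc_eq, ← tens_one]
  congr 1
  simp

theorem loc_apply (i : ι) (A : Matrix κ κ ℂ) (f g : ι → κ) :
    loc i A f g = A (f i) (g i) * ∏ j ∈ Finset.univ.erase i, if f j = g j then 1 else 0 := by
  rw [loc_eq, tens_apply, ← Finset.mul_prod_erase _ _ (Finset.mem_univ i), Function.update_self]
  congr 1
  exact Finset.prod_congr rfl fun j hj => by
    rw [Function.update_of_ne (Finset.ne_of_mem_erase hj), Matrix.one_apply]

theorem loc_conjTranspose (i : ι) (A : Matrix κ κ ℂ) : (loc i A)ᴴ = loc i Aᴴ := by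
  rw [loc_eq, loc_eq, tens_conjTranspose]
  congr 1
  ext1 j
  rcases eq_or_ne j i with rfl | h <;> simp [*]

theorem loc_smul_real (i : ι) (c : ℝ) (A : Matrix κ κ ℂ) : loc i (c • A) = c • loc i A :=
  (loc i).map_smul_of_tower c A

variable [Fintype κ]

theorem loc_mul_loc (i : ι) (A B : Matrix κ κ ℂ) : loc i A * loc i B = loc i (A * B) := by
  rw [loc_eq, loc_eq, loc_eq, tens_mul_tens]
  congr 1
  ext1 j
  rcases eq_or_ne j i with rfl | h <;> simp [*]

theorem loc_mul_loc_of_ne {i j : ι} (h : i ≠ j) (A B : Matrix κ κ ℂ) :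
    loc i A * loc j B = tens (Function.update (Function.update (fun _ => 1) i A) j B) := by
  rw [loc_eq, loc_eq, tens_mul_tens]
  congr 1
  ext1 l
  rcases eq_or_ne l i with rfl | h₁
  · simp [h]
  · rcases eq_or_ne l j with rfl | h₂ <;> simp [*]

theorem loc_comm {i j : ι} (h : i ≠ j) (A B : Matrix κ κ ℂ) :
    loc i A * loc j B = loc j B * loc i A := by
  rw [loc_mul_loc_of_ne h, loc_mul_loc_of_ne h.symm, Function.update_comm h]

theorem isHermitian_loc {A : Matrix κ κ ℂ} (hA : A.IsHermitian) (i : ι) :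
    (loc i A).IsHermitian := by
  rw [Matrix.IsHermitian, loc_conjTranspose, hA.eq]

theorem isHermitian_loc_mul_loc {A B : Matrix κ κ ℂ} (hA : A.IsHermitian) (hB : B.IsHermitian)
    {i j : ι} (h : i ≠ j) : (loc i A * loc j B).IsHermitian := by
  rw [Matrix.IsHermitian, Matrix.conjTranspose_mul, loc_conjTranspose, loc_conjTranspose, hA.eq,
    hB.eq, loc_comm h]

variable [Fintype κ'] [DecidableEq κ'] {v : Matrix κ κ' ℂ}

/-- The local encoding `v ⊗ ⋯ ⊗ v`. -/
def enc (ι : Type*) [Fintype ι] (v : Matrix κ κ' ℂ) : Matrix (ι → κ) (ι → κ') ℂ :=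
  tens fun _ => v

theorem conj_enc_tens (v : Matrix κ κ' ℂ) (F : ι → Matrix κ κ ℂ) :
    (enc ι v)ᴴ * tens F * enc ι v = tens fun i => vᴴ * F i * v := by
  rw [enc, tens_conjTranspose, tens_mul_tens, tens_mul_tens]

theorem enc_conjTranspose_mul_self (hv : vᴴ * v = 1) : (enc ι v)ᴴ * enc ι v = 1 := by
  rw [enc, tens_conjTranspose, tens_mul_tens, hv, tens_one]

theorem loc_mul_enc (i : ι) {A : Matrix κ κ ℂ} (h : A * v = 0) : loc i A * enc ι v = 0 := by
  rw [enc, loc_eq, tens_mul_tens]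
  exact tens_eq_zero i (by simpa)

theorem conj_enc_loc (hv : vᴴ * v = 1) (i : ι) (A : Matrix κ κ ℂ) :
    (enc ι v)ᴴ * loc i A * enc ι v = loc i (vᴴ * A * v) := by
  rw [loc_eq, loc_eq, conj_enc_tens]
  congr 1
  ext1 j
  rcases eq_or_ne j i with rfl | h <;> simp [*]

theorem conj_enc_loc_mul_loc (hv : vᴴ * v = 1) {i j : ι} (h : i ≠ j) (A B : Matrix κ κ ℂ) :
    (enc ι v)ᴴ * (loc i A * loc j B) * enc ι v = loc i (vᴴ * A * v) * loc j (vᴴ * B * v) := by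
  rw [loc_mul_loc_of_ne h, loc_mul_loc_of_ne h, conj_enc_tens]
  congr 1
  ext1 l
  rcases eq_or_ne l j with rfl | h₁
  · simp
  · rcases eq_or_ne l i with rfl | h₂ <;> simp [*]

/-- Compressing a product of two-site operators on different pairs of sites gives zero if the
factors of the first one compress to zero. -/
theorem conj_enc_pair_mul_pair_of_ne [LinearOrder ι] {A B C D : Matrix κ κ ℂ}
    (hA : vᴴ * A * v = 0) (hB : vᴴ * B * v = 0) {i j k l : ι} (hji : j < i) (hlk : l < k)
    (h : ¬ (i = k ∧ j = l)) :
    (enc ι v)ᴴ * (loc i A * loc j B * (loc k C * loc l D)) * enc ι v = 0 := by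
  rw [loc_mul_loc_of_ne hji.ne', loc_mul_loc_of_ne hlk.ne', tens_mul_tens, conj_enc_tens]
  by_cases hi : i ≠ k ∧ i ≠ l
  · exact tens_eq_zero i (by simp [hi.1, hi.2, hji.ne', hA])
  · have hj : j ≠ k ∧ j ≠ l := by
      constructor
      · rintro rfl
        rcases not_and_or.1 hi with h' | h' <;> push Not at h' <;> subst h'
        · exact hji.ne rfl
        · exact lt_asymm hji hlk
      · rintro rfl
        rcases not_and_or.1 hi with h' | h' <;> push Not at h' <;> subst h'
        · exact h ⟨rfl, rfl⟩
        · exact hji.ne rfl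
    exact tens_eq_zero j (by simp [hj.1, hj.2, hB])

theorem loc_mul_loc_mul_enc {i j : ι} (h : i ≠ j) {A : Matrix κ κ ℂ} (hA : A * v = 0)
    (B : Matrix κ κ ℂ) : loc i A * (loc j B * enc ι v) = 0 := by
  rw [← Matrix.mul_assoc, loc_comm h, Matrix.mul_assoc, loc_mul_enc i hA, Matrix.mul_zero]

theorem loc_mulVec (i : ι) (A : Matrix κ κ ℂ) (u : (ι → κ) → ℂ) (f : ι → κ) :
    (loc i A *ᵥ u) f = ∑ c, A (f i) c * u (Function.update f i c) := by
  rw [Matrix.mulVec, dotProduct]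
  refine (Finset.sum_of_injOn (fun c => Function.update f i c)
    (fun a _ b _ h => Function.update_injective f i h) (by simp) ?_ ?_).symm
  · intro g _ hg
    have : ∃ j ≠ i, f j ≠ g j := by
      by_contra! h
      refine hg ⟨g i, by simp, ?_⟩
      ext1 j
      rcases eq_or_ne j i with rfl | hj
      · simp
      · simp [hj, h j hj]
    obtain ⟨j, hji, hj⟩ := this
    rw [loc_apply, Finset.prod_eq_zero (Finset.mem_erase.2 ⟨hji, Finset.mem_univ j⟩) (if_neg hj),
      mul_zero, zero_mul]
  · intro c _
    rw [loc_apply, Finset.prod_eq_one, Function.update_self, mul_one]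
    intro j hj
    rw [Function.update_of_ne (Finset.ne_of_mem_erase hj), if_pos rfl]

theorem loc_mulVec_slice (i : ι) (A : Matrix κ κ ℂ) (u : (ι → κ) → ℂ) (f : ι → κ) :
    (fun c => (loc i A *ᵥ u) (Function.update f i c)) =
      A *ᵥ fun c => u (Function.update f i c) := by
  ext c
  rw [loc_mulVec, Matrix.mulVec, dotProduct]
  simp

theorem loc_mulVec_eq_iff (i : ι) (A : Matrix κ κ ℂ) (u w : (ι → κ) → ℂ) :
    loc i A *ᵥ u = w ↔ ∀ f : ι → κ,
      (A *ᵥ fun c => u (Function.update f i c)) = fun c => w (Function.update f i c) := by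
  constructor
  · rintro rfl f
    rw [loc_mulVec_slice]
  · intro h
    ext f
    have := congrFun (h f) (f i)
    rw [← loc_mulVec_slice] at this
    simpa using this

theorem tens_ite_mulVec {P : Matrix κ κ ℂ} {u : (ι → κ) → ℂ} (h : ∀ i, loc i P *ᵥ u = u)
    (s : Finset ι) : tens (fun i => if i ∈ s then P else 1) *ᵥ u = u := by
  induction s using Finset.induction_on with
  | empty => simp [tens_one]
  | insert i s hi ih =>
    have : tens (fun j => if j ∈ insert i s then P else 1) =
        loc i P * tens (fun j => if j ∈ s then P else 1) := by
      rw [loc_eq, tens_mul_tens]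
      congr 1
      ext1 j
      rcases eq_or_ne j i with rfl | hj <;> simp [*]
    rw [this, ← Matrix.mulVec_mulVec, ih, h]

theorem enc_mulVec_conjTranspose_enc_mulVec {u : (ι → κ) → ℂ}
    (h : ∀ i, loc i (v * vᴴ) *ᵥ u = u) : enc ι v *ᵥ ((enc ι v)ᴴ *ᵥ u) = u := by
  rw [Matrix.mulVec_mulVec, enc, tens_conjTranspose, tens_mul_tens]
  simpa using tens_ite_mulVec h Finset.univ

end TensorProducts

section SumOfSquares

variable {k α : Type*} [Fintype k] [Fintype α]

theorem posSemidef_sum_conjTranspose_mul_self (N : α → Matrix k k ℂ) :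
    (∑ a, (N a)ᴴ * N a).PosSemidef :=
  Matrix.posSemidef_sum _ fun a _ => Matrix.posSemidef_conjTranspose_mul_self (N a)

theorem mulVec_eq_zero_of_sum_conjTranspose_mul_self {N : α → Matrix k k ℂ} {u : k → ℂ}
    (h : (∑ a, (N a)ᴴ * N a) *ᵥ u = 0) (a : α) : N a *ᵥ u = 0 := by
  have h1 : ∑ a, star u ⬝ᵥ (((N a)ᴴ * N a) *ᵥ u) = 0 := by
    rw [← dotProduct_sum, ← Matrix.sum_mulVec, h, dotProduct_zero]
  have h2 := (Finset.sum_eq_zero_iff_of_nonneg fun a _ =>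
    (Matrix.posSemidef_conjTranspose_mul_self (N a)).dotProduct_mulVec_nonneg u).1 h1 a
      (Finset.mem_univ a)
  rw [← Matrix.mulVec_mulVec, Matrix.dotProduct_mulVec, ← Matrix.star_mulVec] at h2
  exact dotProduct_star_self_eq_zero.1 h2

end SumOfSquares

section Gadget

set_option linter.unusedSectionVars false

variable {A : Type*} [Fintype A] [DecidableEq A]

/-- A weighted collective operator on a block of four qubits. -/
noncomputable def coll (B : Matrix (Fin 2) (Fin 2) ℂ) (u : Fin 4 → ℝ) :
    Matrix (Fin 4 → Fin 2) (Fin 4 → Fin 2) ℂ :=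
  ∑ s, u s • loc s B

/-- The isometry `v` encodes a qubit in the common kernel of the total spin operators of four
qubits, in such a way that weighted collective operators have no first-order effect, and a
second-order effect which can be tuned to any of `±X`, `±Z`, up to a shift. -/
structure IsGadget (σ : A → Matrix (Fin 2) (Fin 2) ℂ) (v : Matrix (Fin 4 → Fin 2) (Fin 2) ℂ)
    (e : ℝ) (D : (Fin 4 → ℝ) → Matrix (Fin 2) (Fin 2) ℂ) : Prop where
  nonempty : Nonempty A
  isHermitian : ∀ a, (σ a).IsHermitian
  isometry : vᴴ * v = 1
  coll_one_mul : ∀ a, coll (σ a) 1 * v = 0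
  eq_of_mulVec : ∀ x, (∀ a, coll (σ a) 1 *ᵥ x = 0) → v *ᵥ (vᴴ *ᵥ x) = x
  pos : 0 < e
  penalty_mul : ∀ b u, (∑ a, coll (σ a) 1 * coll (σ a) 1) * (coll (σ b) u * v) =
    e • (coll (σ b) u * v)
  first_order : ∀ a u, vᴴ * coll (σ a) u * v = 0
  second_order : ∀ a b u, vᴴ * (coll (σ a) u * coll (σ b) u) * v = if a = b then D u else 0
  exists_weights : ∀ P, P = PX ∨ P = PZ → ∀ s : ℝ, s = 1 ∨ s = -1 →
    ∃ u, ∃ d : ℝ, D u = d • 1 + s • P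

variable {ι : Type*} [Fintype ι] [DecidableEq ι]

/-- The operators `c + ∑ w_{pq} ∑ₐ σᵃ_p σᵃ_q` on qubits arranged in blocks of four. -/
noncomputable def interactionSpan (ι : Type*) [Fintype ι] [DecidableEq ι]
    (σ : A → Matrix (Fin 2) (Fin 2) ℂ) :
    Submodule ℝ (Matrix (ι → Fin 4 → Fin 2) (ι → Fin 4 → Fin 2) ℂ) :=
  Submodule.span ℝ (insert 1 (Set.range fun x : (ι × Fin 4) × (ι × Fin 4) =>
    ∑ a, loc x.1.1 (loc x.1.2 (σ a)) * loc x.2.1 (loc x.2.2 (σ a))))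

/-- The interaction of the blocks `i` and `j` through weighted collective operators. -/
noncomputable def blockTerm (σ : A → Matrix (Fin 2) (Fin 2) ℂ) (i j : ι) (u u' : Fin 4 → ℝ) :
    Matrix (ι → Fin 4 → Fin 2) (ι → Fin 4 → Fin 2) ℂ :=
  ∑ a, loc i (coll (σ a) u) * loc j (coll (σ a) u')

variable {σ : A → Matrix (Fin 2) (Fin 2) ℂ} {v : Matrix (Fin 4 → Fin 2) (Fin 2) ℂ}
  {e : ℝ} {D : (Fin 4 → ℝ) → Matrix (Fin 2) (Fin 2) ℂ}

theorem isHermitian_sum {k β : Type*} (s : Finset β) {M : β → Matrix k k ℂ}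
    (h : ∀ b ∈ s, (M b).IsHermitian) : (∑ b ∈ s, M b).IsHermitian := by
  rw [Matrix.IsHermitian, Matrix.conjTranspose_sum]
  exact Finset.sum_congr rfl fun b hb => h b hb

theorem isHermitian_smul_real {k : Type*} {M : Matrix k k ℂ} (h : M.IsHermitian) (r : ℝ) :
    (r • M).IsHermitian :=
  h.smul (IsSelfAdjoint.all r)

theorem isHermitian_coll {B : Matrix (Fin 2) (Fin 2) ℂ} (hB : B.IsHermitian) (u : Fin 4 → ℝ) :
    (coll B u).IsHermitian :=
  isHermitian_sum _ fun s _ => isHermitian_smul_real (isHermitian_loc hB s) _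

theorem one_mem_interactionSpan : 1 ∈ interactionSpan ι σ :=
  Submodule.subset_span (Set.mem_insert _ _)

theorem blockTerm_mem_interactionSpan (i j : ι) (u u' : Fin 4 → ℝ) :
    blockTerm σ i j u u' ∈ interactionSpan ι σ := by
  have : blockTerm σ i j u u' = ∑ s, ∑ t, (u s * u' t) •
      ∑ a, loc i (loc s (σ a)) * loc j (loc t (σ a)) := by
    simp only [blockTerm, coll, map_sum, loc_smul_real, Finset.sum_mul, Finset.mul_sum,
      smul_mul_smul_comm, Finset.smul_sum]
    rw [Finset.sum_comm]
    conv_rhs => rw [Finset.sum_comm]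
    exact Finset.sum_congr rfl fun s _ => Finset.sum_comm
  rw [this]
  exact Submodule.sum_mem _ fun s _ => Submodule.sum_mem _ fun t _ => Submodule.smul_mem _ _
    (Submodule.subset_span (Set.mem_insert_of_mem _ ⟨((i, s), (j, t)), rfl⟩))

theorem blockTerm_self (i : ι) (u u' : Fin 4 → ℝ) :
    blockTerm σ i i u u' = loc i (∑ a, coll (σ a) u * coll (σ a) u') := by
  simp only [blockTerm, loc_mul_loc, map_sum]

namespace IsGadget

theorem isHermitian_blockTerm (h : IsGadget σ v e D) {i j : ι} (hij : i ≠ j) (u u' : Fin 4 → ℝ) :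
    (blockTerm σ i j u u').IsHermitian :=
  isHermitian_sum _ fun a _ => isHermitian_loc_mul_loc (isHermitian_coll (h.isHermitian a) _)
    (isHermitian_coll (h.isHermitian a) _) hij

theorem isHermitian_blockTerm_self (h : IsGadget σ v e D) (i : ι) (u : Fin 4 → ℝ) :
    (blockTerm σ i i u u).IsHermitian := by
  rw [blockTerm_self]
  refine isHermitian_loc (isHermitian_sum _ fun a _ => ?_) i
  rw [Matrix.IsHermitian, Matrix.conjTranspose_mul, (isHermitian_coll (h.isHermitian a) u).eq]

theorem penalty_eq (h : IsGadget σ v e D) :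
    ∑ i : ι, blockTerm σ i i 1 1 =
      ∑ x : ι × A, (loc x.1 (coll (σ x.2) 1))ᴴ * loc x.1 (coll (σ x.2) 1) := by
  simp only [Fintype.sum_prod_type, blockTerm_self, map_sum, loc_conjTranspose, loc_mul_loc,
    (isHermitian_coll (h.isHermitian _) _).eq]

theorem posSemidef_penalty (h : IsGadget σ v e D) :
    (∑ i : ι, blockTerm σ i i 1 1).PosSemidef := by
  rw [h.penalty_eq]
  exact posSemidef_sum_conjTranspose_mul_self _

theorem enc_mulVec_of_penalty_mulVec (h : IsGadget σ v e D) {x : (ι → Fin 4 → Fin 2) → ℂ}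
    (hx : (∑ i : ι, blockTerm σ i i 1 1) *ᵥ x = 0) : enc ι v *ᵥ ((enc ι v)ᴴ *ᵥ x) = x := by
  rw [h.penalty_eq] at hx
  refine enc_mulVec_conjTranspose_enc_mulVec fun i => (loc_mulVec_eq_iff _ _ _ _).2 fun f => ?_
  rw [← Matrix.mulVec_mulVec]
  refine h.eq_of_mulVec _ fun a => ?_
  exact (loc_mulVec_eq_iff _ _ _ _).1 (mulVec_eq_zero_of_sum_conjTranspose_mul_self hx (i, a)) f

theorem blockTerm_self_one_mul (h : IsGadget σ v e D) :
    (∑ a, coll (σ a) 1 * coll (σ a) 1) * v = 0 := by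
  rw [Matrix.sum_mul]
  exact Finset.sum_eq_zero fun a _ => by rw [Matrix.mul_assoc, h.coll_one_mul, Matrix.mul_zero]

theorem penalty_mul_enc (h : IsGadget σ v e D) :
    (∑ i : ι, blockTerm σ i i 1 1) * enc ι v = 0 := by
  rw [Matrix.sum_mul]
  refine Finset.sum_eq_zero fun i _ => ?_
  rw [blockTerm_self, loc_mul_enc i h.blockTerm_self_one_mul]

theorem penalty_mul_blockTerm_mul_enc (h : IsGadget σ v e D) {i j : ι} (hij : i ≠ j)
    (u u' : Fin 4 → ℝ) : (∑ i : ι, blockTerm σ i i 1 1) * (blockTerm σ i j u u' * enc ι v) =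
      (2 * e) • (blockTerm σ i j u u' * enc ι v) := by
  obtain ⟨K, hK⟩ : ∃ K, K = ∑ a, coll (σ a) 1 * coll (σ a) 1 := ⟨_, rfl⟩
  have hKv : K * v = 0 := hK ▸ h.blockTerm_self_one_mul
  have hKJ : ∀ b u, (K * coll (σ b) u - e • coll (σ b) u) * v = 0 := fun b u => by
    rw [Matrix.sub_mul, Matrix.mul_assoc, hK, h.penalty_mul, Matrix.smul_mul, sub_self]
  have hloc : ∀ (i j : ι), i ≠ j → ∀ b u (X : Matrix (Fin 4 → Fin 2) (Fin 4 → Fin 2) ℂ),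
      loc i K * (loc i (coll (σ b) u) * (loc j X * enc ι v)) =
        e • (loc i (coll (σ b) u) * (loc j X * enc ι v)) := fun i j hij b u X => by
    have := loc_mul_loc_mul_enc hij (hKJ b u) X
    rw [map_sub, Matrix.sub_mul, loc_smul_real, Matrix.smul_mul, ← loc_mul_loc, Matrix.mul_assoc,
      sub_eq_zero] at this
    exact this
  simp only [blockTerm_self, ← hK]
  rw [Matrix.sum_mul, ← Finset.add_sum_erase _ _ (Finset.mem_univ i),
    ← Finset.add_sum_erase _ _ (Finset.mem_erase.2 ⟨hij.symm, Finset.mem_univ j⟩),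
    Finset.sum_eq_zero, add_zero, two_mul, add_smul]
  · simp only [blockTerm, Matrix.sum_mul, Matrix.mul_sum, Finset.smul_sum]
    congr 1
    · refine Finset.sum_congr rfl fun a _ => ?_
      rw [Matrix.mul_assoc, hloc i j hij]
    · refine Finset.sum_congr rfl fun a _ => ?_
      rw [loc_comm hij, Matrix.mul_assoc, hloc j i hij.symm]
  · intro k hk
    simp only [Finset.mem_erase, Finset.mem_univ, and_true] at hk
    simp only [blockTerm, Matrix.sum_mul, Matrix.mul_sum]
    refine Finset.sum_eq_zero fun a _ => ?_
    rw [Matrix.mul_assoc, ← Matrix.mul_assoc (loc k K), loc_comm hk.2, Matrix.mul_assoc,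
      loc_mul_loc_mul_enc hk.1 hKv, Matrix.mul_zero]

theorem conj_enc_blockTerm_self (h : IsGadget σ v e D) (i : ι) (u : Fin 4 → ℝ) :
    (enc ι v)ᴴ * (blockTerm σ i i u u * enc ι v) = (Fintype.card A : ℝ) • loc i (D u) := by
  rw [blockTerm_self, ← Matrix.mul_assoc, conj_enc_loc h.isometry, ← loc_smul_real]
  congr 1
  simp only [Matrix.mul_sum, Matrix.sum_mul, h.second_order, if_true, Finset.sum_const,
    Finset.card_univ, Nat.cast_smul_eq_nsmul ℝ]

theorem conj_enc_blockTerm_mul_self (h : IsGadget σ v e D) {i j : ι} (hij : i ≠ j)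
    (u u' : Fin 4 → ℝ) :
    (enc ι v)ᴴ * (blockTerm σ i j u u' * (blockTerm σ i j u u' * enc ι v)) =
      (Fintype.card A : ℝ) • (loc i (D u) * loc j (D u')) := by
  have : ∀ a b, (enc ι v)ᴴ * ((loc i (coll (σ a) u) * loc j (coll (σ a) u')) *
      ((loc i (coll (σ b) u) * loc j (coll (σ b) u')) * enc ι v)) =
        if a = b then loc i (D u) * loc j (D u') else 0 := fun a b => by
    rw [← Matrix.mul_assoc _ _ (enc ι v), Matrix.mul_assoc (loc i _),
      ← Matrix.mul_assoc (loc j _), ← loc_comm hij, Matrix.mul_assoc (loc i _) (loc j _),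
      loc_mul_loc, ← Matrix.mul_assoc (loc i _), loc_mul_loc, ← Matrix.mul_assoc,
      conj_enc_loc_mul_loc h.isometry hij, h.second_order, h.second_order]
    split_ifs <;> simp
  simp only [blockTerm, Matrix.sum_mul, Matrix.mul_sum, this,
    Finset.sum_ite_eq', Finset.mem_univ, if_true, Finset.sum_const, Finset.card_univ,
    Nat.cast_smul_eq_nsmul ℝ]

theorem conj_enc_blockTerm_mul_blockTerm [LinearOrder ι] (h : IsGadget σ v e D) {i j k l : ι}
    (hji : j < i) (hlk : l < k) (hne : ¬ (i = k ∧ j = l)) (u u' w w' : Fin 4 → ℝ) :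
    (enc ι v)ᴴ * (blockTerm σ i j u u' * (blockTerm σ k l w w' * enc ι v)) = 0 := by
  simp only [blockTerm, Matrix.sum_mul, Matrix.mul_sum]
  refine Finset.sum_eq_zero fun a _ => Finset.sum_eq_zero fun b _ => ?_
  rw [← Matrix.mul_assoc _ _ (enc ι v), ← Matrix.mul_assoc]
  exact conj_enc_pair_mul_pair_of_ne (h.first_order _ _) (h.first_order _ _) hji hlk hne

end IsGadget

end Gadget

section Assembly

set_option linter.unusedSectionVars false

variable {A : Type*} [Fintype A] [DecidableEq A] {ι : Type*} [Fintype ι] [DecidableEq ι]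
  {σ : A → Matrix (Fin 2) (Fin 2) ℂ} {v : Matrix (Fin 4 → Fin 2) (Fin 2) ℂ}
  {e : ℝ} {D : (Fin 4 → ℝ) → Matrix (Fin 2) (Fin 2) ℂ}

/-- The logical operators obtained at first order from an interaction Hamiltonian. -/
noncomputable def firstOrderSpan (ι : Type*) [Fintype ι] [DecidableEq ι]
    (σ : A → Matrix (Fin 2) (Fin 2) ℂ) (v : Matrix (Fin 4 → Fin 2) (Fin 2) ℂ) :
    Submodule ℝ (Matrix (ι → Fin 2) (ι → Fin 2) ℂ) where
  carrier := {G | ∃ C ∈ interactionSpan ι σ, C.IsHermitian ∧ (enc ι v)ᴴ * (C * enc ι v) = G}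
  add_mem' := by
    rintro _ _ ⟨C, hC, hCh, rfl⟩ ⟨C', hC', hCh', rfl⟩
    exact ⟨C + C', Submodule.add_mem _ hC hC', hCh.add hCh', by
      rw [Matrix.add_mul, Matrix.mul_add]⟩
  zero_mem' := ⟨0, Submodule.zero_mem _, Matrix.isHermitian_zero, by simp⟩
  smul_mem' := by
    rintro r _ ⟨C, hC, hCh, rfl⟩
    exact ⟨r • C, Submodule.smul_mem _ r hC, isHermitian_smul_real hCh r, by
      rw [Matrix.smul_mul, Matrix.mul_smul]⟩

namespace IsGadget

theorem one_mem_firstOrderSpan (h : IsGadget σ v e D) : 1 ∈ firstOrderSpan ι σ v :=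
  ⟨1, one_mem_interactionSpan, Matrix.isHermitian_one, by
    rw [Matrix.one_mul, enc_conjTranspose_mul_self h.isometry]⟩

theorem loc_mem_firstOrderSpan (h : IsGadget σ v e D) (i : ι) {P : Matrix (Fin 2) (Fin 2) ℂ}
    (hP : P = PX ∨ P = PZ) : loc i P ∈ firstOrderSpan ι σ v := by
  have := h.nonempty
  obtain ⟨u, d, hu⟩ := h.exists_weights P hP 1 (Or.inl rfl)
  have h1 : (Fintype.card A : ℝ) • loc i (D u) ∈ firstOrderSpan ι σ v :=
    ⟨_, blockTerm_mem_interactionSpan i i u u, h.isHermitian_blockTerm_self i u,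
      h.conj_enc_blockTerm_self i u⟩
  have h2 : loc i P = (Fintype.card A : ℝ)⁻¹ • (Fintype.card A : ℝ) • loc i (D u) -
      d • (1 : Matrix (ι → Fin 2) (ι → Fin 2) ℂ) := by
    rw [inv_smul_smul₀ (by simp), hu, one_smul, map_add, loc_smul_real, loc_one,
      add_sub_cancel_left]
  rw [h2]
  exact Submodule.sub_mem _ (Submodule.smul_mem _ _ h1)
    (Submodule.smul_mem _ _ h.one_mem_firstOrderSpan)

/-- The second-order effect of a single block term, up to first-order terms. -/
theorem exists_second_order_pair (h : IsGadget σ v e D) (i j : ι) {P Q : Matrix (Fin 2) (Fin 2) ℂ}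
    (hP : P = PX ∨ P = PZ) (hQ : Q = PX ∨ Q = PZ) (α : ℝ) :
    ∃ (r : ℝ) (u u' : Fin 4 → ℝ),
      α • (loc i P * loc j Q) + (2 * e)⁻¹ • (r ^ 2) • (Fintype.card A : ℝ) •
        (loc i (D u) * loc j (D u')) ∈ firstOrderSpan ι σ v := by
  have := h.nonempty
  have hcard : (0 : ℝ) < Fintype.card A := by exact_mod_cast Fintype.card_pos
  have he := h.pos
  obtain ⟨s, hs, hsα⟩ : ∃ s : ℝ, (-s = 1 ∨ -s = -1) ∧ |α| * s = α := by
    rcases le_total 0 α with hα | hα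
    · exact ⟨1, Or.inr rfl, by rw [abs_of_nonneg hα, mul_one]⟩
    · exact ⟨-1, Or.inl (by simp), by rw [abs_of_nonpos hα]; ring⟩
  obtain ⟨u, d, hu⟩ := h.exists_weights P hP 1 (Or.inl rfl)
  obtain ⟨u', d', hu'⟩ := h.exists_weights Q hQ (-s) hs
  refine ⟨Real.sqrt (2 * e * |α| / Fintype.card A), u, u', ?_⟩
  have key : α • (loc i P * loc j Q) + (2 * e)⁻¹ • (Real.sqrt (2 * e * |α| / Fintype.card A) ^ 2) •
      (Fintype.card A : ℝ) • (loc i (D u) * loc j (D u')) =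
      (|α| * d * d') • (1 : Matrix (ι → Fin 2) (ι → Fin 2) ℂ) + (-(α * d)) • loc j Q +
        (|α| * d') • loc i P := by
    rw [Real.sq_sqrt (by positivity), hu, hu', smul_smul, smul_smul]
    have h1 : (2 * e)⁻¹ * (2 * e * |α| / Fintype.card A) * Fintype.card A = |α| := by
      field_simp
    rw [h1, map_add, map_add, loc_smul_real, loc_smul_real, loc_smul_real, loc_smul_real, loc_one,
      loc_one, one_smul]
    simp only [Matrix.add_mul, Matrix.mul_add, Matrix.smul_mul, Matrix.mul_smul, Matrix.one_mul,
      Matrix.mul_one, smul_add, smul_smul]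
    generalize |α| = t at *
    subst hsα
    module
  rw [key]
  exact Submodule.add_mem _ (Submodule.add_mem _ (Submodule.smul_mem _ _ h.one_mem_firstOrderSpan)
    (Submodule.smul_mem _ _ (h.loc_mem_firstOrderSpan j hQ)))
    (Submodule.smul_mem _ _ (h.loc_mem_firstOrderSpan i hP))

theorem exists_perturbation [LinearOrder ι] (h : IsGadget σ v e D) (α : ι → ι → ℝ) (β γ : ι → ℝ)
    (a b : ι → ι → Matrix (Fin 2) (Fin 2) ℂ)
    (hab : ∀ i j, (a i j = PX ∨ a i j = PZ) ∧ (b i j = PX ∨ b i j = PZ)) :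
    ∃ B ∈ interactionSpan ι σ, ∃ C ∈ interactionSpan ι σ,
      ∃ T : Matrix (ι → Fin 4 → Fin 2) (ι → Fin 2) ℂ,
      B.IsHermitian ∧ C.IsHermitian ∧
      (∑ i : ι, blockTerm σ i i 1 1) * T = -(B * enc ι v) ∧
      (enc ι v)ᴴ * (B * T + C * enc ι v) =
        (∑ i, ∑ j, if j < i then α i j • (loc i (a i j) * loc j (b i j)) else 0) +
          ∑ k, (β k • loc k PX + γ k • loc k PZ) := by
  have hpair := fun p : ι × ι => h.exists_second_order_pair p.1 p.2 (hab p.1 p.2).1 (hab p.1 p.2).2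
    (α p.1 p.2)
  choose r u u' hG using hpair
  have he := h.pos
  obtain ⟨P, hP⟩ : ∃ P : Finset (ι × ι), P = Finset.univ.filter fun p => p.2 < p.1 := ⟨_, rfl⟩
  have hlt : ∀ p ∈ P, p.2 < p.1 := fun p hp => by simpa [hP] using hp
  obtain ⟨B, hB⟩ : ∃ B, B = ∑ p ∈ P, r p • blockTerm σ p.1 p.2 (u p) (u' p) := ⟨_, rfl⟩
  have hBV : (∑ i : ι, blockTerm σ i i 1 1) * (B * enc ι v) = (2 * e) • (B * enc ι v) := by
    rw [hB, Matrix.sum_mul _ _ (enc ι v), Matrix.mul_sum, Finset.smul_sum]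
    refine Finset.sum_congr rfl fun p hp => ?_
    rw [Matrix.smul_mul, Matrix.mul_smul, h.penalty_mul_blockTerm_mul_enc (hlt p hp).ne',
      smul_comm]
  have hBB : (enc ι v)ᴴ * (B * (B * enc ι v)) = ∑ p ∈ P, (r p ^ 2) • (Fintype.card A : ℝ) •
      (loc p.1 (D (u p)) * loc p.2 (D (u' p))) := by
    rw [hB]
    simp only [Matrix.sum_mul, Matrix.mul_sum, Matrix.smul_mul, Matrix.mul_smul]
    refine Finset.sum_congr rfl fun p hp => ?_
    rw [Finset.sum_eq_single p, h.conj_enc_blockTerm_mul_self (hlt p hp).ne', smul_smul, sq]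
    · intro q hq hqp
      rw [h.conj_enc_blockTerm_mul_blockTerm, smul_zero]
      · exact hlt _ ‹_›
      · exact hlt _ ‹_›
      · rintro ⟨h1, h2⟩
        exact hqp (Prod.ext h1 h2)
    · exact fun hp' => absurd hp hp'
  have hmem : (∑ p ∈ P, (α p.1 p.2 • (loc p.1 (a p.1 p.2) * loc p.2 (b p.1 p.2)) +
      (2 * e)⁻¹ • (r p ^ 2) • (Fintype.card A : ℝ) •
        (loc p.1 (D (u p)) * loc p.2 (D (u' p))))) +
      ∑ k, (β k • loc k PX + γ k • loc k PZ) ∈ firstOrderSpan ι σ v :=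
    Submodule.add_mem _ (Submodule.sum_mem _ fun p _ => hG p) (Submodule.sum_mem _ fun k _ =>
      Submodule.add_mem _ (Submodule.smul_mem _ _ (h.loc_mem_firstOrderSpan k (Or.inl rfl)))
        (Submodule.smul_mem _ _ (h.loc_mem_firstOrderSpan k (Or.inr rfl))))
  obtain ⟨C, hC, hCh, hCG⟩ := hmem
  refine ⟨B, ?_, C, hC, -((2 * e)⁻¹ • (B * enc ι v)), ?_, hCh, ?_, ?_⟩
  · rw [hB]
    exact Submodule.sum_mem _ fun p _ =>
      Submodule.smul_mem _ _ (blockTerm_mem_interactionSpan _ _ _ _)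
  · rw [hB]
    exact isHermitian_sum _ fun p hp =>
      isHermitian_smul_real (h.isHermitian_blockTerm (hlt p hp).ne' _ _) _
  · rw [Matrix.mul_neg, Matrix.mul_smul, hBV, inv_smul_smul₀ (by positivity)]
  · rw [Matrix.mul_add, hCG, Matrix.mul_neg, Matrix.mul_neg, Matrix.mul_smul, Matrix.mul_smul, hBB,
      Finset.sum_add_distrib, Finset.smul_sum, add_assoc, add_comm (∑ p ∈ P, (2 * e)⁻¹ • _)]
    rw [← Fintype.sum_prod_type' (f := fun i j =>
      if j < i then α i j • (loc i (a i j) * loc j (b i j)) else 0), ← Finset.sum_filter, ← hP]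
    abel

end IsGadget

end Assembly

section SingletGadget

/-- The Pauli matrices, up to a phase in the case of `Y`. -/
def pauliInt : Fin 3 → Matrix (Fin 2) (Fin 2) ℤ :=
  ![!![0, 1; 1, 0], !![0, -1; 1, 0], !![1, 0; 0, -1]]

/-- A basis of the singlet space of four qubits, not normalised. -/
def singlet (f : Fin 4 → Fin 2) (x : Fin 2) : ℤ :=
  if f 0 + f 1 + f 2 + f 3 ≠ 0 ∨ (f 0 = f 1 ∧ f 1 = f 2 ∧ f 2 = f 3) then 0
  else if x = 0 then (if f 0 = f 1 then 0 else if f 0 = f 2 then 1 else -1)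
  else if f 0 = f 1 then 2 else -1

theorem sum_singlet_mul_singlet :
    ∀ x y, ∑ f, singlet f x * singlet f y = if x = y then ![4, 12] x else 0 := by
  decide +kernel

theorem sum_pauliInt_mul_singlet : ∀ a f x,
    ∑ s, ∑ c, pauliInt a (f s) c * singlet (Function.update f s c) x = 0 := by
  decide +kernel

/-- The second-order response of the singlets to a weighted collective operator. -/
def singletResponse (u : Fin 4 → ℤ) (x y : Fin 2) : ℤ :=
  ∑ f, singlet f x * singlet f y * (∑ s, u s * (![1, -1] : Fin 2 → ℤ) (f s)) ^ 2

theorem singletResponse_values :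
    (∀ x y, singletResponse ![1, -1, 0, 0] x y = ![![16, 0], ![0, 16]] x y) ∧
    (∀ x y, singletResponse ![1, 1, 0, 0] x y = ![![0, 0], ![0, 32]] x y) ∧
    (∀ x y, singletResponse ![-2, 1, 4, 0] x y = ![![100, 96], ![96, 300]] x y) ∧
    (∀ x y, singletResponse ![1, -2, 4, 0] x y = ![![100, -96], ![-96, 300]] x y) := by
  refine ⟨?_, ?_, ?_, ?_⟩ <;> decide +kernel

/-- The Pauli matrices `X`, `Y`, `Z`. -/
noncomputable def pauli : Fin 3 → Matrix (Fin 2) (Fin 2) ℂ := ![PX, PY, PZ]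

noncomputable def pauliPhase : Fin 3 → ℂ := ![1, Complex.I, 1]

theorem pauli_apply (a : Fin 3) (x y : Fin 2) :
    pauli a x y = pauliPhase a * (pauliInt a x y : ℂ) := by
  fin_cases a <;> fin_cases x <;> fin_cases y <;> simp [pauli, pauliInt, pauliPhase, PX, PY, PZ]

theorem isHermitian_pauli (a : Fin 3) : (pauli a).IsHermitian := by
  ext x y
  fin_cases a <;> fin_cases x <;> fin_cases y <;>
    simp [pauli, PX, PY, PZ, Matrix.conjTranspose_apply]

noncomputable def singletNorm : Fin 2 → ℝ := ![1 / 2, 1 / Real.sqrt 12]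

theorem singletNorm_mul_self (x : Fin 2) : singletNorm x * singletNorm x * ![4, 12] x = 1 := by
  fin_cases x
  · norm_num [singletNorm]
  · simp only [singletNorm, Fin.mk_one, Matrix.cons_val_one, Matrix.cons_val_fin_one]
    rw [div_mul_div_comm, Real.mul_self_sqrt (by norm_num)]
    norm_num

/-- The isometry onto the singlet space of four qubits. -/
noncomputable def singletIsometry : Matrix (Fin 4 → Fin 2) (Fin 2) ℂ :=
  Matrix.of fun f x => (singletNorm x : ℂ) * (singlet f x : ℂ)

theorem singletIsometry_apply (f : Fin 4 → Fin 2) (x : Fin 2) :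
    singletIsometry f x = (singletNorm x : ℂ) * (singlet f x : ℂ) := rfl

theorem singletIsometry_conjTranspose_apply (f : Fin 4 → Fin 2) (x : Fin 2) :
    singletIsometryᴴ x f = (singletNorm x : ℂ) * (singlet f x : ℂ) := by
  simp [Matrix.conjTranspose_apply, singletIsometry_apply]

theorem singletIsometry_isometry : singletIsometryᴴ * singletIsometry = 1 := by
  ext x y
  have h : (singletIsometryᴴ * singletIsometry) x y = (singletNorm x * singletNorm y : ℂ) *
      ((∑ f, singlet f x * singlet f y : ℤ) : ℂ) := by
    simp only [Matrix.mul_apply, singletIsometry_conjTranspose_apply, singletIsometry_apply]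
    push_cast
    rw [Finset.mul_sum]
    exact Finset.sum_congr rfl fun f _ => by ring
  rw [h, sum_singlet_mul_singlet, Matrix.one_apply]
  split_ifs with hxy
  · subst hxy
    have := singletNorm_mul_self x
    have h2 : ((![4, 12] x : ℤ) : ℂ) = ((![4, 12] x : ℝ) : ℂ) := by fin_cases x <;> simp
    rw [h2]
    exact_mod_cast this
  · simp

theorem loc_mul_apply {ι κ κ' : Type*} [Fintype ι] [DecidableEq ι] [Fintype κ] [DecidableEq κ]
    (i : ι) (B : Matrix κ κ ℂ) (M : Matrix (ι → κ) κ' ℂ) (f : ι → κ) (x : κ') :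
    (loc i B * M) f x = ∑ c, B (f i) c * M (Function.update f i c) x :=
  loc_mulVec i B (fun g => M g x) f

theorem loc_pauli_mul_singletIsometry_apply (a : Fin 3) (s : Fin 4) (f : Fin 4 → Fin 2)
    (y : Fin 2) : (loc s (pauli a) * singletIsometry) f y = pauliPhase a * singletNorm y *
      ((∑ c, pauliInt a (f s) c * singlet (Function.update f s c) y : ℤ) : ℂ) := by
  rw [loc_mul_apply]
  push_cast
  rw [Finset.mul_sum]
  exact Finset.sum_congr rfl fun c _ => by rw [pauli_apply, singletIsometry_apply]; ring

theorem coll_mul {κ : Type*} (B : Matrix (Fin 2) (Fin 2) ℂ) (u : Fin 4 → ℝ)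
    (M : Matrix (Fin 4 → Fin 2) κ ℂ) : coll B u * M = ∑ s, u s • (loc s B * M) := by
  simp only [coll, Matrix.sum_mul, Matrix.smul_mul]

theorem coll_pauli_one_mul_singletIsometry (a : Fin 3) :
    coll (pauli a) 1 * singletIsometry = 0 := by
  ext f x
  rw [coll_mul, Matrix.sum_apply]
  simp only [Pi.one_apply, one_smul, loc_pauli_mul_singletIsometry_apply, ← Finset.mul_sum,
    Matrix.zero_apply]
  rw [← Int.cast_sum, sum_pauliInt_mul_singlet, Int.cast_zero, mul_zero]

theorem coll_one_mul_coll (A B : Matrix (Fin 2) (Fin 2) ℂ) (u : Fin 4 → ℝ) :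
    coll A 1 * coll B u = coll B u * coll A 1 + coll (A * B - B * A) u := by
  have h (r : Fin 4) : coll A 1 * loc r B = loc r B * coll A 1 + loc r (A * B - B * A) := by
    simp only [coll, Pi.one_apply, one_smul, Finset.sum_mul, Finset.mul_sum]
    rw [← Finset.add_sum_erase _ _ (Finset.mem_univ r),
      ← Finset.add_sum_erase _ _ (Finset.mem_univ r), loc_mul_loc, loc_mul_loc, map_sub,
      Finset.sum_congr rfl fun s hs => loc_comm (Finset.ne_of_mem_erase hs) A B]
    abel
  rw [coll.eq_1 B, coll.eq_1 (A * B - B * A), Finset.mul_sum, Finset.sum_mul,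
    ← Finset.sum_add_distrib]
  exact Finset.sum_congr rfl fun s _ => by rw [mul_smul_comm, h, smul_add, smul_mul_assoc]

theorem coll_smul (c : ℂ) (B : Matrix (Fin 2) (Fin 2) ℂ) (u : Fin 4 → ℝ) :
    coll (c • B) u = c • coll B u := by
  simp only [coll, map_smul, Finset.smul_sum]
  exact Finset.sum_congr rfl fun s _ => smul_comm _ _ _

theorem pauli_commutator (a : Fin 3) : pauli a * pauli (a + 1) - pauli (a + 1) * pauli a =
    (2 * Complex.I) • pauli (a + 2) := by
  have h : (2 : Fin 3) + 1 = 0 ∧ (2 : Fin 3) + 2 = 1 ∧ (1 : Fin 3) + 1 = 2 ∧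
    (1 : Fin 3) + 2 = 0 := by decide
  ext x y
  fin_cases a <;> fin_cases x <;> fin_cases y <;>
    simp [h, pauli, PX, PY, PZ] <;> ring_nf <;> simp

theorem pauli_commutator' (a : Fin 3) : pauli a * pauli (a + 2) - pauli (a + 2) * pauli a =
    (-(2 * Complex.I)) • pauli (a + 1) := by
  have h : a + 2 + 1 = a ∧ a + 2 + 2 = a + 1 := by decide +revert
  have := pauli_commutator (a + 2)
  rw [h.1, h.2] at this
  rw [neg_smul, ← this, neg_sub]

/-- A state annihilated by the total spin is invariant under rotations. -/
theorem conj_singletIsometry_commutator {a : Fin 3}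
    {M N : Matrix (Fin 4 → Fin 2) (Fin 4 → Fin 2) ℂ}
    (h : coll (pauli a) 1 * M = M * coll (pauli a) 1 + N) :
    singletIsometryᴴ * N * singletIsometry = 0 := by
  have h' : singletIsometryᴴ * coll (pauli a) 1 = 0 := by
    rw [← (isHermitian_coll (isHermitian_pauli a) 1).eq, ← Matrix.conjTranspose_mul,
      coll_pauli_one_mul_singletIsometry, Matrix.conjTranspose_zero]
  rw [← sub_eq_iff_eq_add'.2 h, Matrix.mul_sub, Matrix.sub_mul, ← Matrix.mul_assoc, h',
    Matrix.mul_assoc, Matrix.mul_assoc, Matrix.mul_assoc, coll_pauli_one_mul_singletIsometry,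
    Matrix.zero_mul, Matrix.mul_zero, Matrix.mul_zero, sub_zero]

theorem singletIsometry_first_order (a : Fin 3) (u : Fin 4 → ℝ) :
    singletIsometryᴴ * coll (pauli a) u * singletIsometry = 0 := by
  have h' : a + 1 + 2 = a := by decide +revert
  have h := conj_singletIsometry_commutator
    (coll_one_mul_coll (pauli (a + 1)) (pauli (a + 1 + 1)) u)
  rw [pauli_commutator, h', coll_smul, Matrix.mul_smul, Matrix.smul_mul, smul_eq_zero] at h
  exact h.resolve_left (by simp)

theorem conj_singletIsometry_coll_mul_coll (a : Fin 3) (B C : Matrix (Fin 2) (Fin 2) ℂ)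
    (u : Fin 4 → ℝ) :
    singletIsometryᴴ * (coll B u * coll (pauli a * C - C * pauli a) u) * singletIsometry +
      singletIsometryᴴ * (coll (pauli a * B - B * pauli a) u * coll C u) * singletIsometry = 0 := by
  rw [← Matrix.add_mul, ← Matrix.mul_add]
  apply conj_singletIsometry_commutator (a := a) (M := coll B u * coll C u)
  rw [← mul_assoc, coll_one_mul_coll, add_mul, mul_assoc, coll_one_mul_coll, mul_add, mul_assoc,
    add_assoc]

theorem conj_singletIsometry_of_ne {a b : Fin 3} (h : a ≠ b) (u : Fin 4 → ℝ) :
    singletIsometryᴴ * (coll (pauli a) u * coll (pauli b) u) * singletIsometry = 0 := by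
  obtain ⟨c, k, hk, hc⟩ : ∃ (c : Fin 3) (k : ℂ), k ≠ 0 ∧
      pauli a * pauli c - pauli c * pauli a = k • pauli b := by
    have h' : b = a + 2 ∨ b = a + 1 := by decide +revert
    rcases h' with rfl | rfl
    · exact ⟨_, _, by simp, pauli_commutator a⟩
    · exact ⟨_, _, by simp, pauli_commutator' a⟩
  have := conj_singletIsometry_coll_mul_coll a (pauli a) (pauli c) u
  have h0 : coll 0 u = 0 := by simp [coll]
  rw [hc, sub_self, coll_smul, h0, zero_mul, Matrix.mul_zero, Matrix.zero_mul, add_zero,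
    mul_smul_comm, Matrix.mul_smul, Matrix.smul_mul, smul_eq_zero] at this
  exact this.resolve_left hk

theorem conj_singletIsometry_add_one (a : Fin 3) (u : Fin 4 → ℝ) :
    singletIsometryᴴ * (coll (pauli (a + 1)) u * coll (pauli (a + 1)) u) * singletIsometry =
      singletIsometryᴴ * (coll (pauli a) u * coll (pauli a) u) * singletIsometry := by
  have e : a + 2 + 1 = a ∧ a + 2 + 2 = a + 1 := by decide +revert
  have h := conj_singletIsometry_coll_mul_coll (a + 2) (pauli a) (pauli (a + 1)) u
  have h1 := pauli_commutator (a + 2)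
  have h2 := pauli_commutator' (a + 2)
  rw [e.1, e.2] at h1 h2
  rw [h1, h2, coll_smul, coll_smul, mul_smul_comm, smul_mul_assoc, Matrix.mul_smul,
    Matrix.mul_smul, Matrix.smul_mul, Matrix.smul_mul, neg_smul, neg_add_eq_zero] at h
  exact (smul_right_injective _ (by simp : (2 * Complex.I) ≠ 0) h).symm

/-- The compression to the singlet space of the square of a weighted collective operator. -/
noncomputable def responseMatrix (u : Fin 4 → ℝ) : Matrix (Fin 2) (Fin 2) ℂ :=
  Matrix.of fun x y => (singletNorm x * singletNorm y : ℂ) *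
    ∑ f, (singlet f x * singlet f y : ℂ) * (∑ s, u s * ((![1, -1] : Fin 2 → ℤ) (f s) : ℂ)) ^ 2

theorem coll_PZ_mul_apply {κ : Type*} (u : Fin 4 → ℝ) (M : Matrix (Fin 4 → Fin 2) κ ℂ)
    (f : Fin 4 → Fin 2) (y : κ) :
    (coll PZ u * M) f y = (∑ s, u s * ((![1, -1] : Fin 2 → ℤ) (f s) : ℂ)) * M f y := by
  have h (p : Fin 2) (F : Fin 2 → ℂ) : ∑ c, PZ p c * F c = ((![1, -1] : Fin 2 → ℤ) p : ℂ) * F p := by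
    fin_cases p <;> simp [PZ]
  simp only [coll, Matrix.sum_mul, Matrix.smul_mul, Matrix.sum_apply, Matrix.smul_apply,
    Finset.sum_mul]
  refine Finset.sum_congr rfl fun s _ => ?_
  rw [loc_mul_apply, h, Function.update_eq_self, Complex.real_smul, mul_assoc]

theorem conj_singletIsometry_coll_PZ (u : Fin 4 → ℝ) :
    singletIsometryᴴ * (coll PZ u * coll PZ u) * singletIsometry = responseMatrix u := by
  ext x y
  rw [Matrix.mul_assoc, Matrix.mul_assoc, Matrix.mul_apply, responseMatrix, Matrix.of_apply,
    Finset.mul_sum]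
  refine Finset.sum_congr rfl fun f _ => ?_
  rw [coll_PZ_mul_apply, coll_PZ_mul_apply, singletIsometry_conjTranspose_apply,
    singletIsometry_apply]
  ring

theorem singletIsometry_second_order (a b : Fin 3) (u : Fin 4 → ℝ) :
    singletIsometryᴴ * (coll (pauli a) u * coll (pauli b) u) * singletIsometry =
      if a = b then responseMatrix u else 0 := by
  split_ifs with h
  · subst h
    have h0 := conj_singletIsometry_add_one 0 u
    have h1 := conj_singletIsometry_add_one 1 u
    have h2 := conj_singletIsometry_coll_PZ u
    fin_cases a
    · exact h0.symm.trans (h1.symm.trans h2)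
    · exact h1.symm.trans h2
    · exact h2
  · exact conj_singletIsometry_of_ne h u

theorem responseMatrix_smul (r : ℝ) (u : Fin 4 → ℝ) :
    responseMatrix (r • u) = (r ^ 2) • responseMatrix u := by
  ext x y
  simp only [responseMatrix, Matrix.of_apply, Matrix.smul_apply, Complex.real_smul, Pi.smul_apply,
    smul_eq_mul, Complex.ofReal_mul, mul_assoc, ← Finset.mul_sum, mul_pow]
  simp only [mul_left_comm _ ((r : ℂ) ^ 2), ← Finset.mul_sum, Complex.ofReal_pow]

theorem responseMatrix_intCast (u : Fin 4 → ℤ) (x y : Fin 2) :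
    responseMatrix (fun s => (u s : ℝ)) x y =
      (singletNorm x * singletNorm y : ℂ) * (singletResponse u x y : ℂ) := by
  simp [responseMatrix, singletResponse]

theorem exists_weights_of_responseMatrix {P : Matrix (Fin 2) (Fin 2) ℂ} {u : Fin 4 → ℝ}
    {d c s : ℝ} (hc : 0 < c) (h : responseMatrix u = d • 1 + (c * s) • P) :
    ∃ u, ∃ d : ℝ, responseMatrix u = d • 1 + s • P := by
  refine ⟨(Real.sqrt c)⁻¹ • u, c⁻¹ * d, ?_⟩
  rw [responseMatrix_smul, h, inv_pow, Real.sq_sqrt hc.le, smul_add, smul_smul, smul_smul,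
    inv_mul_cancel_left₀ hc.ne']

theorem exists_responseMatrix_eq (P : Matrix (Fin 2) (Fin 2) ℂ) (hP : P = PX ∨ P = PZ) (s : ℝ)
    (hs : s = 1 ∨ s = -1) : ∃ u, ∃ d : ℝ, responseMatrix u = d • 1 + s • P := by
  obtain ⟨h1, h2, h3, h4⟩ := singletResponse_values
  have hr : (((Real.sqrt 12)⁻¹ : ℝ) : ℂ) * (((Real.sqrt 12)⁻¹ : ℝ) : ℂ) = 1 / 12 := by
    rw [← Complex.ofReal_mul, ← mul_inv, Real.mul_self_sqrt (by norm_num)]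
    norm_num
  push_cast at hr
  have h12 : 0 < Real.sqrt 12 := by positivity
  rcases hP with rfl | rfl <;> rcases hs with rfl | rfl
  · refine exists_weights_of_responseMatrix
      (u := fun s => ((![-2, 1, 4, 0] : Fin 4 → ℤ) s : ℝ)) (d := 25) (c := 48 / Real.sqrt 12) (by positivity) ?_
    ext x y
    rw [responseMatrix_intCast, h3]
    fin_cases x <;> fin_cases y <;> simp [singletNorm, PX, hr] <;> ring
  · refine exists_weights_of_responseMatrix
      (u := fun s => ((![1, -2, 4, 0] : Fin 4 → ℤ) s : ℝ)) (d := 25) (c := 48 / Real.sqrt 12) (by positivity) ?_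
    ext x y
    rw [responseMatrix_intCast, h4]
    fin_cases x <;> fin_cases y <;> simp [singletNorm, PX, hr] <;> ring
  · refine exists_weights_of_responseMatrix
      (u := fun s => ((![1, -1, 0, 0] : Fin 4 → ℤ) s : ℝ)) (d := 8 / 3) (c := 4 / 3) (by positivity) ?_
    ext x y
    rw [responseMatrix_intCast, h1]
    fin_cases x <;> fin_cases y <;> simp [singletNorm, PZ, hr] <;> ring
  · refine exists_weights_of_responseMatrix
      (u := fun s => ((![1, 1, 0, 0] : Fin 4 → ℤ) s : ℝ)) (d := 4 / 3) (c := 4 / 3) (by positivity) ?_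
    ext x y
    rw [responseMatrix_intCast, h2]
    fin_cases x <;> fin_cases y <;> simp [singletNorm, PZ, hr]
    ring

end SingletGadget

section SingletGadgets

theorem coll_one_mul_coll_mul {A B : Matrix (Fin 2) (Fin 2) ℂ} {κ : Type*}
    {v : Matrix (Fin 4 → Fin 2) κ ℂ} (h : coll A 1 * v = 0) (u : Fin 4 → ℝ) :
    coll A 1 * (coll B u * v) = coll (A * B - B * A) u * v := by
  rw [← Matrix.mul_assoc, coll_one_mul_coll, Matrix.add_mul, Matrix.mul_assoc, h, Matrix.mul_zero,
    zero_add]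

theorem coll_sum {A : Type*} [Fintype A] (B : A → Matrix (Fin 2) (Fin 2) ℂ) (u : Fin 4 → ℝ) :
    coll (∑ a, B a) u = ∑ a, coll (B a) u := by
  simp only [coll, map_sum, Finset.smul_sum]
  exact Finset.sum_comm

theorem penalty_mul_coll_mul {A κ : Type*} [Fintype A] {σ : A → Matrix (Fin 2) (Fin 2) ℂ}
    {v : Matrix (Fin 4 → Fin 2) κ ℂ} (h : ∀ a, coll (σ a) 1 * v = 0)
    {B : Matrix (Fin 2) (Fin 2) ℂ} {e : ℝ}
    (he : ∑ a, (σ a * (σ a * B - B * σ a) - (σ a * B - B * σ a) * σ a) = e • B)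
    (u : Fin 4 → ℝ) :
    (∑ a, coll (σ a) 1 * coll (σ a) 1) * (coll B u * v) = e • (coll B u * v) := by
  simp only [Matrix.sum_mul, Matrix.mul_assoc, coll_one_mul_coll_mul (h _)]
  rw [← Matrix.sum_mul, ← coll_sum, he, ← Complex.coe_smul, coll_smul, Matrix.smul_mul,
    Complex.coe_smul]

theorem sum_fin_four_fun {M : Type*} [AddCommMonoid M] (F : (Fin 4 → Fin 2) → M) :
    ∑ f, F f = ∑ a, ∑ b, ∑ c, ∑ d, F ![a, b, c, d] := by
  let e : Fin 2 × Fin 2 × Fin 2 × Fin 2 ≃ (Fin 4 → Fin 2) :=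
    { toFun := fun p => ![p.1, p.2.1, p.2.2.1, p.2.2.2]
      invFun := fun f => (f 0, f 1, f 2, f 3)
      left_inv := fun p => rfl
      right_inv := fun f => by ext i; fin_cases i <;> rfl }
  simp only [← e.sum_comp, Fintype.sum_prod_type]
  rfl

theorem coll_one_mulVec_apply (B : Matrix (Fin 2) (Fin 2) ℂ) (x : (Fin 4 → Fin 2) → ℂ)
    (a b c d : Fin 2) : (coll B 1 *ᵥ x) ![a, b, c, d] =
      ∑ t, B a t * x ![t, b, c, d] + ∑ t, B b t * x ![a, t, c, d] +
        ∑ t, B c t * x ![a, b, t, d] + ∑ t, B d t * x ![a, b, c, t] := by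
  have h0 (t : Fin 2) : Function.update ![a, b, c, d] 0 t = ![t, b, c, d] := by
    ext i; fin_cases i <;> rfl
  have h1 (t : Fin 2) : Function.update ![a, b, c, d] 1 t = ![a, t, c, d] := by
    ext i; fin_cases i <;> rfl
  have h2 (t : Fin 2) : Function.update ![a, b, c, d] 2 t = ![a, b, t, d] := by
    ext i; fin_cases i <;> rfl
  have h3 (t : Fin 2) : Function.update ![a, b, c, d] 3 t = ![a, b, c, t] := by
    ext i; fin_cases i <;> rfl
  simp only [coll, Pi.one_apply, one_smul, Fin.sum_univ_four, Matrix.add_mulVec, Pi.add_apply,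
    loc_mulVec, h0, h1, h2, h3]
  rfl

theorem singletIsometry_mulVec_conjTranspose_mulVec {x : (Fin 4 → Fin 2) → ℂ}
    (hX : coll PX 1 *ᵥ x = 0) (hY : coll PY 1 *ᵥ x = 0) :
    singletIsometry *ᵥ (singletIsometryᴴ *ᵥ x) = x := by
  have hZ : coll PZ 1 *ᵥ x = 0 := by
    have h : (coll PX 1 * coll PY 1) *ᵥ x =
        (coll PY 1 * coll PX 1 + coll ((2 * Complex.I) • PZ) 1) *ᵥ x :=
      congrArg (· *ᵥ x) ((coll_one_mul_coll PX PY 1).trans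
        (by rw [show PX * PY - PY * PX = (2 * Complex.I) • PZ from pauli_commutator 0]))
    rw [← Matrix.mulVec_mulVec, hY, Matrix.add_mulVec, ← Matrix.mulVec_mulVec, hX, coll_smul,
      Matrix.smul_mulVec, Matrix.mulVec_zero, Matrix.mulVec_zero, zero_add, eq_comm,
      smul_eq_zero] at h
    exact h.resolve_left (by simp)
  have hX' (a b c d : Fin 2) := (coll_one_mulVec_apply PX x a b c d).symm.trans (congrFun hX _)
  have hZ' (a b c d : Fin 2) := (coll_one_mulVec_apply PZ x a b c d).symm.trans (congrFun hZ _)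
  simp only [PX, PZ, Fin.sum_univ_two, Pi.zero_apply] at hX' hZ'
  have hn0 : (singletNorm 0 : ℂ) * singletNorm 0 = 1 / 4 := by
    norm_num [singletNorm]
  have hn1 : (singletNorm 1 : ℂ) * singletNorm 1 = 1 / 12 := by
    rw [← Complex.ofReal_mul]
    have := singletNorm_mul_self 1
    simp only [Matrix.cons_val_one, Matrix.cons_val_fin_one] at this
    rw [show singletNorm 1 * singletNorm 1 = 1 / 12 by linarith]
    norm_num
  have key (f : Fin 4 → Fin 2) : (singletIsometry *ᵥ (singletIsometryᴴ *ᵥ x)) f =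
      ∑ g, (1 / 4 * (singlet f 0 * singlet g 0 : ℤ) + 1 / 12 * (singlet f 1 * singlet g 1 : ℤ)) *
        x g := by
    simp only [Matrix.mulVec, dotProduct, Fin.sum_univ_two, singletIsometry_conjTranspose_apply,
      singletIsometry_apply, Finset.mul_sum, ← Finset.sum_add_distrib]
    refine Finset.sum_congr rfl fun g _ => ?_
    push_cast
    linear_combination (singlet f 0 * singlet g 0 * x g : ℂ) * hn0 +
      (singlet f 1 * singlet g 1 * x g : ℂ) * hn1
  have z0 : x ![0, 0, 0, 0] = 0 := by
    linear_combination (by simpa using hZ' 0 0 0 0 : _ = (0 : ℂ)) / 4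
  have z1 : x ![1, 0, 0, 0] = 0 := by simpa using hZ' 1 0 0 0
  have z2 : x ![0, 1, 0, 0] = 0 := by simpa using hZ' 0 1 0 0
  have z3 : x ![0, 0, 1, 0] = 0 := by simpa using hZ' 0 0 1 0
  have z4 : x ![0, 0, 0, 1] = 0 := by simpa using hZ' 0 0 0 1
  have z5 : x ![0, 1, 1, 1] = 0 := by simpa using hZ' 0 1 1 1
  have z6 : x ![1, 0, 1, 1] = 0 := by simpa using hZ' 1 0 1 1
  have z7 : x ![1, 1, 0, 1] = 0 := by simpa using hZ' 1 1 0 1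
  have z8 : x ![1, 1, 1, 0] = 0 := by simpa using hZ' 1 1 1 0
  have z9 : x ![1, 1, 1, 1] = 0 := by
    linear_combination (by simpa using hZ' 1 1 1 1 : _ = (0 : ℂ)) / (-4)
  have e1 := hX' 1 0 0 0
  have e2 := hX' 0 1 0 0
  have e3 := hX' 0 0 1 0
  have e4 := hX' 0 0 0 1
  have e5 := hX' 0 1 1 1
  simp [*] at e1 e2 e3 e4 e5
  have r1 : x ![0, 0, 1, 1] = x ![1, 1, 0, 0] := by linear_combination e5 - e2
  have r2 : x ![0, 1, 0, 1] = x ![1, 0, 1, 0] := by linear_combination e5 - e3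
  have r3 : x ![0, 1, 1, 0] = x ![1, 0, 0, 1] := by linear_combination e5 - e4
  have r4 : x ![1, 0, 0, 1] = - x ![1, 1, 0, 0] - x ![1, 0, 1, 0] := by linear_combination e1
  ext f
  obtain ⟨a, b, c, d, rfl⟩ : ∃ a b c d, f = ![a, b, c, d] :=
    ⟨f 0, f 1, f 2, f 3, by ext i; fin_cases i <;> rfl⟩
  rw [key, sum_fin_four_fun]
  simp only [Fin.sum_univ_two, z0, z1, z2, z3, z4, z5, z6, z7, z8, z9, r1, r2, r3, r4]
  fin_cases a <;> fin_cases b <;> fin_cases c <;> fin_cases d <;>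
    simp [singlet, z0, z1, z2, z3, z4, z5, z6, z7, z8, z9, r1, r2, r3, r4] <;> ring

theorem pauli_mul_self (a : Fin 3) : pauli a * pauli a = 1 := by
  ext x y
  fin_cases a <;> fin_cases x <;> fin_cases y <;> simp [pauli, PX, PY, PZ]

theorem pauli_double_commutator (a b : Fin 3) :
    pauli a * (pauli a * pauli b - pauli b * pauli a) -
      (pauli a * pauli b - pauli b * pauli a) * pauli a =
      (if a = b then 0 else 4 : ℝ) • pauli b := by
  rcases eq_or_ne a b with rfl | h
  · simp
  have h3 : pauli b * pauli a = -(pauli a * pauli b) := by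
    ext x y
    fin_cases a <;> fin_cases b <;> simp at h <;> fin_cases x <;> fin_cases y <;>
      simp [pauli, PX, PY, PZ]
  have h4 : pauli a * (pauli b * pauli a) = -pauli b := by
    rw [h3, mul_neg, ← mul_assoc, pauli_mul_self, one_mul]
  have h5 : pauli a * pauli b * pauli a = -pauli b := by rw [mul_assoc, h4]
  have h6 : pauli b * pauli a * pauli a = pauli b := by rw [mul_assoc, pauli_mul_self, mul_one]
  rw [if_neg h, mul_sub, sub_mul, h4, h5, h6, ← mul_assoc, pauli_mul_self, one_mul]
  module

theorem sum_ite_eq_zero_four {A : Type*} [Fintype A] [DecidableEq A] (b : A) :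
    ∑ a : A, (if a = b then 0 else 4 : ℝ) = 4 * (Fintype.card A - 1) := by
  have h (a : A) : (if a = b then 0 else 4 : ℝ) = 4 - if a = b then 4 else 0 := by
    split_ifs <;> norm_num
  simp only [h, Finset.sum_sub_distrib, Finset.sum_ite_eq', Finset.mem_univ, if_true,
    Finset.sum_const, Finset.card_univ, nsmul_eq_mul]
  ring

theorem isGadget_pauli : IsGadget pauli singletIsometry 8 responseMatrix where
  nonempty := ⟨0⟩
  isHermitian := isHermitian_pauli
  isometry := singletIsometry_isometry
  coll_one_mul := coll_pauli_one_mul_singletIsometry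
  eq_of_mulVec x h := singletIsometry_mulVec_conjTranspose_mulVec (h 0) (h 1)
  pos := by norm_num
  penalty_mul b u := by
    refine penalty_mul_coll_mul coll_pauli_one_mul_singletIsometry ?_ u
    rw [Finset.sum_congr rfl fun a _ => pauli_double_commutator a b, ← Finset.sum_smul,
      sum_ite_eq_zero_four, Fintype.card_fin]
    norm_num
  first_order := singletIsometry_first_order
  second_order := singletIsometry_second_order
  exists_weights := exists_responseMatrix_eq

theorem isGadget_pauli_castSucc :
    IsGadget (fun a : Fin 2 => pauli a.castSucc) singletIsometry 4 responseMatrix where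
  nonempty := ⟨0⟩
  isHermitian a := isHermitian_pauli a.castSucc
  isometry := singletIsometry_isometry
  coll_one_mul a := coll_pauli_one_mul_singletIsometry a.castSucc
  eq_of_mulVec x h := singletIsometry_mulVec_conjTranspose_mulVec (h 0) (h 1)
  pos := by norm_num
  penalty_mul b u := by
    refine penalty_mul_coll_mul (σ := fun a : Fin 2 => pauli a.castSucc)
      (B := pauli b.castSucc) (fun a => coll_pauli_one_mul_singletIsometry a.castSucc) ?_ u
    rw [Finset.sum_congr rfl fun a _ => pauli_double_commutator a.castSucc b.castSucc,
      ← Finset.sum_smul]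
    simp only [Fin.castSucc_inj]
    rw [sum_ite_eq_zero_four, Fintype.card_fin]
    norm_num
  first_order a u := singletIsometry_first_order a.castSucc u
  second_order a b u := by
    refine (singletIsometry_second_order a.castSucc b.castSucc u).trans ?_
    simp only [Fin.castSucc_inj]
  exists_weights := exists_responseMatrix_eq

end SingletGadgets

section Qubits

set_option linter.unusedSectionVars false

/-- Configurations of `4 n` qubits, regarded as configurations of `n` blocks of four qubits. -/
def blockEquiv (n : ℕ) : (Fin (n * 4) → Fin 2) ≃ (Fin n → Fin 4 → Fin 2) :=
  (Equiv.arrowCongr finProdFinEquiv.symm (Equiv.refl _)).trans (Equiv.curry _ _ _)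

theorem blockEquiv_apply {n : ℕ} (g : Fin (n * 4) → Fin 2) (i : Fin n) (s : Fin 4) :
    blockEquiv n g i s = g (finProdFinEquiv (i, s)) := rfl

theorem onSite_eq_loc {m : ℕ} (i : Fin m) (B : Matrix (Fin 2) (Fin 2) ℂ) :
    onSite i B = loc i B := by
  ext f g
  rw [loc_apply, onSite, Matrix.of_apply]

theorem loc_loc_submatrix_blockEquiv {n : ℕ} (i : Fin n) (s : Fin 4)
    (B : Matrix (Fin 2) (Fin 2) ℂ) :
    (loc i (loc s B)).submatrix (blockEquiv n) (blockEquiv n) = loc (finProdFinEquiv (i, s)) B := by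
  ext f g
  rw [Matrix.submatrix_apply, loc_eq, loc_eq (finProdFinEquiv (i, s)), tens_apply, tens_apply,
    ← finProdFinEquiv.prod_comp, Fintype.prod_prod_type]
  refine Finset.prod_congr rfl fun j _ => ?_
  rcases eq_or_ne j i with rfl | h
  · rw [Function.update_self, loc_eq, tens_apply]
    refine Finset.prod_congr rfl fun t _ => ?_
    rcases eq_or_ne t s with rfl | h <;> simp [blockEquiv_apply, *]
  · rw [Function.update_of_ne h, ← tens_one, tens_apply]
    refine Finset.prod_congr rfl fun t _ => ?_
    rw [Function.update_of_ne fun h' => h (Prod.ext_iff.1 (finProdFinEquiv.injective h')).1]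
    rfl

variable {A : Type*} [Fintype A] [DecidableEq A] {σ : A → Matrix (Fin 2) (Fin 2) ℂ}

/-- The operators of the form `c + ∑ w_{pq} h_{pq}` with `p < q` and `h_{pq} = ∑ₐ σᵃ_p σᵃ_q`. -/
def IsInteraction {m : ℕ} (σ : A → Matrix (Fin 2) (Fin 2) ℂ)
    (M : Matrix (Fin m → Fin 2) (Fin m → Fin 2) ℂ) : Prop :=
  ∃ (c : ℝ) (w : Fin m → Fin m → ℝ), M = c • (1 : Matrix (Fin m → Fin 2) (Fin m → Fin 2) ℂ) +
    ∑ i, ∑ j, if i < j then w i j • ∑ a, loc i (σ a) * loc j (σ a) else 0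

theorem isInteraction_smul_one {m : ℕ} (c : ℝ) :
    IsInteraction σ (c • (1 : Matrix (Fin m → Fin 2) (Fin m → Fin 2) ℂ)) :=
  ⟨c, 0, by simp⟩

theorem isInteraction_pair_of_lt {m : ℕ} {p q : Fin m} (h : p < q) :
    IsInteraction σ (∑ a, loc p (σ a) * loc q (σ a)) := by
  refine ⟨0, fun i j => if i = p ∧ j = q then 1 else 0, ?_⟩
  rw [zero_smul, zero_add, Finset.sum_eq_single p, Finset.sum_eq_single q]
  · simp [h]
  · intro j _ hj
    simp [hj]
  · simp
  · intro i _ hi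
    simp [hi]
  · simp

theorem isInteraction_pair {m : ℕ} (hσ : ∀ a, σ a * σ a = 1) (p q : Fin m) :
    IsInteraction σ (∑ a, loc p (σ a) * loc q (σ a)) := by
  rcases lt_trichotomy p q with h | rfl | h
  · exact isInteraction_pair_of_lt h
  · have : ∑ a, loc p (σ a) * loc p (σ a) = (Fintype.card A : ℝ) • 1 := by
      simp only [loc_mul_loc, hσ, loc_one, Finset.sum_const, Finset.card_univ]
      rw [Nat.cast_smul_eq_nsmul]
    rw [this]
    exact isInteraction_smul_one _
  · simp only [loc_comm h.ne']
    exact isInteraction_pair_of_lt h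

theorem isInteraction_submatrix_blockEquiv {n : ℕ} (hσ : ∀ a, σ a * σ a = 1)
    {M : Matrix (Fin n → Fin 4 → Fin 2) (Fin n → Fin 4 → Fin 2) ℂ}
    (hM : M ∈ interactionSpan (Fin n) σ) :
    IsInteraction σ (M.submatrix (blockEquiv n) (blockEquiv n)) := by
  induction hM using Submodule.span_induction with
  | mem M hM =>
    rcases hM with rfl | ⟨⟨⟨i, s⟩, ⟨j, t⟩⟩, rfl⟩
    · rw [Matrix.submatrix_one_equiv]
      simpa using isInteraction_smul_one (σ := σ) (m := n * 4) 1
    · have : (∑ a, loc i (loc s (σ a)) * loc j (loc t (σ a))).submatrix (blockEquiv n)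
          (blockEquiv n) = ∑ a, loc (finProdFinEquiv (i, s)) (σ a) *
            loc (finProdFinEquiv (j, t)) (σ a) := by
        simp only [← loc_loc_submatrix_blockEquiv, Matrix.submatrix_mul_equiv]
        ext f g
        simp [Matrix.sum_apply]
      exact this ▸ isInteraction_pair hσ _ _
  | zero => exact ⟨0, 0, by simp⟩
  | add M N _ _ hM hN =>
    obtain ⟨c, w, h⟩ := hM
    obtain ⟨c', w', h'⟩ := hN
    refine ⟨c + c', w + w', ?_⟩
    rw [Matrix.submatrix_add, Pi.add_apply, Pi.add_apply, h, h', add_smul, add_add_add_comm,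
      ← Finset.sum_add_distrib]
    congr 1
    refine Finset.sum_congr rfl fun i _ => ?_
    rw [← Finset.sum_add_distrib]
    refine Finset.sum_congr rfl fun j _ => ?_
    split_ifs
    · rw [Pi.add_apply, Pi.add_apply, add_smul]
    · rw [add_zero]
  | smul r M _ hM =>
    obtain ⟨c, w, h⟩ := hM
    refine ⟨r * c, r • w, ?_⟩
    rw [Matrix.submatrix_smul, Pi.smul_apply, Pi.smul_apply, h]
    simp only [smul_add, smul_smul, Finset.smul_sum, Pi.smul_apply, smul_eq_mul, smul_ite,
      smul_zero]

theorem IsGadget.exists_isInteraction {v : Matrix (Fin 4 → Fin 2) (Fin 2) ℂ} {e : ℝ}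
    {D : (Fin 4 → ℝ) → Matrix (Fin 2) (Fin 2) ℂ} (h : IsGadget σ v e D)
    (hσ : ∀ a, σ a * σ a = 1) {n : ℕ} (α : Fin n → Fin n → ℝ) (β γ : Fin n → ℝ)
    (a b : Fin n → Fin n → Matrix (Fin 2) (Fin 2) ℂ)
    (hab : ∀ i j : Fin n, (a i j = PX ∨ a i j = PZ) ∧ (b i j = PX ∨ b i j = PZ))
    {H : Matrix (Fin n → Fin 2) (Fin n → Fin 2) ℂ}
    (hH : H = (∑ i : Fin n, ∑ j : Fin n,
        if j < i then α i j • (loc i (a i j) * loc j (b i j)) else 0)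
      + ∑ k : Fin n, (β k • loc k PX + γ k • loc k PZ))
    {Δ η ε : ℝ} (hΔ : opNorm H < Δ) (hη : 0 < η) (hε : 0 < ε) :
    ∃ (H' : Matrix (Fin (n * 4) → Fin 2) (Fin (n * 4) → Fin 2) ℂ)
      (W : Matrix (Fin (n * 4) → Fin 2) (Fin n → Fin 2) ℂ),
      IsInteraction σ H' ∧ Wᴴ * W = 1 ∧
        opNorm (W - (enc (Fin n) v).submatrix (blockEquiv n) id) ≤ η ∧
        W * Wᴴ = lowEnergyProj H' Δ ∧
        opNorm (H' * lowEnergyProj H' Δ - W * H * Wᴴ) ≤ ε := by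
  obtain ⟨B, hB, C, hC, T, hBh, hCh, hKT, hT⟩ := h.exists_perturbation α β γ a b hab
  rw [← hH] at hT
  set K : Matrix (Fin n → Fin 4 → Fin 2) (Fin n → Fin 4 → Fin 2) ℂ :=
    ∑ i, blockTerm σ i i 1 1 with hK
  have hKm : K ∈ interactionSpan (Fin n) σ :=
    Submodule.sum_mem _ fun i _ => blockTerm_mem_interactionSpan i i 1 1
  set ω := blockEquiv n
  obtain ⟨x, W, hW, hWV, hP, hHW⟩ := exists_second_order_simulation
    (K := K.submatrix ω ω) (B := B.submatrix ω ω) (C := C.submatrix ω ω)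
    (V := (enc (Fin n) v).submatrix ω id) (T₁ := T.submatrix ω id) (H := H)
    (h.posSemidef_penalty.submatrix ω) (hBh.submatrix ω) (hCh.submatrix ω)
    (by
      rw [Matrix.conjTranspose_submatrix, Matrix.submatrix_mul_equiv,
        enc_conjTranspose_mul_self h.isometry, Matrix.submatrix_id_id])
    (by rw [Matrix.submatrix_mul_equiv, h.penalty_mul_enc]; rfl)
    (by
      intro u hu
      rw [Matrix.submatrix_mulVec_equiv] at hu
      have hu' : K *ᵥ (u ∘ ω.symm) = 0 := by
        ext f
        simpa using congrFun hu (ω.symm f)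
      ext f
      rw [Matrix.conjTranspose_submatrix, Matrix.submatrix_mulVec_equiv]
      exact (congrFun (h.enc_mulVec_of_penalty_mulVec hu') (ω f)).trans (by simp))
    (by rw [Matrix.submatrix_mul_equiv, Matrix.submatrix_mul_equiv, hKT]; rfl)
    (by
      rw [Matrix.submatrix_mul_equiv, Matrix.submatrix_mul_equiv, Matrix.conjTranspose_submatrix]
      have : (B * T).submatrix ω id + (C * enc (Fin n) v).submatrix ω id =
        (B * T + C * enc (Fin n) v).submatrix ω id := rfl
      rw [this, Matrix.submatrix_mul_equiv, hT, Matrix.submatrix_id_id])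
    hΔ hη hε
  refine ⟨_, W, ?_, hW, hWV, hP, hHW⟩
  have := isInteraction_submatrix_blockEquiv hσ
    (add_mem (add_mem (Submodule.smul_mem _ (x ^ 2) hKm) (Submodule.smul_mem _ x hB)) hC)
  convert this using 2
  rw [Complex.coe_smul, Complex.coe_smul]
  rfl

/-- The qubits of a block, as an index set of four elements. -/
def blockQubits {n : ℕ} (i : Fin n) :
    Fin 4 ≃ {j : Fin (n * 4) // (finProdFinEquiv.symm j).1 = i} where
  toFun s := ⟨finProdFinEquiv (i, s), by simp⟩
  invFun j := (finProdFinEquiv.symm j.1).2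
  left_inv s := by simp
  right_inv j := by
    obtain ⟨j, rfl⟩ := j
    exact Subtype.ext (finProdFinEquiv.apply_symm_apply j)

theorem IsGadget.exists_simulation {v : Matrix (Fin 4 → Fin 2) (Fin 2) ℂ} {e : ℝ}
    {D : (Fin 4 → ℝ) → Matrix (Fin 2) (Fin 2) ℂ} (h : IsGadget σ v e D)
    (hσ : ∀ a, σ a * σ a = 1) {n : ℕ} (α : Fin n → Fin n → ℝ) (β γ : Fin n → ℝ)
    (a b : Fin n → Fin n → Matrix (Fin 2) (Fin 2) ℂ)
    (hab : ∀ i j : Fin n, (a i j = PX ∨ a i j = PZ) ∧ (b i j = PX ∨ b i j = PZ))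
    {H : Matrix (Fin n → Fin 2) (Fin n → Fin 2) ℂ}
    (hH : H = (∑ i : Fin n, ∑ j : Fin n,
        if j < i then α i j • twoSite i j (a i j) (b i j) else 0)
      + ∑ k : Fin n, (β k • onSite k PX + γ k • onSite k PZ))
    {Δ η ε : ℝ} (hΔ : opNorm H < Δ) (hη : 0 < η) (hε : 0 < ε) :
    ∃ (m : ℕ) (c : ℝ) (w : Fin m → Fin m → ℝ)
        (H' : Matrix (Fin m → Fin 2) (Fin m → Fin 2) ℂ)
        (blk : Fin m → Fin n)
        (Vi : ∀ i : Fin n, Matrix ({j : Fin m // blk j = i} → Fin 2) (Fin 2) ℂ)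
        (Vt : Matrix (Fin m → Fin 2) (Fin n → Fin 2) ℂ),
        Function.Surjective blk ∧
        (H' = c • (1 : Matrix (Fin m → Fin 2) (Fin m → Fin 2) ℂ) +
          ∑ i : Fin m, ∑ j : Fin m,
            if i < j then w i j • ∑ a, twoSite i j (σ a) (σ a) else 0) ∧
        (∀ i : Fin n, (Vi i)ᴴ * Vi i = 1) ∧
        Vtᴴ * Vt = 1 ∧
        opNorm (Vt - Matrix.of fun (g : Fin m → Fin 2) (f : Fin n → Fin 2) =>
          ∏ i : Fin n, Vi i (fun j => g j.1) (f i)) ≤ η ∧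
        Vt * Vtᴴ = lowEnergyProj H' Δ ∧
        opNorm (H' * lowEnergyProj H' Δ - Vt * H * Vtᴴ) ≤ ε := by
  simp only [twoSite, onSite_eq_loc] at hH ⊢
  obtain ⟨H', W, ⟨c, w, hH'⟩, hW, hWV, hP, hHW⟩ :=
    h.exists_isInteraction hσ α β γ a b hab hH hΔ hη hε
  refine ⟨n * 4, c, w, H', fun j => (finProdFinEquiv.symm j).1,
    fun i => v.submatrix ((blockQubits i).arrowCongr (Equiv.refl _)).symm id, W,
    fun i => ⟨finProdFinEquiv (i, 0), by simp⟩, hH', fun i => ?_, hW, hWV, hP, hHW⟩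
  rw [Matrix.conjTranspose_submatrix, Matrix.submatrix_mul_equiv, h.isometry,
    Matrix.submatrix_id_id]

end Qubits

theorem heis_eq_sum {m : ℕ} (i j : Fin m) :
    heis i j = ∑ a, twoSite i j (pauli a) (pauli a) := by
  rw [Fin.sum_univ_three]
  rfl

theorem xy_eq_sum {m : ℕ} (i j : Fin m) :
    xy i j = ∑ a : Fin 2, twoSite i j (pauli a.castSucc) (pauli a.castSucc) := by
  rw [Fin.sum_univ_two]
  rfl

/-- Heisenberg (or XY) Hamiltonians with variable coupling strengths can simulate any
qubit Hamiltonian of the form `Σ_{i>j} α_{ij} A_{ij} + Σ_k (β_k X_k + γ_k Z_k)` with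
each `A_{ij} ∈ {XX, XZ, ZX, ZZ}`, to any precision `(η, ε)` and any sufficiently
large cutoff `Δ`, via a local encoding in which each logical qubit is encoded into a
block of physical qubits by an isometry `V = V₁ ⊗ ⋯ ⊗ Vₙ`. -/
theorem heisenberg_and_xy_simulate_pauli_hamiltonians
    {n : ℕ}
    (α : Fin n → Fin n → ℝ) (β γ : Fin n → ℝ)
    (a b : Fin n → Fin n → Matrix (Fin 2) (Fin 2) ℂ)
    (hab : ∀ i j : Fin n, (a i j = PX ∨ a i j = PZ) ∧ (b i j = PX ∨ b i j = PZ))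
    (H : Matrix (Fin n → Fin 2) (Fin n → Fin 2) ℂ)
    (hHdef : H = (∑ i : Fin n, ∑ j : Fin n,
        if j < i then α i j • twoSite i j (a i j) (b i j) else 0)
      + ∑ k : Fin n, (β k • onSite k PX + γ k • onSite k PZ))
    (useXY : Bool)
    (η ε : ℝ) (hη : 0 < η) (hε : 0 < ε) :
    ∃ Δ₀ : ℝ, 0 < Δ₀ ∧ ∀ Δ : ℝ, Δ₀ ≤ Δ →
      ∃ (m : ℕ) (c : ℝ) (w : Fin m → Fin m → ℝ)
        (H' : Matrix (Fin m → Fin 2) (Fin m → Fin 2) ℂ)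
        (blk : Fin m → Fin n)
        (Vi : ∀ i : Fin n, Matrix ({j : Fin m // blk j = i} → Fin 2) (Fin 2) ℂ)
        (Vt : Matrix (Fin m → Fin 2) (Fin n → Fin 2) ℂ),
        Function.Surjective blk ∧
        (H' = c • (1 : Matrix (Fin m → Fin 2) (Fin m → Fin 2) ℂ) +
          ∑ i : Fin m, ∑ j : Fin m,
            if i < j then w i j • (if useXY then xy i j else heis i j) else 0) ∧
        (∀ i : Fin n, (Vi i)ᴴ * Vi i = 1) ∧
        Vtᴴ * Vt = 1 ∧
        opNorm (Vt - Matrix.of fun (g : Fin m → Fin 2) (f : Fin n → Fin 2) =>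
          ∏ i : Fin n, Vi i (fun j => g j.1) (f i)) ≤ η ∧
        Vt * Vtᴴ = lowEnergyProj H' Δ ∧
        opNorm (H' * lowEnergyProj H' Δ - Vt * H * Vtᴴ) ≤ ε := by
  refine ⟨opNorm H + 1, add_pos_of_nonneg_of_pos (norm_nonneg _) one_pos, fun Δ hΔ => ?_⟩
  have hΔ' : opNorm H < Δ := (lt_add_one _).trans_le hΔ
  cases useXY with
  | false =>
    simp only [Bool.false_eq_true, if_false, heis_eq_sum]
    exact isGadget_pauli.exists_simulation pauli_mul_self α β γ a b hab hHdef hΔ' hη hε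
  | true =>
    simp only [if_true, xy_eq_sum]
    exact isGadget_pauli_castSucc.exists_simulation (fun a => pauli_mul_self a.castSucc)
      α β γ a b hab hHdef hΔ' hη hε
end

section
/- Let k, n ∈ ℕ and let H be a real k-local Hamiltonian on n qubits: a Hermitian 2ⁿ×2ⁿ matrix with all entries real, expressible as a sum of terms each acting non-trivially on at most k of the n qubits. Then for all η > 0 and ε > 0 there exists Δ₀ > 0 such that for every Δ ≥ Δ₀ there exist m ∈ ℕ with m ≥ n, a Hamiltonian H' on m qubits which is (k+1)-local and whose Pauli decomposition contains no Y factors (i.e. H' is a real linear combination of tensor products of the matrices 1, X, Z, each product acting non-trivially on at most k+1 qubits), a product state |φ⟩ of the m − n ancilla qubits, and an isometry Ṽ : ℂ^{2ⁿ} → ℂ^{2ᵐ}, such that, with V : ℂ^{2ⁿ} → ℂ^{2ᵐ} defined by V|ψ⟩ = |ψ⟩ ⊗ |φ⟩: ‖Ṽ − V‖ ≤ η, Ṽ·Ṽ† = P_{≤Δ(H')}, and ‖H'·P_{≤Δ(H')} − Ṽ·H·Ṽ†‖ ≤ ε. -/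
open scoped Matrix Kronecker ComplexOrder Classical

/-- An operator on qubits indexed by `ι` acts (non-trivially) only within the subset
`S` of the qubits. -/
def actsWithin {ι : Type*} [Fintype ι] [DecidableEq ι] (S : Finset ι)
    (A : Matrix (ι → Fin 2) (ι → Fin 2) ℂ) : Prop :=
  ∃ B : Matrix ({x // x ∈ S} → Fin 2) ({x // x ∈ S} → Fin 2) ℂ,
    A = Matrix.of fun f g => B (fun x => f x.1) (fun x => g x.1) *
      ∏ j ∈ Sᶜ, if f j = g j then 1 else 0

/-- A `k`-local Hamiltonian: a sum of Hermitian terms, each acting non-trivially on at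
most `k` qubits. -/
def IsKLocal {ι : Type*} [Fintype ι] [DecidableEq ι] (k : ℕ)
    (H : Matrix (ι → Fin 2) (ι → Fin 2) ℂ) : Prop :=
  ∃ (T : ℕ) (h : Fin T → Matrix (ι → Fin 2) (ι → Fin 2) ℂ),
    (∀ t, (h t).IsHermitian ∧ ∃ S : Finset ι, S.card ≤ k ∧ actsWithin S (h t)) ∧
    H = ∑ t, h t

section PerturbationTheory

open Matrix
open scoped Matrix.Norms.L2Operator MatrixOrder

set_option linter.unusedSectionVars false

variable {M N : Type*} [Fintype M] [DecidableEq M] [Fintype N] [DecidableEq N]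

lemma norm_le_norm_of_posSemidef {A B : Matrix N N ℂ} (hA : A.PosSemidef)
    (hAB : (B - A).PosSemidef) : ‖A‖ ≤ ‖B‖ :=
  CStarAlgebra.norm_le_norm_of_nonneg_of_le (Matrix.nonneg_iff_posSemidef.mpr hA)
    (Matrix.le_iff.mpr hAB)

lemma norm_le_one_of_isometry {V : Matrix M N ℂ} (hV : Vᴴ * V = 1) : ‖V‖ ≤ 1 := by
  have h : ‖V‖ * ‖V‖ ≤ 1 := by
    rw [← l2_opNorm_conjTranspose_mul_self, hV]
    rcases isEmpty_or_nonempty N with hN | hN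
    · simp [Subsingleton.elim (1 : Matrix N N ℂ) 0]
    · simp
  nlinarith [norm_nonneg V]

/-- A matrix `G` close to the identity has a Hermitian inverse square root close to the identity. -/
lemma exists_inv_sqrt [Nonempty N] {G : Matrix N N ℂ} (hG : G.IsHermitian) {c : ℝ}
    (hc : c ≤ 1 / 2) (hGc : ‖G - 1‖ ≤ c) :
    ∃ F : Matrix N N ℂ, F.IsHermitian ∧ F * G * F = 1 ∧ ‖F - 1‖ ≤ c := by
  have hsa : IsSelfAdjoint G := hG
  have hspec : ∀ x ∈ spectrum ℝ G, |x - 1| ≤ c := by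
    intro x hx
    have h1 : x - 1 ∈ spectrum ℝ (G - algebraMap ℝ (Matrix N N ℂ) 1) := by
      rw [← spectrum.sub_singleton_eq]
      exact ⟨x, hx, 1, rfl, rfl⟩
    have h2 := spectrum.norm_le_norm_of_mem h1
    rw [map_one] at h2
    exact h2.trans hGc
  have hpos : ∀ x ∈ spectrum ℝ G, 1 / 2 ≤ x := fun x hx => by
    have := abs_le.mp (hspec x hx)
    linarith
  have hcont : ContinuousOn (fun x : ℝ => (√x)⁻¹) (spectrum ℝ G) := by
    apply ContinuousOn.inv₀ (Real.continuous_sqrt.continuousOn)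
    intro x hx
    have := hpos x hx
    positivity
  refine ⟨cfc (fun x : ℝ => (√x)⁻¹) G, cfc_predicate _ _, ?_, ?_⟩
  · nth_rewrite 2 [← cfc_id' ℝ G]
    rw [← cfc_mul _ _ G hcont (continuousOn_id' _), ← cfc_mul (fun x : ℝ => (√x)⁻¹ * x) _ G
      (hcont.mul (continuousOn_id' _)) hcont, ← cfc_const_one ℝ G]
    apply cfc_congr
    intro x hx
    have h1 := hpos x hx
    have h2 : 0 < √x := by positivity
    have h3 := Real.mul_self_sqrt (show 0 ≤ x by linarith)
    field_simp
    nlinarith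
  · rw [← cfc_const_one ℝ G, ← cfc_sub _ _ G hcont continuousOn_const]
    apply norm_cfc_le ((norm_nonneg _).trans hGc)
    intro x hx
    have h1 := hpos x hx
    have h0 := hspec x hx
    have h2 : 0 < √x := by positivity
    have h3 := Real.mul_self_sqrt (show 0 ≤ x by linarith)
    have h4 : (√x)⁻¹ - 1 = (1 - x) / (√x * (1 + √x)) := by
      field_simp
      nlinarith
    have h5 : 1 / 2 ≤ √x := by nlinarith
    have h6 : 1 ≤ √x * (1 + √x) := by nlinarith
    rw [h4, norm_div, Real.norm_eq_abs, Real.norm_eq_abs, abs_sub_comm,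
      abs_of_pos (show 0 < √x * (1 + √x) by linarith)]
    exact (div_le_self (abs_nonneg _) h6).trans h0

section LowEnergy

variable {K : Matrix M M ℂ}

lemma lowEnergyProj_eq (hK : K.IsHermitian) (Δ : ℝ) :
    lowEnergyProj K Δ = (hK.eigenvectorUnitary : Matrix M M ℂ) *
      Matrix.diagonal (fun i => if hK.eigenvalues i ≤ Δ then (1 : ℂ) else 0) *
      (hK.eigenvectorUnitary : Matrix M M ℂ)ᴴ := by
  rw [lowEnergyProj, dif_pos hK]
  rfl

lemma eq_eigenvector_diagonal (hK : K.IsHermitian) :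
    K = (hK.eigenvectorUnitary : Matrix M M ℂ) *
      Matrix.diagonal (fun i => (hK.eigenvalues i : ℂ)) *
      (hK.eigenvectorUnitary : Matrix M M ℂ)ᴴ := by
  conv_lhs => rw [hK.spectral_theorem, Unitary.conjStarAlgAut_apply]
  rfl

lemma conj_unitary_mul {U D E : Matrix M M ℂ} (hU : Uᴴ * U = 1) :
    U * D * Uᴴ * (U * E * Uᴴ) = U * (D * E) * Uᴴ := by
  rw [show U * D * Uᴴ * (U * E * Uᴴ) = U * D * (Uᴴ * U) * E * Uᴴ by simp only [Matrix.mul_assoc],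
    hU, Matrix.mul_one]
  simp only [Matrix.mul_assoc]

lemma lowEnergyProj_spec (hK : K.IsHermitian) (Δ : ℝ) :
    (lowEnergyProj K Δ).IsHermitian ∧
    lowEnergyProj K Δ * lowEnergyProj K Δ = lowEnergyProj K Δ ∧
    K * lowEnergyProj K Δ = lowEnergyProj K Δ * K ∧
    ((Δ : ℂ) • lowEnergyProj K Δ - K * lowEnergyProj K Δ).PosSemidef ∧
    (K * (1 - lowEnergyProj K Δ) - (Δ : ℂ) • (1 - lowEnergyProj K Δ)).PosSemidef := by
  have hU : (hK.eigenvectorUnitary : Matrix M M ℂ)ᴴ * (hK.eigenvectorUnitary : Matrix M M ℂ) = 1 :=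
    Unitary.coe_star_mul_self hK.eigenvectorUnitary
  have hU' : (hK.eigenvectorUnitary : Matrix M M ℂ) * (hK.eigenvectorUnitary : Matrix M M ℂ)ᴴ = 1 :=
    Unitary.coe_mul_star_self hK.eigenvectorUnitary
  have hP := lowEnergyProj_eq hK Δ
  have hKd := eq_eigenvector_diagonal hK
  generalize (hK.eigenvectorUnitary : Matrix M M ℂ) = U at hU hU' hP hKd
  generalize hK.eigenvalues = lam at hP hKd
  generalize lowEnergyProj K Δ = P at hP ⊢
  have h1 : (1 : Matrix M M ℂ) = U * Matrix.diagonal (fun _ => (1 : ℂ)) * Uᴴ := by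
    simp [hU']
  have hKP : K * P = U * Matrix.diagonal
      (fun i => (lam i : ℂ) * if lam i ≤ Δ then (1 : ℂ) else 0) * Uᴴ := by
    rw [hP]
    conv_lhs => rw [hKd]
    rw [conj_unitary_mul hU, diagonal_mul_diagonal]
  have hQ : 1 - P = U * Matrix.diagonal
      (fun i => (1 : ℂ) - if lam i ≤ Δ then (1 : ℂ) else 0) * Uᴴ := by
    rw [hP]
    conv_lhs => rw [h1]
    rw [← Matrix.sub_mul, ← Matrix.mul_sub, diagonal_sub]
  refine ⟨?_, ?_, ?_, ?_, ?_⟩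
  · rw [hP]
    apply isHermitian_mul_mul_conjTranspose
    apply isHermitian_diagonal_of_self_adjoint
    ext i
    simp only [Pi.star_apply]
    split_ifs <;> simp
  · rw [hP, conj_unitary_mul hU, diagonal_mul_diagonal]
    congr 3
    ext i
    split_ifs <;> simp
  · rw [hKP, hP]
    conv_rhs => rw [hKd]
    rw [conj_unitary_mul hU, diagonal_mul_diagonal]
    congr 3
    ext i
    rw [mul_comm]
  · rw [hKP, hP, ← Matrix.smul_mul, ← Matrix.mul_smul, ← diagonal_smul, ← Matrix.sub_mul,
      ← Matrix.mul_sub, diagonal_sub]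
    apply PosSemidef.mul_mul_conjTranspose_same
    apply PosSemidef.diagonal
    intro i
    simp only [Pi.zero_apply, Pi.smul_apply, smul_eq_mul]
    split_ifs with h
    · rw [mul_one, mul_one, ← Complex.ofReal_sub]
      exact_mod_cast sub_nonneg.mpr h
    · simp
  · rw [hQ]
    nth_rewrite 1 [hKd]
    rw [conj_unitary_mul hU, diagonal_mul_diagonal, ← Matrix.smul_mul, ← Matrix.mul_smul,
      ← diagonal_smul, ← Matrix.sub_mul, ← Matrix.mul_sub, diagonal_sub]
    apply PosSemidef.mul_mul_conjTranspose_same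
    apply PosSemidef.diagonal
    intro i
    simp only [Pi.zero_apply, Pi.smul_apply, smul_eq_mul]
    split_ifs with h
    · simp
    · rw [sub_zero, mul_one, mul_one, ← Complex.ofReal_sub]
      exact_mod_cast sub_nonneg.mpr (not_le.mp h).le

end LowEnergy

set_option maxHeartbeats 1000000 in
lemma eq_zero_of_energy_le [Nonempty N] {K P : Matrix M M ℂ} {H : Matrix N N ℂ}
    {V T : Matrix M N ℂ} {δ Δ Λ : ℝ} (hK : K.IsHermitian)
    (hPΔ : ((Δ : ℂ) • P - K * P).PosSemidef) (hV : Vᴴ * V = 1) (hVT : Vᴴ * T = 1)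
    (hδ : δ ≤ 1 / 20) (hTV : ‖T - V‖ ≤ δ) (hR : ‖K * T - T * H‖ ≤ δ)
    (hΔ : ‖H‖ + 1 ≤ Δ) (hΛ : 8 * Δ < Λ)
    (hgap : ∀ w : Matrix M M ℂ, Vᴴ * w = 0 → (wᴴ * K * w - (Λ : ℂ) • (wᴴ * w)).PosSemidef)
    {Q : Matrix M M ℂ} (hQ : P * Q = Q) (hTQ : Tᴴ * Q = 0) : Q = 0 := by
  have hδ0 : 0 ≤ δ := (norm_nonneg _).trans hTV
  have hV1 := norm_le_one_of_isometry hV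
  have hT2 : ‖T‖ ≤ 2 := by
    have := norm_add_le (T - V) V
    rw [sub_add_cancel] at this
    linarith
  set R := K * T - T * H with hRdef
  have hKT : K * T = T * H + R := by rw [hRdef]; abel
  set x := Vᴴ * Q with hx
  have hxnorm : ‖x‖ ≤ δ * ‖Q‖ := by
    have : x = -((T - V)ᴴ * Q) := by
      rw [conjTranspose_sub, Matrix.sub_mul, hTQ, hx]; simp
    rw [this, norm_neg]
    refine (l2_opNorm_mul _ _).trans ?_
    rw [l2_opNorm_conjTranspose]
    gcongr
  set w := Q - T * x with hw
  have hVw : Vᴴ * w = 0 := by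
    rw [hw, Matrix.mul_sub, ← Matrix.mul_assoc, hVT, Matrix.one_mul, sub_self]
  have hg := hgap w hVw
  have hRQ : Tᴴ * K * Q = Rᴴ * Q := by
    have : Tᴴ * K = (K * T)ᴴ := by rw [conjTranspose_mul, hK.eq]
    rw [this, hKT, conjTranspose_add, conjTranspose_mul, Matrix.add_mul, Matrix.mul_assoc, hTQ]
    simp
  have hQR : Qᴴ * (K * T) = Qᴴ * R := by
    have := congrArg conjTranspose hRQ
    simpa only [conjTranspose_mul, conjTranspose_conjTranspose, hK.eq, Matrix.mul_assoc] using this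
  set Z : Matrix M M ℂ := -(Qᴴ * R * x) - xᴴ * (Rᴴ * Q) + xᴴ * Tᴴ * (T * H + R) * x with hZ
  have hwKw : wᴴ * K * w = Qᴴ * K * Q + Z := by
    have e1 : wᴴ * K * w = Qᴴ * K * Q - Qᴴ * (K * T) * x - xᴴ * (Tᴴ * K * Q)
        + xᴴ * Tᴴ * (K * T) * x := by
      rw [hw]
      simp only [conjTranspose_sub, conjTranspose_mul, Matrix.mul_sub, Matrix.sub_mul,
        Matrix.mul_assoc]
      abel
    rw [e1, hQR, hRQ, hKT, hZ]
    abel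
  have hQKQ : ((Δ : ℂ) • (Qᴴ * Q) - Qᴴ * K * Q).PosSemidef := by
    have := hPΔ.conjTranspose_mul_mul_same Q
    rwa [Matrix.mul_sub, Matrix.sub_mul, Matrix.mul_smul, Matrix.smul_mul, Matrix.mul_assoc, hQ,
      Matrix.mul_assoc, Matrix.mul_assoc, hQ, ← Matrix.mul_assoc] at this
  have hcomb : (((Δ : ℂ) • (Qᴴ * Q) + Z) - (Λ : ℂ) • (wᴴ * w)).PosSemidef := by
    have := hg.add hQKQ
    rw [hwKw] at this
    convert this using 1
    abel
  have hΛ0 : 0 ≤ Λ := by linarith [norm_nonneg H]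
  have hΔ0 : 0 ≤ Δ := by linarith [norm_nonneg H]
  have hpsd : ((Λ : ℂ) • (wᴴ * w)).PosSemidef :=
    (posSemidef_conjTranspose_mul_self w).smul (by exact_mod_cast hΛ0)
  have hn := norm_le_norm_of_posSemidef hpsd hcomb
  rw [norm_smul, l2_opNorm_conjTranspose_mul_self] at hn
  have hn2 : ‖(Δ : ℂ) • (Qᴴ * Q) + Z‖ ≤ Δ * (‖Q‖ * ‖Q‖) + ‖Z‖ := by
    refine (norm_add_le _ _).trans ?_
    rw [norm_smul, l2_opNorm_conjTranspose_mul_self]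
    simp [abs_of_nonneg hΔ0]
  have hZn : ‖Z‖ ≤ (‖H‖ + 1) * (‖Q‖ * ‖Q‖) := by
    have z1 : ‖Qᴴ * R * x‖ ≤ ‖Q‖ * δ * (δ * ‖Q‖) := by
      refine (l2_opNorm_mul _ _).trans ?_
      gcongr
      refine (l2_opNorm_mul _ _).trans ?_
      rw [l2_opNorm_conjTranspose]
      gcongr
    have z2 : ‖xᴴ * (Rᴴ * Q)‖ ≤ (δ * ‖Q‖) * (δ * ‖Q‖) := by
      refine (l2_opNorm_mul _ _).trans ?_
      rw [l2_opNorm_conjTranspose]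
      gcongr
      refine (l2_opNorm_mul _ _).trans ?_
      rw [l2_opNorm_conjTranspose]
      gcongr
    have z3 : ‖xᴴ * Tᴴ * (T * H + R) * x‖ ≤ (δ * ‖Q‖) * 2 * (2 * ‖H‖ + δ) * (δ * ‖Q‖) := by
      refine (l2_opNorm_mul _ _).trans ?_
      gcongr
      refine (l2_opNorm_mul _ _).trans ?_
      gcongr
      · refine (l2_opNorm_mul _ _).trans ?_
        rw [l2_opNorm_conjTranspose, l2_opNorm_conjTranspose]
        gcongr
      · refine (norm_add_le _ _).trans ?_
        gcongr
        refine (l2_opNorm_mul _ _).trans ?_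
        gcongr
    have z4 : ‖Z‖ ≤ ‖Qᴴ * R * x‖ + ‖xᴴ * (Rᴴ * Q)‖ + ‖xᴴ * Tᴴ * (T * H + R) * x‖ := by
      refine (norm_add_le _ _).trans ?_
      gcongr
      refine (norm_sub_le _ _).trans ?_
      rw [norm_neg]
    have q2 : 0 ≤ ‖Q‖ * ‖Q‖ := by positivity
    have hδ2 : δ * δ ≤ 1 / 20 * (1 / 20) := by gcongr
    have hh := norm_nonneg H
    have hδh : δ * δ * ‖H‖ ≤ 1 / 20 * (1 / 20) * ‖H‖ := by gcongr
    have hδ3 : δ * δ * δ ≤ 1 / 20 * (1 / 20) * (1 / 20) := by gcongr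
    have : 2 * (δ * δ) + 4 * (δ * δ * ‖H‖) + 2 * (δ * δ * δ) ≤ ‖H‖ + 1 := by linarith
    calc ‖Z‖ ≤ (2 * (δ * δ) + 4 * (δ * δ * ‖H‖) + 2 * (δ * δ * δ)) * (‖Q‖ * ‖Q‖) := by linarith
      _ ≤ _ := by gcongr
  have hwn : ‖Q‖ / 2 ≤ ‖w‖ := by
    have a1 : ‖Q‖ ≤ ‖w‖ + ‖T * x‖ := by
      have := norm_add_le w (T * x)
      rwa [hw, sub_add_cancel, ← hw] at this
    have a2 : ‖T * x‖ ≤ 2 * (δ * ‖Q‖) := (l2_opNorm_mul _ _).trans (by gcongr)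
    have a3 : δ * ‖Q‖ ≤ 1 / 20 * ‖Q‖ := by gcongr
    linarith [norm_nonneg Q]
  have hΛn : ‖(Λ : ℂ)‖ = Λ := by simp [abs_of_nonneg hΛ0]
  rw [hΛn] at hn
  by_contra hne
  have hq : 0 < ‖Q‖ := norm_pos_iff.mpr hne
  have hww : ‖Q‖ / 2 * (‖Q‖ / 2) ≤ ‖w‖ * ‖w‖ := by gcongr
  have hfin : Λ * (‖Q‖ / 2 * (‖Q‖ / 2)) ≤ (2 * Δ) * (‖Q‖ * ‖Q‖) := by
    calc Λ * (‖Q‖ / 2 * (‖Q‖ / 2)) ≤ Λ * (‖w‖ * ‖w‖) := by gcongr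
      _ ≤ Δ * (‖Q‖ * ‖Q‖) + (‖H‖ + 1) * (‖Q‖ * ‖Q‖) := by linarith
      _ ≤ Δ * (‖Q‖ * ‖Q‖) + Δ * (‖Q‖ * ‖Q‖) := by gcongr
      _ = _ := by ring
  nlinarith [mul_pos hq hq]

set_option maxHeartbeats 1000000 in
/-- An approximately invariant isometry-like map `T`, close to the isometry `V` and carrying the
low-energy part of `K`, can be corrected to an exact isometry onto the low-energy space. -/
lemma exists_simulating_isometry [Nonempty N] {K : Matrix M M ℂ} {H : Matrix N N ℂ}
    {V T : Matrix M N ℂ} {δ Δ Λ : ℝ} (hK : K.IsHermitian) (hV : Vᴴ * V = 1) (hVT : Vᴴ * T = 1)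
    (hδ : δ ≤ 1 / 20) (hTV : ‖T - V‖ ≤ δ) (hR : ‖K * T - T * H‖ ≤ δ)
    (hΔ : ‖H‖ + 1 ≤ Δ) (hΛ : 8 * Δ < Λ)
    (hgap : ∀ w : Matrix M M ℂ, Vᴴ * w = 0 → (wᴴ * K * w - (Λ : ℂ) • (wᴴ * w)).PosSemidef) :
    ∃ Vt : Matrix M N ℂ, Vtᴴ * Vt = 1 ∧ ‖Vt - V‖ ≤ 14 * δ ∧ Vt * Vtᴴ = lowEnergyProj K Δ ∧
      ‖K * lowEnergyProj K Δ - Vt * H * Vtᴴ‖ ≤ (24 * ‖H‖ + 2) * δ := by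
  obtain ⟨hP, hPP, hPK, hPΔ, hQΔ⟩ := lowEnergyProj_spec hK Δ
  generalize lowEnergyProj K Δ = P at hP hPP hPK hPΔ hQΔ ⊢
  have hδ0 : 0 ≤ δ := (norm_nonneg _).trans hTV
  have hh := norm_nonneg H
  have hV1 := norm_le_one_of_isometry hV
  set R := K * T - T * H with hRdef
  have hKT : K * T = T * H + R := by rw [hRdef]; abel
  have hP1 : ‖P‖ ≤ 1 := by
    have h : ‖P‖ * ‖P‖ = ‖P‖ := by
      rw [← l2_opNorm_conjTranspose_mul_self, hP.eq, hPP]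
    nlinarith [norm_nonneg P]
  set P' := 1 - P with hP'
  have hP'h : P'ᴴ = P' := by rw [hP', conjTranspose_sub, hP.eq, conjTranspose_one]
  have hP'P' : P' * P' = P' := by
    simp [hP', Matrix.mul_sub, Matrix.sub_mul, hPP]
  have hP'1 : ‖P'‖ ≤ 1 := by
    have h : ‖P'‖ * ‖P'‖ = ‖P'‖ := by
      rw [← l2_opNorm_conjTranspose_mul_self, hP'h, hP'P']
    nlinarith [norm_nonneg P']
  have hP'K : K * P' = P' * K := by rw [hP', Matrix.mul_sub, Matrix.sub_mul, hPK]; simp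
  set Y := P' * T with hY
  have hYn : ‖Y‖ ≤ δ := by
    have e : K * Y = Y * H + P' * R := by
      rw [hY, ← Matrix.mul_assoc, hP'K, Matrix.mul_assoc, hKT, Matrix.mul_add, Matrix.mul_assoc]
    have hPY : P' * Y = Y := by rw [hY, ← Matrix.mul_assoc, hP'P']
    have h1 : (Yᴴ * (Y * H + P' * R) - (Δ : ℂ) • (Yᴴ * Y)).PosSemidef := by
      have := hQΔ.conjTranspose_mul_mul_same Y
      rwa [Matrix.mul_sub, Matrix.sub_mul, Matrix.mul_smul, Matrix.smul_mul, Matrix.mul_assoc,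
        Matrix.mul_assoc K, hPY, Matrix.mul_assoc, hPY, e] at this
    have hΔ0 : 0 ≤ Δ := by linarith
    have h2 := norm_le_norm_of_posSemidef
      ((posSemidef_conjTranspose_mul_self Y).smul (a := (Δ : ℂ)) (by exact_mod_cast hΔ0)) h1
    rw [norm_smul, l2_opNorm_conjTranspose_mul_self] at h2
    have h3 : ‖Yᴴ * (Y * H + P' * R)‖ ≤ ‖Y‖ * (‖Y‖ * ‖H‖ + 1 * δ) := by
      refine (l2_opNorm_mul _ _).trans ?_
      rw [l2_opNorm_conjTranspose]
      gcongr
      refine (norm_add_le _ _).trans ?_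
      gcongr
      · exact l2_opNorm_mul _ _
      · exact (l2_opNorm_mul _ _).trans (by gcongr)
    have h4 : ‖(Δ : ℂ)‖ = Δ := by simp [abs_of_nonneg hΔ0]
    rw [h4] at h2
    by_contra hlt
    push Not at hlt
    have hy : 0 < ‖Y‖ := hδ0.trans_lt hlt
    have h5 : ‖Y‖ * (Δ * ‖Y‖) ≤ ‖Y‖ * (‖Y‖ * ‖H‖ + 1 * δ) := by linarith
    have h6 := le_of_mul_le_mul_left h5 hy
    nlinarith
  set W := P * T with hW
  have hWV : ‖W - V‖ ≤ 2 * δ := by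
    have : W - V = (T - V) - Y := by rw [hW, hY, hP', Matrix.sub_mul, Matrix.one_mul]; abel
    rw [this]
    exact (norm_sub_le _ _).trans (by linarith)
  have hW2 : ‖W‖ ≤ 2 := by
    have := norm_add_le (W - V) V
    rw [sub_add_cancel] at this
    linarith
  have hG : ‖Wᴴ * W - 1‖ ≤ 6 * δ := by
    have : Wᴴ * W - 1 = (W - V)ᴴ * W + Vᴴ * (W - V) := by
      rw [conjTranspose_sub, Matrix.sub_mul, Matrix.mul_sub, hV]; abel
    rw [this]
    refine (norm_add_le _ _).trans ?_
    have a1 : ‖(W - V)ᴴ * W‖ ≤ 2 * δ * 2 := by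
      refine (l2_opNorm_mul _ _).trans ?_
      rw [l2_opNorm_conjTranspose]
      gcongr
    have a2 : ‖Vᴴ * (W - V)‖ ≤ 1 * (2 * δ) := by
      refine (l2_opNorm_mul _ _).trans ?_
      rw [l2_opNorm_conjTranspose]
      gcongr
    linarith
  obtain ⟨F, hF, hFG, hF1⟩ := exists_inv_sqrt (isHermitian_conjTranspose_mul_self W)
    (by linarith : 6 * δ ≤ 1 / 2) hG
  have hF2 : ‖F‖ ≤ 2 := by
    have := norm_add_le (F - 1) 1
    rw [sub_add_cancel, norm_one] at this
    linarith
  have hPW : P * W = W := by rw [hW, ← Matrix.mul_assoc, hPP]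
  have hVtVt : (W * F)ᴴ * (W * F) = 1 := by
    rw [conjTranspose_mul, hF.eq, ← hFG]
    simp only [Matrix.mul_assoc]
  have hVtn := norm_le_one_of_isometry hVtVt
  have hproj : (W * F) * (W * F)ᴴ = P := by
    have hPVt : P * (W * F) = W * F := by rw [← Matrix.mul_assoc, hPW]
    set Q := P - (W * F) * (W * F)ᴴ with hQ
    have hVtP : (W * F)ᴴ * P = (W * F)ᴴ := by
      have := congrArg conjTranspose hPVt
      rwa [conjTranspose_mul, hP.eq] at this
    have hPQ : P * Q = Q := by
      rw [hQ, Matrix.mul_sub, hPP, ← Matrix.mul_assoc, hPVt]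
    have hVtQ : (W * F)ᴴ * Q = 0 := by
      rw [hQ, Matrix.mul_sub, hVtP, ← Matrix.mul_assoc, hVtVt, Matrix.one_mul, sub_self]
    have hWQ : Wᴴ * Q = 0 := by
      have h1 : (Wᴴ * W * F) * F = 1 := by
        rw [mul_eq_one_comm]
        simpa only [Matrix.mul_assoc] using hFG
      rw [conjTranspose_mul, hF.eq, Matrix.mul_assoc] at hVtQ
      rw [← Matrix.one_mul (Wᴴ * Q), ← h1, Matrix.mul_assoc, hVtQ, Matrix.mul_zero]
    have hTQ : Tᴴ * Q = 0 := by
      rwa [hW, conjTranspose_mul, hP.eq, Matrix.mul_assoc, hPQ] at hWQ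
    have := eq_zero_of_energy_le hK hPΔ hV hVT hδ hTV hR hΔ hΛ hgap hPQ hTQ
    rw [hQ, sub_eq_zero] at this
    exact this.symm
  refine ⟨W * F, hVtVt, ?_, hproj, ?_⟩
  · have : W * F - V = W * (F - 1) + (W - V) := by
      rw [Matrix.mul_sub, Matrix.mul_one]; abel
    rw [this]
    refine (norm_add_le _ _).trans ?_
    have : ‖W * (F - 1)‖ ≤ 2 * (6 * δ) := (l2_opNorm_mul _ _).trans (by gcongr)
    linarith
  · have e1 : K * (W * F) - (W * F) * H = W * (H * (F - 1) - (F - 1) * H) + P * R * F := by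
      have : K * W = W * H + P * R := by
        rw [hW, ← Matrix.mul_assoc, hPK, Matrix.mul_assoc, hKT, Matrix.mul_add, Matrix.mul_assoc]
      rw [← Matrix.mul_assoc, this]
      simp only [Matrix.mul_sub, Matrix.sub_mul, Matrix.add_mul, Matrix.mul_one, Matrix.one_mul,
        Matrix.mul_assoc]
      abel
    have e2 : K * P - W * F * H * (W * F)ᴴ = (K * (W * F) - (W * F) * H) * (W * F)ᴴ := by
      rw [Matrix.sub_mul, ← hproj]
      simp only [Matrix.mul_assoc]
    rw [e2, e1]
    have b1 : ‖W * (H * (F - 1) - (F - 1) * H)‖ ≤ 2 * (‖H‖ * (6 * δ) + (6 * δ) * ‖H‖) := by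
      refine (l2_opNorm_mul _ _).trans ?_
      gcongr
      refine (norm_sub_le _ _).trans ?_
      gcongr
      · exact (l2_opNorm_mul _ _).trans (by gcongr)
      · exact (l2_opNorm_mul _ _).trans (by gcongr)
    have b2 : ‖P * R * F‖ ≤ 1 * δ * 2 := by
      refine (l2_opNorm_mul _ _).trans ?_
      gcongr
      exact (l2_opNorm_mul _ _).trans (by gcongr)
    calc _ ≤ ‖W * (H * (F - 1) - (F - 1) * H) + P * R * F‖ * ‖(W * F)ᴴ‖ := l2_opNorm_mul _ _
      _ ≤ (2 * (‖H‖ * (6 * δ) + (6 * δ) * ‖H‖) + 1 * δ * 2) * 1 := by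
        rw [l2_opNorm_conjTranspose]
        gcongr
        exact (norm_add_le _ _).trans (add_le_add b1 b2)
      _ = _ := by ring

lemma posSemidef_add_norm_smul_one {A : Matrix M M ℂ} (hA : A.IsHermitian) :
    (A + (‖A‖ : ℂ) • (1 : Matrix M M ℂ)).PosSemidef := by
  have h := IsSelfAdjoint.neg_algebraMap_norm_le_self (a := A) hA
  rw [Matrix.le_iff] at h
  rw [sub_neg_eq_add, Algebra.algebraMap_eq_smul_one] at h
  exact h

set_option maxHeartbeats 2000000 in
/-- Second-order perturbation theory for `s² N + s B + C` with an explicit pseudo-inverse `Np` of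
the unperturbed Hamiltonian `N`, whose kernel is the range of `V`. -/
lemma exists_perturbative_simulation [Nonempty N] {N₀ Np B C : Matrix M M ℂ} {H : Matrix N N ℂ}
    {V : Matrix M N ℂ} (hN : N₀.IsHermitian) (hB : B.IsHermitian) (hC : C.IsHermitian)
    (hV : Vᴴ * V = 1) (hNV : N₀ * V = 0) (hNNp : N₀ * Np = 1 - V * Vᴴ) (hVNp : Vᴴ * Np = 0)
    (hNgap : (N₀ - (1 - V * Vᴴ)).PosSemidef) (hNBV : N₀ * (B * V) = B * V)
    (hH : H + Vᴴ * (B * (B * V)) = Vᴴ * (C * V)) {η ε : ℝ} (hη : 0 < η) (hε : 0 < ε) :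
    ∃ Δ₀ : ℝ, 0 < Δ₀ ∧ ∀ Δ : ℝ, Δ₀ ≤ Δ → ∃ s : ℝ, ∃ Vt : Matrix M N ℂ,
      Vtᴴ * Vt = 1 ∧ ‖Vt - V‖ ≤ η ∧
      Vt * Vtᴴ = lowEnergyProj (((s ^ 2 : ℝ) : ℂ) • N₀ + (s : ℂ) • B + C) Δ ∧
      ‖(((s ^ 2 : ℝ) : ℂ) • N₀ + (s : ℂ) • B + C) *
        lowEnergyProj (((s ^ 2 : ℝ) : ℂ) • N₀ + (s : ℂ) • B + C) Δ - Vt * H * Vtᴴ‖ ≤ ε := by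
  refine ⟨‖H‖ + 1, by positivity, fun Δ hΔ => ?_⟩
  set T₁ : Matrix M N ℂ := -(B * V) with hT₁
  set Rm : Matrix M N ℂ := V * H - C * V + B * (B * V) with hRm
  set T₂ : Matrix M N ℂ := Np * Rm with hT₂
  have hVT₁ : Vᴴ * T₁ = 0 := by
    have : Vᴴ * N₀ = 0 := by
      have := congrArg conjTranspose hNV
      rwa [conjTranspose_mul, hN.eq, conjTranspose_zero] at this
    rw [hT₁, ← hNBV, Matrix.mul_neg, ← Matrix.mul_assoc, this]
    simp
  have hVT₂ : Vᴴ * T₂ = 0 := by rw [hT₂, ← Matrix.mul_assoc, hVNp, Matrix.zero_mul]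
  have hNT₁ : N₀ * T₁ = -(B * V) := by rw [hT₁, Matrix.mul_neg, hNBV]
  have hVR : Vᴴ * Rm = 0 := by
    rw [hRm, Matrix.mul_add, Matrix.mul_sub, ← Matrix.mul_assoc, hV, Matrix.one_mul, ← hH]
    abel
  have hNT₂ : N₀ * T₂ = Rm := by
    rw [hT₂, ← Matrix.mul_assoc, hNNp, Matrix.sub_mul, Matrix.mul_assoc, hVR]
    simp
  set a := ‖T₁‖ + ‖T₂‖ with ha
  set b := ‖C * T₁ + B * T₂ - T₁ * H‖ + ‖C * T₂ - T₂ * H‖ with hb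
  set κ := min (1 / 20) (min (η / 14) (ε / (24 * ‖H‖ + 2))) with hκ
  have hh := norm_nonneg H
  have hκ0 : 0 < κ := by positivity
  have ha0 : 0 ≤ a := by positivity
  have hb0 : 0 ≤ b := by positivity
  set s : ℝ := 1 + (a + b) / κ + (8 * Δ + ‖B‖ + ‖C‖) with hs
  have hΔ0 : 0 ≤ Δ := by linarith
  have hs1 : 1 ≤ s := by
    have : 0 ≤ (a + b) / κ := by positivity
    linarith [norm_nonneg B, norm_nonneg C]
  have hs0 : (0 : ℝ) < s := by linarith
  have hsC : (s : ℂ) ≠ 0 := by exact_mod_cast hs0.ne'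
  have hsab : s⁻¹ * (a + b) ≤ κ := by
    rw [inv_mul_le_iff₀ hs0]
    have : (a + b) / κ ≤ s := by linarith [norm_nonneg B, norm_nonneg C]
    rwa [div_le_iff₀ hκ0] at this
  have hsΛ : 8 * Δ < s ^ 2 - s * ‖B‖ - ‖C‖ := by
    have h1 : 1 + 8 * Δ + ‖B‖ + ‖C‖ ≤ s := by
      have : 0 ≤ (a + b) / κ := by positivity
      linarith
    nlinarith [norm_nonneg B, norm_nonneg C]
  have hsn : ‖(s : ℂ)⁻¹‖ = s⁻¹ := by simp [abs_of_pos hs0]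
  have hsi : s⁻¹ * s⁻¹ ≤ s⁻¹ := by
    have := inv_le_one_of_one_le₀ hs1
    have : 0 ≤ s⁻¹ := by positivity
    nlinarith
  set K := ((s ^ 2 : ℝ) : ℂ) • N₀ + (s : ℂ) • B + C with hK
  have hKh : K.IsHermitian := by
    rw [hK]
    refine ((IsHermitian.add ?_ ?_).add hC)
    · rw [IsHermitian, conjTranspose_smul, hN.eq]; simp
    · rw [IsHermitian, conjTranspose_smul, hB.eq]; simp
  set T := V + (s : ℂ)⁻¹ • T₁ + ((s : ℂ)⁻¹ * (s : ℂ)⁻¹) • T₂ with hT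
  have hVT : Vᴴ * T = 1 := by
    rw [hT, Matrix.mul_add, Matrix.mul_add, Matrix.mul_smul, Matrix.mul_smul, hVT₁, hVT₂, hV]
    simp
  have hTV : ‖T - V‖ ≤ κ := by
    have : T - V = (s : ℂ)⁻¹ • T₁ + ((s : ℂ)⁻¹ * (s : ℂ)⁻¹) • T₂ := by rw [hT]; abel
    rw [this]
    calc _ ≤ s⁻¹ * ‖T₁‖ + s⁻¹ * s⁻¹ * ‖T₂‖ := by
          refine (norm_add_le _ _).trans ?_
          rw [norm_smul, norm_smul, norm_mul, hsn]
      _ ≤ s⁻¹ * ‖T₁‖ + s⁻¹ * ‖T₂‖ := by gcongr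
      _ = s⁻¹ * a := by ring
      _ ≤ s⁻¹ * (a + b) := by gcongr; linarith
      _ ≤ κ := hsab
  have hR : ‖K * T - T * H‖ ≤ κ := by
    have : K * T - T * H = (s : ℂ)⁻¹ • (C * T₁ + B * T₂ - T₁ * H) +
        ((s : ℂ)⁻¹ * (s : ℂ)⁻¹) • (C * T₂ - T₂ * H) := by
      have e : K * T - T * H = (s : ℂ) • (B * V + N₀ * T₁) + (B * T₁ + C * V + N₀ * T₂ - V * H) +
          (s : ℂ)⁻¹ • (C * T₁ + B * T₂ - T₁ * H) +
          ((s : ℂ)⁻¹ * (s : ℂ)⁻¹) • (C * T₂ - T₂ * H) := by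
        rw [hK, hT]
        simp only [Matrix.mul_add, Matrix.add_mul, Matrix.smul_mul, Matrix.mul_smul, hNV,
          smul_zero, smul_add, smul_sub, smul_smul]
        rw [show (s : ℂ)⁻¹ * (((s ^ 2 : ℝ) : ℂ)) = s by push_cast; field_simp,
          show (s : ℂ)⁻¹ * (s : ℂ)⁻¹ * (((s ^ 2 : ℝ) : ℂ)) = 1 by push_cast; field_simp,
          show (s : ℂ)⁻¹ * (s : ℂ) = 1 by field_simp,
          show (s : ℂ)⁻¹ * (s : ℂ)⁻¹ * s = (s : ℂ)⁻¹ by field_simp]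
        simp only [one_smul]
        abel
      rw [e, hNT₁, hNT₂, hRm, hT₁, Matrix.mul_neg]
      simp only [add_neg_cancel, smul_zero, zero_add]
      have : -(B * (B * V)) + C * V + (V * H - C * V + B * (B * V)) - V * H = 0 := by abel
      rw [this, zero_add]
    rw [this]
    calc _ ≤ s⁻¹ * ‖C * T₁ + B * T₂ - T₁ * H‖ + s⁻¹ * s⁻¹ * ‖C * T₂ - T₂ * H‖ := by
          refine (norm_add_le _ _).trans ?_
          rw [norm_smul, norm_smul, norm_mul, hsn]
      _ ≤ s⁻¹ * ‖C * T₁ + B * T₂ - T₁ * H‖ + s⁻¹ * ‖C * T₂ - T₂ * H‖ := by gcongr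
      _ = s⁻¹ * b := by ring
      _ ≤ s⁻¹ * (a + b) := by gcongr; linarith
      _ ≤ κ := hsab
  have hgap : ∀ w : Matrix M M ℂ, Vᴴ * w = 0 →
      (wᴴ * K * w - ((s ^ 2 - s * ‖B‖ - ‖C‖ : ℝ) : ℂ) • (wᴴ * w)).PosSemidef := by
    intro w hw
    have p1 := (hNgap.conjTranspose_mul_mul_same w).smul (a := ((s ^ 2 : ℝ) : ℂ))
      (by exact_mod_cast (by positivity : (0 : ℝ) ≤ s ^ 2))
    have p2 := ((posSemidef_add_norm_smul_one hB).conjTranspose_mul_mul_same w).smul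
      (a := (s : ℂ)) (by exact_mod_cast hs0.le)
    have p3 := (posSemidef_add_norm_smul_one hC).conjTranspose_mul_mul_same w
    have hw' : wᴴ * (V * Vᴴ) * w = 0 := by
      rw [Matrix.mul_assoc, Matrix.mul_assoc, hw]; simp
    convert (p1.add p2).add p3 using 1
    rw [hK]
    simp only [Matrix.mul_add, Matrix.add_mul, Matrix.mul_sub, Matrix.sub_mul, hw', sub_zero,
      Matrix.mul_one, Matrix.mul_smul, Matrix.smul_mul, smul_add, smul_sub]
    push_cast
    simp only [sub_smul, mul_smul]
    abel
  obtain ⟨Vt, h1, h2, h3, h4⟩ := exists_simulating_isometry hKh hV hVT (min_le_left _ _) hTV hR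
    hΔ hsΛ hgap
  refine ⟨s, Vt, h1, h2.trans ?_, h3, h4.trans ?_⟩
  · have : κ ≤ η / 14 := (min_le_right _ _).trans (min_le_left _ _)
    linarith
  · have : κ ≤ ε / (24 * ‖H‖ + 2) := (min_le_right _ _).trans (min_le_right _ _)
    rw [le_div_iff₀ (by positivity)] at this
    linarith

end PerturbationTheory

section PauliStrings

open Matrix

set_option linter.unusedSectionVars false

variable {ι : Type*} [Fintype ι] [DecidableEq ι]

noncomputable def pauliString (σ : ι → Matrix (Fin 2) (Fin 2) ℂ) : Matrix (ι → Fin 2) (ι → Fin 2) ℂ :=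
  Matrix.of fun f g => ∏ j, σ j (f j) (g j)

/-- The real span of the tensor products of `1`, `X`, `Z` with at most `k` nontrivial factors. -/
noncomputable def xzSpan (ι : Type*) [Fintype ι] [DecidableEq ι] (k : ℕ) :
    Submodule ℝ (Matrix (ι → Fin 2) (ι → Fin 2) ℂ) :=
  Submodule.span ℝ {A | ∃ σ : ι → Matrix (Fin 2) (Fin 2) ℂ,
    (∀ j, σ j = 1 ∨ σ j = PX ∨ σ j = PZ) ∧
    (Finset.univ.filter fun j => σ j ≠ 1).card ≤ k ∧ A = pauliString σ}

lemma isHermitian_of_mem_xzSpan {k : ℕ} {A : Matrix (ι → Fin 2) (ι → Fin 2) ℂ}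
    (hA : A ∈ xzSpan ι k) : A.IsHermitian := by
  induction hA using Submodule.span_induction with
  | mem A hA =>
    obtain ⟨σ, h1, -, rfl⟩ := hA
    ext f g
    simp only [pauliString, conjTranspose_apply, of_apply, star_prod]
    refine Finset.prod_congr rfl fun j _ => ?_
    have : (σ j)ᴴ = σ j := by
      rcases h1 j with h | h | h
      · rw [h, conjTranspose_one]
      · rw [h]; ext a b; fin_cases a <;> fin_cases b <;> simp [PX]
      · rw [h]; ext a b; fin_cases a <;> fin_cases b <;> simp [PZ]
    rw [← conjTranspose_apply, this]
  | zero => exact isHermitian_zero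
  | add A B _ _ hA hB => exact hA.add hB
  | smul c A _ hA =>
    rw [IsHermitian, conjTranspose_smul, hA.eq, star_trivial]

lemma fin_two_add_self (a : Fin 2) : a + a = 0 := by fin_cases a <;> rfl

lemma add_self_eq_zero_of_fin_two (u : ι → Fin 2) : u + u = 0 :=
  funext fun j => fin_two_add_self (u j)

/-- The tensor product of `X` over the qubits `j` with `u j = 1`. -/
noncomputable def bitFlip (u : ι → Fin 2) : Matrix (ι → Fin 2) (ι → Fin 2) ℂ :=
  Matrix.of fun f g => if f = g + u then 1 else 0

lemma bitFlip_eq_pauliString (u : ι → Fin 2) :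
    bitFlip u = pauliString fun j => if u j = 0 then 1 else PX := by
  ext f g
  have h : ∀ a b c : Fin 2, (if c = 0 then (1 : Matrix (Fin 2) (Fin 2) ℂ) else PX) a b =
      if a = b + c then 1 else 0 := by
    intro a b c
    fin_cases a <;> fin_cases b <;> fin_cases c <;> simp [PX]
  simp only [bitFlip, pauliString, of_apply, h, Finset.prod_boole, Finset.mem_univ, true_implies,
    funext_iff, Pi.add_apply]

lemma bitFlip_mem_xzSpan {u : ι → Fin 2} {S : Finset ι} (hu : ∀ j, j ∉ S → u j = 0) {k : ℕ}
    (hS : S.card ≤ k) : bitFlip u ∈ xzSpan ι k := by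
  rw [bitFlip_eq_pauliString]
  refine Submodule.subset_span ⟨_, fun j => ?_, (Finset.card_le_card fun j hj => ?_).trans hS, rfl⟩
  · split_ifs <;> simp
  · by_contra hjS
    simp [hu j hjS] at hj

lemma bitFlip_zero : bitFlip (0 : ι → Fin 2) = 1 := by
  ext f g
  simp [bitFlip, Matrix.one_apply]

lemma bitFlip_mul_self (u : ι → Fin 2) : bitFlip u * bitFlip u = 1 := by
  ext f g
  simp [bitFlip, Matrix.mul_apply, Matrix.one_apply, add_assoc, add_self_eq_zero_of_fin_two]

noncomputable def bitSign (a : Fin 2) : ℝ := if a = 0 then 1 else -1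

lemma diagonal_bitSign_eq_pauliString (R : Finset ι) :
    Matrix.diagonal (fun g : ι → Fin 2 => ((∏ j ∈ R, bitSign (g j) : ℝ) : ℂ)) =
      pauliString fun j => if j ∈ R then PZ else 1 := by
  ext f g
  have h : ∀ j, (if j ∈ R then PZ else (1 : Matrix (Fin 2) (Fin 2) ℂ)) (f j) (g j) =
      (if j ∈ R then ((bitSign (f j) : ℝ) : ℂ) else 1) * if f j = g j then 1 else 0 := by
    intro j
    split_ifs with h1 h2 h2
    · rw [h2]
      generalize g j = b
      fin_cases b <;> simp [PZ, bitSign]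
    · revert h2
      generalize g j = b
      generalize f j = a
      fin_cases b <;> fin_cases a <;> simp [PZ]
    · rw [h2, Matrix.one_apply_eq, one_mul]
    · rw [Matrix.one_apply_ne h2, mul_zero]
  simp only [pauliString, of_apply, h, Finset.prod_mul_distrib, Finset.prod_boole,
    Finset.mem_univ, true_implies, Finset.prod_ite_mem, Finset.univ_inter, diagonal_apply,
    funext_iff]
  split_ifs <;> simp

lemma mem_span_bitSign (S : Finset ι) (d : (ι → Fin 2) → ℝ)
    (hd : ∀ g g', (∀ j ∈ S, g j = g' j) → d g = d g') :
    d ∈ Submodule.span ℝ {e | ∃ R : Finset ι, R ⊆ S ∧ e = fun g => ∏ j ∈ R, bitSign (g j)} := by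
  induction S using Finset.induction_on generalizing d with
  | empty =>
    have : d = d 0 • fun _ => 1 := by
      ext g
      simpa using hd g 0 (by simp)
    rw [this]
    exact Submodule.smul_mem _ _ (Submodule.subset_span ⟨∅, by simp, by simp⟩)
  | insert a S ha ih =>
    set d₀ : (ι → Fin 2) → ℝ := fun g =>
      (d (Function.update g a 0) + d (Function.update g a 1)) / 2 with hd₀
    set d₁ : (ι → Fin 2) → ℝ := fun g =>
      (d (Function.update g a 0) - d (Function.update g a 1)) / 2 with hd₁
    have hup : ∀ (b : Fin 2) (g g' : ι → Fin 2), (∀ j ∈ S, g j = g' j) →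
        d (Function.update g a b) = d (Function.update g' a b) := by
      intro b g g' h
      apply hd
      intro j hj
      rcases eq_or_ne j a with rfl | hja
      · simp
      · simpa [hja] using h j (Finset.mem_of_mem_insert_of_ne hj hja)
    have hsum : d = d₀ + fun g => bitSign (g a) * d₁ g := by
      ext g
      have : g a = 0 ∨ g a = 1 := by
        generalize g a = b
        fin_cases b <;> simp
      rcases this with h | h
      · have e : Function.update g a 0 = g := by rw [← h, Function.update_eq_self]
        simp only [Pi.add_apply, hd₀, hd₁, e, h, bitSign]
        simp
        ring
      · have e : Function.update g a 1 = g := by rw [← h, Function.update_eq_self]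
        simp only [Pi.add_apply, hd₀, hd₁, e, h, bitSign]
        simp
        ring
    rw [hsum]
    apply Submodule.add_mem
    · refine Submodule.span_mono ?_ (ih d₀ fun g g' h => ?_)
      · rintro e ⟨R, hR, rfl⟩
        exact ⟨R, hR.trans (Finset.subset_insert _ _), rfl⟩
      · simp only [hd₀, hup _ _ _ h]
    · have h1 := ih d₁ fun g g' h => by simp only [hd₁, hup _ _ _ h]
      generalize d₁ = e at h1
      induction h1 using Submodule.span_induction with
      | mem e he =>
        obtain ⟨R, hR, rfl⟩ := he
        refine Submodule.subset_span ⟨insert a R, Finset.insert_subset_insert _ hR, ?_⟩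
        ext g
        rw [Finset.prod_insert fun h => ha (hR h)]
      | zero => simp only [Pi.zero_apply, mul_zero]; exact Submodule.zero_mem _
      | add x y _ _ hx hy =>
        convert Submodule.add_mem _ hx hy using 1
        ext g
        simp [mul_add]
      | smul c x _ hx =>
        convert Submodule.smul_mem _ c hx using 1
        ext g
        simp only [Pi.smul_apply, smul_eq_mul]
        ring

lemma diagonal_mem_xzSpan {S : Finset ι} {k : ℕ} (hS : S.card ≤ k) {d : (ι → Fin 2) → ℝ}
    (hd : ∀ g g', (∀ j ∈ S, g j = g' j) → d g = d g') :
    Matrix.diagonal (fun g => (d g : ℂ)) ∈ xzSpan ι k := by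
  have h := mem_span_bitSign S d hd
  clear hd
  induction h using Submodule.span_induction with
  | mem e he =>
    obtain ⟨R, hR, rfl⟩ := he
    rw [diagonal_bitSign_eq_pauliString]
    refine Submodule.subset_span ⟨_, fun j => ?_,
      (Finset.card_le_card fun j hj => ?_).trans hS, rfl⟩
    · split_ifs <;> simp
    · by_contra hjS
      have : j ∉ R := fun h => hjS (hR h)
      simp [this] at hj
  | zero => simp
  | add x y _ _ hx hy =>
    convert Submodule.add_mem _ hx hy using 1
    rw [diagonal_add]
    simp
  | smul c x _ hx =>
    convert Submodule.smul_mem _ c hx using 1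
    rw [← diagonal_smul]
    congr 1
    ext g
    simp

/-- `h` equals minus a sum of squares of elements of `xzSpan ι k`, up to an element of
`xzSpan ι k`. -/
def IsSumOfXZSquares (k : ℕ) (h : Matrix (ι → Fin 2) (ι → Fin 2) ℂ) : Prop :=
  ∃ L : List (Matrix (ι → Fin 2) (ι → Fin 2) ℂ), (∀ W ∈ L, W ∈ xzSpan ι k) ∧
    h + (L.map fun W => W * W).sum ∈ xzSpan ι k

lemma isSumOfXZSquares_zero (k : ℕ) :
    IsSumOfXZSquares k (0 : Matrix (ι → Fin 2) (ι → Fin 2) ℂ) :=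
  ⟨[], by simp, by simp⟩

lemma IsSumOfXZSquares.add {k : ℕ} {h h' : Matrix (ι → Fin 2) (ι → Fin 2) ℂ}
    (H : IsSumOfXZSquares k h) (H' : IsSumOfXZSquares k h') : IsSumOfXZSquares k (h + h') := by
  obtain ⟨L, hL, hs⟩ := H
  obtain ⟨L', hL', hs'⟩ := H'
  refine ⟨L ++ L', fun W hW => ?_, ?_⟩
  · rcases List.mem_append.mp hW with hW | hW
    exacts [hL W hW, hL' W hW]
  · rw [List.map_append, List.sum_append, add_add_add_comm]
    exact Submodule.add_mem _ hs hs'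

lemma isSumOfXZSquares_sum {α : Type*} (s : Finset α) {k : ℕ}
    {h : α → Matrix (ι → Fin 2) (ι → Fin 2) ℂ} (H : ∀ a ∈ s, IsSumOfXZSquares k (h a)) :
    IsSumOfXZSquares k (∑ a ∈ s, h a) :=
  Finset.sum_induction _ _ (fun _ _ => IsSumOfXZSquares.add) (isSumOfXZSquares_zero k) H

lemma isSumOfXZSquares_bitFlip_mul_diagonal {S : Finset ι} {k : ℕ} (hS : S.card ≤ k)
    {u : ι → Fin 2} (hu : ∀ j, j ∉ S → u j = 0) {d : (ι → Fin 2) → ℝ}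
    (hd : ∀ g g', (∀ j ∈ S, g j = g' j) → d g = d g') (hdu : ∀ g, d (g + u) = d g) :
    IsSumOfXZSquares k (bitFlip u * Matrix.diagonal fun g => (d g : ℂ)) := by
  have hcomm : (Matrix.diagonal fun g => (d g : ℂ)) * bitFlip u =
      bitFlip u * Matrix.diagonal fun g => (d g : ℂ) := by
    ext f g
    rw [diagonal_mul, mul_diagonal]
    simp only [bitFlip, of_apply]
    split_ifs with h
    · rw [h, hdu, mul_comm]
    · simp
  have hhalf : ((Matrix.diagonal fun g => ((d g / 2 : ℝ) : ℂ)) : Matrix (ι → Fin 2) (ι → Fin 2) ℂ)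
      = (1 / 2 : ℂ) • Matrix.diagonal fun g => (d g : ℂ) := by
    rw [← diagonal_smul]
    congr 1
    ext g
    simp only [Pi.smul_apply, smul_eq_mul]
    push_cast
    ring
  refine ⟨[bitFlip u - Matrix.diagonal fun g => ((d g / 2 : ℝ) : ℂ)], ?_, ?_⟩
  · intro W hW
    rw [List.mem_singleton.mp hW]
    exact Submodule.sub_mem _ (bitFlip_mem_xzSpan hu hS)
      (diagonal_mem_xzSpan hS fun g g' h => by rw [hd g g' h])
  · have e : (bitFlip u * Matrix.diagonal fun g => (d g : ℂ)) +
        (bitFlip u - Matrix.diagonal fun g => ((d g / 2 : ℝ) : ℂ)) *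
        (bitFlip u - Matrix.diagonal fun g => ((d g / 2 : ℝ) : ℂ)) =
        Matrix.diagonal fun g => ((1 + (d g / 2) * (d g / 2) : ℝ) : ℂ) := by
      rw [Matrix.sub_mul, Matrix.mul_sub, Matrix.mul_sub, bitFlip_mul_self, diagonal_mul_diagonal,
        hhalf, Matrix.smul_mul, Matrix.mul_smul, hcomm,
        show (Matrix.diagonal fun g => ((1 + (d g / 2) * (d g / 2) : ℝ) : ℂ)) =
          (1 : Matrix (ι → Fin 2) (ι → Fin 2) ℂ) +
            Matrix.diagonal fun g => ((d g / 2 : ℝ) : ℂ) * ((d g / 2 : ℝ) : ℂ) by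
          rw [← diagonal_one, diagonal_add]; push_cast; rfl]
      module
    simp only [List.map_cons, List.map_nil, List.sum_cons, List.sum_nil, add_zero]
    rw [e]
    exact diagonal_mem_xzSpan hS fun g g' h => by rw [hd g g' h]

lemma actsWithin.apply_eq_zero {S : Finset ι} {A : Matrix (ι → Fin 2) (ι → Fin 2) ℂ}
    (hA : actsWithin S A) {f g : ι → Fin 2} {j : ι} (hj : j ∉ S) (hfg : f j ≠ g j) :
    A f g = 0 := by
  obtain ⟨B, rfl⟩ := hA
  rw [of_apply, Finset.prod_eq_zero (Finset.mem_compl.mpr hj) (if_neg hfg), mul_zero]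

lemma actsWithin.apply_congr {S : Finset ι} {A : Matrix (ι → Fin 2) (ι → Fin 2) ℂ}
    (hA : actsWithin S A) {u : ι → Fin 2} (hu : ∀ j, j ∉ S → u j = 0) {g g' : ι → Fin 2}
    (h : ∀ j ∈ S, g j = g' j) : A (g + u) g = A (g' + u) g' := by
  obtain ⟨B, rfl⟩ := hA
  simp only [of_apply, Pi.add_apply]
  congr 1
  · congr 1
    · ext x; rw [h x x.2]
    · ext x; rw [h x x.2]
  · rw [Finset.prod_eq_one, Finset.prod_eq_one]
    all_goals
      intro j hj
      exact if_pos (by rw [hu j (Finset.mem_compl.mp hj), add_zero])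

lemma actsWithin.isSumOfXZSquares_re {S : Finset ι} {k : ℕ} (hS : S.card ≤ k)
    {A : Matrix (ι → Fin 2) (ι → Fin 2) ℂ} (hA : actsWithin S A) (hAh : A.IsHermitian) :
    IsSumOfXZSquares k (A.map fun z => ((z.re : ℝ) : ℂ)) := by
  have hsymm : ∀ f g, (A f g).re = (A g f).re := by
    intro f g
    rw [← hAh.apply f g]
    simp
  have hdec : A.map (fun z => ((z.re : ℝ) : ℂ)) = ∑ u : ι → Fin 2,
      bitFlip u * Matrix.diagonal fun g => (((A (g + u) g).re : ℝ) : ℂ) := by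
    ext f g
    rw [Matrix.sum_apply, Finset.sum_eq_single (g + f)]
    · simp [mul_diagonal, bitFlip, ← add_assoc, add_self_eq_zero_of_fin_two]
    · intro u _ hu
      rw [mul_diagonal, bitFlip, of_apply, if_neg, zero_mul]
      rintro rfl
      apply hu
      rw [← add_assoc, add_self_eq_zero_of_fin_two, zero_add]
    · simp
  rw [hdec]
  refine isSumOfXZSquares_sum _ fun u _ => ?_
  by_cases hu : ∀ j, j ∉ S → u j = 0
  · refine isSumOfXZSquares_bitFlip_mul_diagonal hS hu (fun g g' h => ?_) fun g => ?_
    · rw [hA.apply_congr hu h]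
    · rw [add_assoc, add_self_eq_zero_of_fin_two, add_zero, hsymm]
  · push Not at hu
    obtain ⟨j, hj, huj⟩ := hu
    have : ∀ g : ι → Fin 2, A (g + u) g = 0 := fun g =>
      hA.apply_eq_zero hj (by simpa using huj)
    simp only [this]
    simpa using isSumOfXZSquares_zero k

lemma IsKLocal.isSumOfXZSquares {k : ℕ} {H : Matrix (ι → Fin 2) (ι → Fin 2) ℂ}
    (hloc : IsKLocal k H) (hreal : ∀ i j, (H i j).im = 0) : IsSumOfXZSquares k H := by
  obtain ⟨T, h, hh, rfl⟩ := hloc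
  have : ∑ t, h t = ∑ t, (h t).map fun z => ((z.re : ℝ) : ℂ) := by
    ext f g
    have h1 : ((∑ t, h t) f g) = ((((∑ t, h t) f g).re : ℝ) : ℂ) :=
      Complex.ext (by simp) (by simpa using hreal f g)
    rw [h1]
    simp [Matrix.sum_apply]
  rw [this]
  refine isSumOfXZSquares_sum _ fun t _ => ?_
  obtain ⟨hherm, S, hS, hact⟩ := hh t
  exact hact.isSumOfXZSquares_re hS hherm

end PauliStrings

section Ancillas

open Matrix

set_option linter.unusedSectionVars false

variable {α β : Type*} [Fintype α] [DecidableEq α] [Fintype β] [DecidableEq β]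

/-- The tensor product of an operator on the qubits `α` and one on the qubits `β`. -/
noncomputable def qubitTensor (A : Matrix (α → Fin 2) (α → Fin 2) ℂ)
    (E : Matrix (β → Fin 2) (β → Fin 2) ℂ) : Matrix (α ⊕ β → Fin 2) (α ⊕ β → Fin 2) ℂ :=
  Matrix.of fun f g => A (f ∘ Sum.inl) (g ∘ Sum.inl) * E (f ∘ Sum.inr) (g ∘ Sum.inr)

lemma qubitTensor_pauliString (σ : α → Matrix (Fin 2) (Fin 2) ℂ)
    (τ : β → Matrix (Fin 2) (Fin 2) ℂ) :
    qubitTensor (pauliString σ) (pauliString τ) = pauliString (Sum.elim σ τ) := by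
  ext f g
  simp [qubitTensor, pauliString, Fintype.prod_sum_type]

lemma qubitTensor_mem_xzSpan {k l : ℕ} {A : Matrix (α → Fin 2) (α → Fin 2) ℂ}
    {E : Matrix (β → Fin 2) (β → Fin 2) ℂ} (hA : A ∈ xzSpan α k) (hE : E ∈ xzSpan β l) :
    qubitTensor A E ∈ xzSpan (α ⊕ β) (k + l) := by
  induction hA using Submodule.span_induction with
  | mem A hA =>
    obtain ⟨σ, hσ, hσk, rfl⟩ := hA
    induction hE using Submodule.span_induction with
    | mem E hE =>
      obtain ⟨τ, hτ, hτl, rfl⟩ := hE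
      rw [qubitTensor_pauliString]
      refine Submodule.subset_span ⟨_, ?_, ?_, rfl⟩
      · rintro (j | j)
        exacts [hσ j, hτ j]
      · refine (le_of_eq ?_).trans (Nat.add_le_add hσk hτl)
        simp only [Finset.card_filter, Fintype.sum_sum_type, Sum.elim_inl, Sum.elim_inr]
        congr!
    | zero =>
      convert Submodule.zero_mem _
      ext f g
      simp [qubitTensor]
    | add x y _ _ hx hy =>
      convert Submodule.add_mem _ hx hy
      ext f g
      simp [qubitTensor, mul_add]
    | smul c x _ hx =>
      convert Submodule.smul_mem _ c hx
      ext f g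
      simp [qubitTensor, mul_left_comm]
  | zero =>
    convert Submodule.zero_mem _
    ext f g
    simp [qubitTensor]
  | add x y _ _ hx hy =>
    convert Submodule.add_mem _ hx hy
    ext f g
    simp [qubitTensor, add_mul]
  | smul c x _ hx =>
    convert Submodule.smul_mem _ c hx
    ext f g
    simp [qubitTensor, mul_assoc]

lemma one_mem_xzSpan (k : ℕ) : (1 : Matrix (α → Fin 2) (α → Fin 2) ℂ) ∈ xzSpan α k := by
  rw [← bitFlip_zero]
  exact bitFlip_mem_xzSpan (S := ∅) (by simp) (by simp)

/-- The isometry `|ψ⟩ ↦ |ψ⟩ ⊗ |b⟩` for a computational basis state `|b⟩` of the ancillas. -/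
noncomputable def attach (α : Type*) [Fintype α] [DecidableEq α] (b : β → Fin 2) :
    Matrix (α ⊕ β → Fin 2) (α → Fin 2) ℂ :=
  Matrix.of fun g f => if g = Sum.elim f b then 1 else 0

lemma eq_sumElim_iff {g : α ⊕ β → Fin 2} {f : α → Fin 2} {b : β → Fin 2} :
    g = Sum.elim f b ↔ g ∘ Sum.inl = f ∧ g ∘ Sum.inr = b := by
  constructor
  · rintro rfl
    simp
  · rintro ⟨rfl, rfl⟩
    simp

lemma mul_attach_apply {γ : Type*} (A : Matrix γ (α ⊕ β → Fin 2) ℂ) (b : β → Fin 2) (g : γ)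
    (f : α → Fin 2) : (A * attach α b) g f = A g (Sum.elim f b) := by
  simp [Matrix.mul_apply, attach]

lemma attach_mul_apply {γ : Type*} (A : Matrix (α → Fin 2) γ ℂ) (b : β → Fin 2)
    (g : α ⊕ β → Fin 2) (f : γ) :
    (attach α b * A) g f = if g ∘ Sum.inr = b then A (g ∘ Sum.inl) f else 0 := by
  simp only [Matrix.mul_apply, attach, of_apply, eq_sumElim_iff]
  split_ifs with h <;> simp [h]

lemma attach_conjTranspose_mul (b b' : β → Fin 2) :
    (attach α b)ᴴ * attach α b' = if b = b' then 1 else 0 := by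
  ext f f'
  rw [mul_attach_apply, conjTranspose_apply]
  simp only [attach, of_apply, eq_sumElim_iff, Sum.elim_comp_inl, Sum.elim_comp_inr]
  by_cases h : b = b'
  · subst h
    simp [Matrix.one_apply, eq_comm, apply_ite]
  · simp [h, Ne.symm h]

lemma qubitTensor_bitFlip_mul_attach (A : Matrix (α → Fin 2) (α → Fin 2) ℂ) (u b : β → Fin 2) :
    qubitTensor A (bitFlip u) * attach α b = attach α (b + u) * A := by
  ext g f
  rw [mul_attach_apply, attach_mul_apply]
  simp only [qubitTensor, bitFlip, of_apply, Sum.elim_comp_inl, Sum.elim_comp_inr, mul_ite,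
    mul_one, mul_zero]
  congr

/-- The number of excited ancillas. -/
noncomputable def excitations (b : β → Fin 2) : ℝ := ∑ j, if b j = 0 then 0 else 1

lemma excitations_zero : excitations (0 : β → Fin 2) = 0 := by simp [excitations]

lemma excitations_single (a : β) : excitations (Pi.single a 1 : β → Fin 2) = 1 := by
  rw [excitations, Finset.sum_eq_single a] <;> simp +contextual

lemma one_le_excitations {b : β → Fin 2} (hb : b ≠ 0) : 1 ≤ excitations b := by
  obtain ⟨j, hj⟩ := Function.ne_iff.mp hb
  rw [excitations]
  refine le_trans ?_ (Finset.single_le_sum (f := fun j => if b j = 0 then (0 : ℝ) else 1)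
    (fun i _ => ?_) (Finset.mem_univ j))
  · have : b j ≠ 0 := hj
    simp [this]
  · split_ifs <;> simp

noncomputable def numberOp (α β : Type*) [Fintype α] [DecidableEq α] [Fintype β] [DecidableEq β] :
    Matrix (α ⊕ β → Fin 2) (α ⊕ β → Fin 2) ℂ :=
  Matrix.diagonal fun g => (excitations (g ∘ Sum.inr) : ℂ)

lemma numberOp_mul_attach (b : β → Fin 2) :
    numberOp α β * attach α b = (excitations b : ℂ) • attach α b := by
  ext g f
  rw [numberOp, diagonal_mul, Matrix.smul_apply, attach, of_apply]
  split_ifs with h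
  · subst h
    simp
  · simp

lemma numberOp_mem_xzSpan {k : ℕ} (hk : 1 ≤ k) : numberOp α β ∈ xzSpan (α ⊕ β) k := by
  have : numberOp α β = ∑ j : β, Matrix.diagonal fun g : α ⊕ β → Fin 2 =>
      (((if g (Sum.inr j) = 0 then 0 else 1 : ℝ)) : ℂ) := by
    ext f g
    rw [Matrix.sum_apply, numberOp]
    simp only [diagonal_apply]
    split_ifs with h
    · simp [excitations]
    · simp
  rw [this]
  refine Submodule.sum_mem _ fun j _ => diagonal_mem_xzSpan (S := {Sum.inr j}) (by simpa using hk)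
    fun g g' h => ?_
  rw [h _ (Finset.mem_singleton_self _)]

lemma attach_zero_mul_conjTranspose :
    attach α (0 : β → Fin 2) * (attach α (0 : β → Fin 2))ᴴ =
      Matrix.diagonal fun g => if g ∘ Sum.inr = 0 then 1 else 0 := by
  ext g g'
  rw [attach_mul_apply, conjTranspose_apply]
  simp only [attach, of_apply, diagonal_apply, eq_sumElim_iff]
  by_cases h : g = g'
  · subst h
    by_cases h0 : g ∘ Sum.inr = 0 <;> simp [h0]
  · rw [if_neg h]
    split_ifs with h1 h2
    · exfalso
      apply h
      rw [← Sum.elim_comp_inl_inr g, ← Sum.elim_comp_inl_inr g', h1, h2.1, h2.2]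
    · simp
    · rfl

end Ancillas

section Simulation

open Matrix

open scoped Matrix.Norms.L2Operator

variable {α β : Type*} [Fintype α] [DecidableEq α] [Fintype β] [DecidableEq β]

/-- The interaction in which each operator `W a` flips its own ancilla. -/
noncomputable def flipInteraction (W : β → Matrix (α → Fin 2) (α → Fin 2) ℂ) :
    Matrix (α ⊕ β → Fin 2) (α ⊕ β → Fin 2) ℂ :=
  ∑ a, qubitTensor (W a) (bitFlip (Pi.single a 1))

lemma flipInteraction_mem_xzSpan {k : ℕ} {W : β → Matrix (α → Fin 2) (α → Fin 2) ℂ}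
    (hW : ∀ a, W a ∈ xzSpan α k) : flipInteraction W ∈ xzSpan (α ⊕ β) (k + 1) := by
  refine Submodule.sum_mem _ fun a _ => qubitTensor_mem_xzSpan (hW a) ?_
  refine bitFlip_mem_xzSpan (S := {a}) (fun j hj => ?_) (by simp)
  simp only [Finset.mem_singleton] at hj
  simp [hj]

lemma flipInteraction_mul_attach (W : β → Matrix (α → Fin 2) (α → Fin 2) ℂ) :
    flipInteraction W * attach α (0 : β → Fin 2) = ∑ a, attach α (Pi.single a 1) * W a := by
  simp only [flipInteraction, Matrix.sum_mul, qubitTensor_bitFlip_mul_attach, zero_add]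

lemma conjTranspose_flipInteraction_mul_attach_mul {k : ℕ}
    {W : β → Matrix (α → Fin 2) (α → Fin 2) ℂ} (hW : ∀ a, W a ∈ xzSpan α k) :
    (attach α (0 : β → Fin 2))ᴴ * (flipInteraction W * (flipInteraction W * attach α (0 : β → Fin 2))) =
      ∑ a, W a * W a := by
  have hB := (isHermitian_of_mem_xzSpan (flipInteraction_mem_xzSpan hW)).eq
  have : (attach α (0 : β → Fin 2))ᴴ * (flipInteraction W * (flipInteraction W * attach α (0 : β → Fin 2))) =
      (flipInteraction W * attach α (0 : β → Fin 2))ᴴ * (flipInteraction W * attach α (0 : β → Fin 2)) := by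
    rw [conjTranspose_mul, hB, Matrix.mul_assoc]
  rw [this, flipInteraction_mul_attach, conjTranspose_sum, Matrix.sum_mul]
  refine Finset.sum_congr rfl fun a _ => ?_
  rw [Matrix.mul_sum, Finset.sum_eq_single a]
  · rw [conjTranspose_mul, Matrix.mul_assoc, ← Matrix.mul_assoc _ _ (W a),
      attach_conjTranspose_mul, if_pos rfl, Matrix.one_mul, (isHermitian_of_mem_xzSpan (hW a)).eq]
  · intro b _ hb
    have hne : (Pi.single a 1 : β → Fin 2) ≠ Pi.single b 1 := by
      intro h
      have := congrFun h a
      rw [Pi.single_eq_same, Pi.single_eq_of_ne hb.symm] at this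
      exact one_ne_zero this
    rw [conjTranspose_mul, Matrix.mul_assoc, ← Matrix.mul_assoc _ _ (W b),
      attach_conjTranspose_mul, if_neg hne, Matrix.zero_mul, Matrix.mul_zero]
  · simp

lemma numberOp_mul_flipInteraction_mul_attach (W : β → Matrix (α → Fin 2) (α → Fin 2) ℂ) :
    numberOp α β * (flipInteraction W * attach α (0 : β → Fin 2)) = flipInteraction W * attach α (0 : β → Fin 2) := by
  simp only [flipInteraction_mul_attach, Matrix.mul_sum, ← Matrix.mul_assoc,
    numberOp_mul_attach, excitations_single, Complex.ofReal_one, one_smul]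

lemma isHermitian_numberOp : (numberOp α β).IsHermitian :=
  isHermitian_of_mem_xzSpan (numberOp_mem_xzSpan le_rfl)

lemma one_sub_attach_zero_mul_conjTranspose :
    1 - attach α (0 : β → Fin 2) * (attach α (0 : β → Fin 2))ᴴ =
      Matrix.diagonal fun g => if g ∘ Sum.inr = 0 then 0 else 1 := by
  rw [attach_zero_mul_conjTranspose, ← diagonal_one, diagonal_sub]
  congr 1
  ext g
  split_ifs <;> simp

lemma numberOp_mul_diagonal_inv :
    numberOp α β * Matrix.diagonal (fun g : α ⊕ β → Fin 2 => ((excitations (g ∘ Sum.inr))⁻¹ : ℂ)) =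
      1 - attach α (0 : β → Fin 2) * (attach α (0 : β → Fin 2))ᴴ := by
  rw [one_sub_attach_zero_mul_conjTranspose, numberOp, diagonal_mul_diagonal]
  congr 1
  ext g
  split_ifs with h
  · simp [h, excitations_zero]
  · have := one_le_excitations h
    refine mul_inv_cancel₀ ?_
    exact_mod_cast (by linarith : excitations (g ∘ Sum.inr) ≠ 0)

lemma posSemidef_numberOp_sub :
    (numberOp α β - (1 - attach α (0 : β → Fin 2) * (attach α (0 : β → Fin 2))ᴴ)).PosSemidef := by
  rw [one_sub_attach_zero_mul_conjTranspose, numberOp, diagonal_sub]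
  refine PosSemidef.diagonal fun g => ?_
  simp only [Pi.zero_apply]
  split_ifs with h
  · simp [h, excitations_zero]
  · have := one_le_excitations h
    rw [sub_nonneg]
    exact_mod_cast this

lemma attach_zero_conjTranspose_mul_diagonal_inv :
    (attach α (0 : β → Fin 2))ᴴ *
      Matrix.diagonal (fun g : α ⊕ β → Fin 2 => ((excitations (g ∘ Sum.inr))⁻¹ : ℂ)) = 0 := by
  ext f g
  rw [mul_diagonal, conjTranspose_apply, attach, of_apply]
  split_ifs with h
  · simp [h, excitations_zero]
  · simp

/-- An operator of the form `C - ∑ W ^ 2` is simulated by XZ Hamiltonians. -/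
lemma IsSumOfXZSquares.exists_simulation {k : ℕ} {H : Matrix (α → Fin 2) (α → Fin 2) ℂ}
    (hH : IsSumOfXZSquares k H) {η ε : ℝ} (hη : 0 < η) (hε : 0 < ε) :
    ∃ r : ℕ, ∃ Δ₀ : ℝ, 0 < Δ₀ ∧ ∀ Δ : ℝ, Δ₀ ≤ Δ → ∃ K ∈ xzSpan (α ⊕ Fin r) (k + 1),
      ∃ Vt : Matrix (α ⊕ Fin r → Fin 2) (α → Fin 2) ℂ,
        Vtᴴ * Vt = 1 ∧ opNorm (Vt - attach α 0) ≤ η ∧ Vt * Vtᴴ = lowEnergyProj K Δ ∧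
        opNorm (K * lowEnergyProj K Δ - Vt * H * Vtᴴ) ≤ ε := by
  obtain ⟨L, hL, hC⟩ := hH
  have hW : ∀ a, L.get a ∈ xzSpan α k := fun a => hL _ (List.get_mem _ _)
  have hsum : (L.map fun W => W * W).sum = ∑ a, L.get a * L.get a := by
    rw [← Fin.sum_univ_fun_getElem]
    rfl
  set C := H + (L.map fun W => W * W).sum with hC_def
  have hB := flipInteraction_mem_xzSpan hW
  have hC1 : qubitTensor C (1 : Matrix (Fin L.length → Fin 2) _ ℂ) ∈
      xzSpan (α ⊕ Fin L.length) (k + 1) :=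
    qubitTensor_mem_xzSpan hC (one_mem_xzSpan 1)
  obtain ⟨Δ₀, hΔ₀, h⟩ := exists_perturbative_simulation (H := H) isHermitian_numberOp
    (isHermitian_of_mem_xzSpan hB) (isHermitian_of_mem_xzSpan hC1)
    (V := attach α (0 : Fin L.length → Fin 2))
    (by rw [attach_conjTranspose_mul, if_pos rfl])
    (by rw [numberOp_mul_attach, excitations_zero, Complex.ofReal_zero, zero_smul])
    numberOp_mul_diagonal_inv attach_zero_conjTranspose_mul_diagonal_inv posSemidef_numberOp_sub
    (numberOp_mul_flipInteraction_mul_attach _)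
    (by
      rw [conjTranspose_flipInteraction_mul_attach_mul hW, ← bitFlip_zero,
        qubitTensor_bitFlip_mul_attach, add_zero, ← Matrix.mul_assoc, attach_conjTranspose_mul,
        if_pos rfl, Matrix.one_mul, hC_def, hsum]) hη hε
  refine ⟨L.length, Δ₀, hΔ₀, fun Δ hΔ => ?_⟩
  obtain ⟨s, Vt, h1, h2, h3, h4⟩ := h Δ hΔ
  refine ⟨_, ?_, Vt, h1, h2, h3, h4⟩
  simp only [Complex.coe_smul]
  exact Submodule.add_mem _ (Submodule.add_mem _
    (Submodule.smul_mem _ _ (numberOp_mem_xzSpan (by omega))) (Submodule.smul_mem _ _ hB)) hC1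

lemma exists_eq_sum_of_mem_xzSpan {k : ℕ} {A : Matrix (α → Fin 2) (α → Fin 2) ℂ}
    (hA : A ∈ xzSpan α k) :
    ∃ (T : ℕ) (c : Fin T → ℝ) (σ : Fin T → α → Matrix (Fin 2) (Fin 2) ℂ),
      (∀ t j, σ t j = 1 ∨ σ t j = PX ∨ σ t j = PZ) ∧
      (∀ t, (Finset.univ.filter fun j => σ t j ≠ 1).card ≤ k) ∧
      A = ∑ t, c t • Matrix.of fun f g => ∏ j, σ t j (f j) (g j) := by
  obtain ⟨T, c, g, rfl⟩ := (Submodule.mem_span_set' ..).mp hA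
  choose σ h1 h2 h3 using fun t => (g t).2
  refine ⟨T, c, σ, h1, h2, Finset.sum_congr rfl fun t _ => ?_⟩
  rw [h3 t, pauliString]

/-- Attaching all-zero ancillas, written as a tensor product of one-qubit states. -/
lemma attach_zero_eq :
    attach α (0 : β → Fin 2) = Matrix.of fun (g : α ⊕ β → Fin 2) (f : α → Fin 2) =>
      (if (fun j : α => g (Sum.inl j)) = f then (1 : ℂ) else 0) *
        ∏ j : β, (Pi.single 0 1 : Fin 2 → ℂ) (g (Sum.inr j)) := by
  ext g f
  have hprod : ∏ j : β, (Pi.single 0 1 : Fin 2 → ℂ) (g (Sum.inr j)) =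
      if g ∘ Sum.inr = 0 then 1 else 0 := by
    simp only [Pi.single_apply, Finset.prod_boole, Finset.mem_univ, true_imp_iff, funext_iff,
      Function.comp_apply, Pi.zero_apply]
  have hinl : ((fun j : α => g (Sum.inl j)) = f) = (g ∘ Sum.inl = f) := rfl
  simp only [attach, of_apply, hprod, eq_sumElim_iff, hinl]
  by_cases h1 : g ∘ Sum.inl = f <;> by_cases h2 : g ∘ Sum.inr = 0 <;> simp [h1, h2]

end Simulation

/-- Any real `k`-local qubit Hamiltonian can be simulated, to any precision `(η, ε)`
and any sufficiently large cutoff `Δ`, by a `(k+1)`-local Hamiltonian whose Pauli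
decomposition contains no `Y` factors, with the encoding isometry
`V|ψ⟩ = |ψ⟩ ⊗ |φ⟩` attaching a product state `|φ⟩` of the ancilla qubits.  Here the
`m = n + r` simulator qubits are indexed by `Fin n ⊕ Fin r`, with `Sum.inl` labelling
the original qubits and `Sum.inr` the ancillas. -/
theorem no_Y_Hamiltonians_simulate_real_Hamiltonians
    {n k : ℕ} (H : Matrix (Fin n → Fin 2) (Fin n → Fin 2) ℂ)
    (hH : H.IsHermitian) (hreal : ∀ i j, (H i j).im = 0) (hloc : IsKLocal k H)
    (η ε : ℝ) (hη : 0 < η) (hε : 0 < ε) :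
    ∃ Δ₀ : ℝ, 0 < Δ₀ ∧ ∀ Δ : ℝ, Δ₀ ≤ Δ →
      ∃ (r : ℕ)
        (H' : Matrix ((Fin n ⊕ Fin r) → Fin 2) ((Fin n ⊕ Fin r) → Fin 2) ℂ)
        (T : ℕ) (c : Fin T → ℝ)
        (σ : Fin T → (Fin n ⊕ Fin r) → Matrix (Fin 2) (Fin 2) ℂ)
        (φ : Fin r → Fin 2 → ℂ)
        (Vt : Matrix ((Fin n ⊕ Fin r) → Fin 2) (Fin n → Fin 2) ℂ),
        H'.IsHermitian ∧
        (∀ t j, σ t j = 1 ∨ σ t j = PX ∨ σ t j = PZ) ∧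
        (∀ t, (Finset.univ.filter fun j => σ t j ≠ 1).card ≤ k + 1) ∧
        (H' = ∑ t, c t • Matrix.of fun f g => ∏ j, σ t j (f j) (g j)) ∧
        (∀ j, star (φ j) ⬝ᵥ φ j = 1) ∧
        Vtᴴ * Vt = 1 ∧
        opNorm (Vt - Matrix.of fun (g : (Fin n ⊕ Fin r) → Fin 2) (f : Fin n → Fin 2) =>
          (if (fun j : Fin n => g (Sum.inl j)) = f then (1 : ℂ) else 0) *
            ∏ j : Fin r, φ j (g (Sum.inr j))) ≤ η ∧
        Vt * Vtᴴ = lowEnergyProj H' Δ ∧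
        opNorm (H' * lowEnergyProj H' Δ - Vt * H * Vtᴴ) ≤ ε := by
  obtain ⟨r, Δ₀, hΔ₀, h⟩ := (hloc.isSumOfXZSquares hreal).exists_simulation hη hε
  refine ⟨Δ₀, hΔ₀, fun Δ hΔ => ?_⟩
  obtain ⟨K, hK, Vt, h1, h2, h3, h4⟩ := h Δ hΔ
  obtain ⟨T, c, σ, hσ, hσk, hsum⟩ := exists_eq_sum_of_mem_xzSpan hK
  refine ⟨r, K, T, c, σ, fun _ => Pi.single 0 1, Vt, isHermitian_of_mem_xzSpan hK, hσ, hσk,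
    hsum, fun _ => by simp, h1, ?_, h3, h4⟩
  rw [attach_zero_eq] at h2
  convert h2
end
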